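/- Let A^(0), A^(1) ∈ (0,∞)^E, let μ_s := μ_{v0,A^(s)}, and let P_s^(T) be the ERRW trajectory law on V^{T+1} with initial weights A^(s), for s ∈ {0,1}. Define Gap_T := D(μ_0 ‖ μ_1) − D(P_0^(T) ‖ P_1^(T)) and ā := min_{e∈E} min{a_e^(0), a_e^(1)} > 0. (i) If 0 < ā ≤ 4 + 2√5, then for every r with 0 < r < min{ā/8, 3/4} there exists a finite constant C_r, depending only on G, v0, A^(0), A^(1), r, such that Gap_T ≤ C_r · T^{−r} for all T ≥ 1. (ii) If ā > 4 + 2√5, then there exists a finite constant C, depending only on G, v0, A^(0), A^(1), such that Gap_T ≤ C/T for all T ≥ 1. -/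

import Mathlib

open MeasureTheory Real Filter
open scoped ENNReal NNReal Classical BigOperators

noncomputable section

namespace ERRW

variable {V : Type*} [Fintype V] [DecidableEq V]

/-- Total weight at a vertex: sum of the edge weights over the edges incident to `i`. -/
def vw (G : SimpleGraph V) [DecidableRel G.Adj] (w : Sym2 V → ℝ) (i : V) : ℝ :=
  ∑ j ∈ G.neighborFinset i, w s(i, j)

/-- Product of a vertex function over the two endpoints of an unordered pair. -/
def sprod (f : V → ℝ) : Sym2 V → ℝ :=
  Sym2.lift ⟨fun i j => f i * f j, fun i j => mul_comm _ _⟩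

/-- Sum of a vertex function over the two endpoints of an unordered pair. -/
def ssum (f : V → ℝ) : Sym2 V → ℝ :=
  Sym2.lift ⟨fun i j => f i + f j, fun i j => add_comm _ _⟩

/-- Quenched transition probability `p_{ij}(w) = w_{ij}/w_i`. -/
def qstep (G : SimpleGraph V) [DecidableRel G.Adj] (w : Sym2 V → ℝ) (i j : V) : ℝ :=
  if G.Adj i j then w s(i, j) / vw G w i else 0

/-- Stationary distribution `π_i(w) = w_i / Σ_v w_v` of the quenched chain. -/
def statDist (G : SimpleGraph V) [DecidableRel G.Adj] (w : Sym2 V → ℝ) (i : V) : ℝ :=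
  vw G w i / ∑ v : V, vw G w v

/-- Spanning trees of `G`, as edge sets. -/
def spanningTrees (G : SimpleGraph V) [DecidableRel G.Adj] : Finset (Finset (Sym2 V)) :=
  G.edgeFinset.powerset.filter fun F =>
    (SimpleGraph.fromEdgeSet (F : Set (Sym2 V))).IsTree

/-- Spanning-tree polynomial `τ(w) = Σ_{T} Π_{e ∈ T} w_e`. -/
def tau (G : SimpleGraph V) [DecidableRel G.Adj] (w : Sym2 V → ℝ) : ℝ :=
  ∑ F ∈ spanningTrees G, ∏ e ∈ F, w e

/-- Vertex parameter `b_v = (B_v + 1 - 𝟙(v = x))/2`. -/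
def bwt (G : SimpleGraph V) [DecidableRel G.Adj] (x : V) (B : Sym2 V → ℝ) (v : V) : ℝ :=
  (vw G B v + 1 - if v = x then 1 else 0) / 2

/-- The normalizing constant `Z_{x,B}` of the magic formula. -/
def Znorm (G : SimpleGraph V) [DecidableRel G.Adj] (x : V) (B : Sym2 V → ℝ) : ℝ :=
  ((∏ e ∈ G.edgeFinset, Real.Gamma (B e)) /
      ∏ v : V, Real.Gamma (bwt G x B v)) *
    Real.pi ^ (((Fintype.card V : ℝ) - 1) / 2) /
    2 ^ ((1 : ℝ) - (Fintype.card V : ℝ) + ∑ e ∈ G.edgeFinset, B e)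

/-- The magic-formula density of `μ_{x,B}` with respect to `Π_{e ≠ e0} dw_e`. -/
def magicDensity (G : SimpleGraph V) [DecidableRel G.Adj] (x : V) (B : Sym2 V → ℝ)
    (w : Sym2 V → ℝ) : ℝ :=
  (Znorm G x B)⁻¹ * (vw G w x) ^ ((1 : ℝ) / 2) *
      (∏ e ∈ G.edgeFinset, w e ^ (B e - 1)) /
      (∏ v : V, (vw G w v) ^ ((vw G B v + 1) / 2)) *
    Real.sqrt (tau G w)

/-- Coordinates indexed by the non-reference edges. -/
abbrev Epin (G : SimpleGraph V) [DecidableRel G.Adj] (e0 : Sym2 V) :=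
  {e : Sym2 V // e ∈ G.edgeFinset ∧ e ≠ e0}

/-- Extension of non-reference edge coordinates to a pinned environment (`w_{e0} = 1`). -/
def pinExt (G : SimpleGraph V) [DecidableRel G.Adj] (e0 : Sym2 V)
    (u : Epin G e0 → ℝ) : Sym2 V → ℝ :=
  fun e => if e = e0 then 1 else if h : e ∈ G.edgeFinset ∧ e ≠ e0 then u ⟨e, h⟩ else 0

/-- The mixing measure `μ_{x,B}` of the magic formula, as a measure on
environments pinned at the reference edge `e0`. -/
def mixing (G : SimpleGraph V) [DecidableRel G.Adj] (e0 : Sym2 V) (x : V) (B : Sym2 V → ℝ) :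
    Measure (Sym2 V → ℝ) :=
  Measure.map (pinExt G e0)
    ((volume : Measure (Epin G e0 → ℝ)).withDensity fun u =>
      ENNReal.ofReal
        (if ∀ e ∈ G.edgeFinset, 0 < pinExt G e0 u e then
          magicDensity G x B (pinExt G e0 u) else 0))

/-- Kullback–Leibler divergence (natural logarithm), `+∞` if `P` is not
absolutely continuous with respect to `Q`. -/
def KL {Ω : Type*} [MeasurableSpace Ω] (P Q : Measure Ω) : EReal :=
  if P ≪ Q then ((∫ x, Real.log (P.rnDeriv Q x).toReal ∂P : ℝ) : EReal) else ⊤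

/-- Edge local time (current edge weight) at time `t` along a path. -/
def localTime (a : Sym2 V → ℝ) (x : ℕ → V) (t : ℕ) (e : Sym2 V) : ℝ :=
  a e + ((Finset.range t).filter fun k => s(x k, x (k + 1)) = e).card

/-- One-step ERRW conditional probability at time `t` given the past of the path. -/
def errwStep (G : SimpleGraph V) [DecidableRel G.Adj] (a : Sym2 V → ℝ) (x : ℕ → V)
    (t : ℕ) : ℝ :=
  if G.Adj (x t) (x (t + 1)) then
    localTime a x t s(x t, x (t + 1)) /
      ∑ u ∈ G.neighborFinset (x t), localTime a x t s(x t, u)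
  else 0

/-- Extension of a finite path to ℕ (junk value `v0` beyond time `T`). -/
def extendPath {T : ℕ} (v0 : V) (x : Fin (T + 1) → V) : ℕ → V :=
  fun t => if h : t < T + 1 then x ⟨t, h⟩ else v0

/-- ERRW trajectory probability of a length-`T` path (the trajectory law mass function). -/
def errwProb (G : SimpleGraph V) [DecidableRel G.Adj] (v0 : V) (a : Sym2 V → ℝ) (T : ℕ)
    (x : Fin (T + 1) → V) : ℝ :=
  if x 0 = v0 then ∏ t ∈ Finset.range T, errwStep G a (extendPath v0 x) t else 0

/-- Undirected traversal count `N_e` of an edge along a finite path. -/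
def edgeCount {T : ℕ} (v0 : V) (x : Fin (T + 1) → V) (e : Sym2 V) : ℕ :=
  ((Finset.range T).filter fun k =>
    s(extendPath v0 x k, extendPath v0 x (k + 1)) = e).card

/-- Quenched path probability of a length-`T` path started at `v0`. -/
def quenchedProb (G : SimpleGraph V) [DecidableRel G.Adj] (v0 : V) (w : Sym2 V → ℝ) (T : ℕ)
    (x : Fin (T + 1) → V) : ℝ :=
  if x 0 = v0 then
    ∏ t ∈ Finset.range T, qstep G w (extendPath v0 x t) (extendPath v0 x (t + 1))
  else 0

/-- The measure on a finite type determined by a mass function. -/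
def discreteMeasure {Ω : Type*} [Fintype Ω] [MeasurableSpace Ω] (p : Ω → ℝ) : Measure Ω :=
  ∑ x : Ω, ENNReal.ofReal (p x) • Measure.dirac x

/-- Digamma function `Ψ = (log Γ)'`. -/
def digamma (x : ℝ) : ℝ := deriv (fun y => Real.log (Real.Gamma y)) x

/-- Trigamma function `Ψ₁ = Ψ'`. -/
def trigamma (x : ℝ) : ℝ := deriv digamma x

/-- `Λ(p,q) = log Γ(q) − log Γ(p) − (q−p)·Ψ(p)`. -/
def Lam (p q : ℝ) : ℝ :=
  Real.log (Real.Gamma q) - Real.log (Real.Gamma p) - (q - p) * digamma p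

set_option linter.unusedSectionVars false

theorem hasDerivAt_log_Gamma {x : ℝ} (hx : 0 < x) :
    HasDerivAt (fun y => log (Gamma y)) (digamma x) x := by
  have h : DifferentiableAt ℝ (fun y => log (Gamma y)) x := by
    refine DifferentiableAt.log (differentiableAt_Gamma fun m => ?_) (Gamma_pos_of_pos hx).ne'
    have : (0 : ℝ) ≤ m := m.cast_nonneg
    linarith
  exact h.hasDerivAt

theorem log_Gamma_add_one {x : ℝ} (hx : 0 < x) :
    log (Gamma (x + 1)) = log x + log (Gamma x) := by
  rw [Gamma_add_one hx.ne', log_mul hx.ne' (Gamma_pos_of_pos hx).ne']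

/-- Tangent-line inequality for the convex function `log Γ`. -/
theorem digamma_mul_le {x y : ℝ} (hx : 0 < x) (hy : 0 < y) :
    digamma x * (y - x) ≤ log (Gamma y) - log (Gamma x) := by
  have hc := convexOn_log_Gamma
  have hd := hasDerivAt_log_Gamma hx
  rcases lt_trichotomy x y with h | h | h
  · have := hc.le_slope_of_hasDerivAt (x := x) (y := y) hx hy h hd
    rw [slope_def_field, le_div_iff₀ (by linarith)] at this
    simpa using this
  · simp [h]
  · have := hc.slope_le_of_hasDerivAt (x := y) (y := x) hy hx h hd
    rw [slope_def_field, div_le_iff₀ (by linarith)] at this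
    simp only [Function.comp] at this
    linarith

theorem digamma_add_one {x : ℝ} (hx : 0 < x) : digamma (x + 1) = digamma x + 1 / x := by
  have h1 : HasDerivAt (fun y => log (Gamma (y + 1))) (digamma (x + 1)) x :=
    (hasDerivAt_log_Gamma (x := x + 1) (by linarith)).comp_add_const x 1
  have h2 : HasDerivAt (fun y => log y + log (Gamma y)) (x⁻¹ + digamma x) x :=
    (hasDerivAt_log hx.ne').add (hasDerivAt_log_Gamma hx)
  have h3 : (fun y => log (Gamma (y + 1))) =ᶠ[nhds x] fun y => log y + log (Gamma y) := by
    filter_upwards [lt_mem_nhds hx] with y hy using log_Gamma_add_one hy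
  have := h1.unique (h2.congr_of_eventuallyEq h3)
  rw [this]; ring

theorem digamma_le_log {x : ℝ} (hx : 0 < x) : digamma x ≤ log x := by
  have := digamma_mul_le hx (y := x + 1) (by linarith)
  rw [log_Gamma_add_one hx] at this
  linarith

theorem log_sub_le_digamma {x : ℝ} (hx : 0 < x) : log x - 1 / x ≤ digamma x := by
  have := digamma_mul_le (x := x + 1) (y := x) (by linarith) hx
  rw [log_Gamma_add_one hx, digamma_add_one hx] at this
  linarith

theorem Lam_nonneg {p q : ℝ} (hp : 0 < p) (hq : 0 < q) : 0 ≤ Lam p q := by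
  have := digamma_mul_le hp hq
  unfold Lam; linarith

theorem Lam_le {p q : ℝ} (hp : 0 < p) (hq : 0 < q) :
    Lam p q ≤ |q - p| * (|q - p| + 1) / min p q := by
  have h := digamma_mul_le hq hp
  have key : ∀ {x y : ℝ}, 0 < x → x ≤ y → digamma y - digamma x ≤ ((y - x) + 1) / x := by
    intro x y hx hxy
    have h1 := digamma_le_log (hx.trans_le hxy)
    have h2 := log_sub_le_digamma hx
    have h3 := log_le_sub_one_of_pos (x := y / x) (div_pos (hx.trans_le hxy) hx)
    rw [log_div (hx.trans_le hxy).ne' hx.ne'] at h3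
    have : ((y - x) + 1) / x = y / x - 1 + 1 / x := by field_simp
    linarith
  have h0 : Lam p q ≤ (q - p) * (digamma q - digamma p) := by
    unfold Lam; linarith
  refine h0.trans ?_
  rcases le_total p q with hpq | hpq
  · rw [min_eq_left hpq, abs_of_nonneg (by linarith), mul_div_assoc]
    exact mul_le_mul_of_nonneg_left (key hp hpq) (by linarith)
  · rw [min_eq_right hpq, abs_of_nonpos (by linarith), mul_div_assoc]
    have := mul_le_mul_of_nonneg_left (key hq hpq) (show 0 ≤ p - q by linarith)
    rw [neg_sub]
    linarith

theorem Lam_add_one {p q : ℝ} (hp : 0 < p) (hq : 0 < q) :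
    Lam (p + 1) (q + 1) = Lam p q + (log (q / p) - (q - p) / p) := by
  unfold Lam
  rw [log_Gamma_add_one hp, log_Gamma_add_one hq, digamma_add_one hp, log_div hq.ne' hp.ne']
  ring

/-- The environment obtained from `B` by reinforcing the edge `e` once. -/
def bump (B : Sym2 V → ℝ) (e : Sym2 V) : Sym2 V → ℝ := fun f => B f + if f = e then 1 else 0

theorem vw_pos (G : SimpleGraph V) [DecidableRel G.Adj] {B : Sym2 V → ℝ}
    (hB : ∀ e ∈ G.edgeFinset, 0 < B e) {x v : V} (h : G.Adj x v) : 0 < vw G B x := by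
  unfold vw
  refine Finset.sum_pos (fun j hj => hB _ ?_) ⟨v, by simpa using h⟩
  simpa using hj

theorem vw_nonneg (G : SimpleGraph V) [DecidableRel G.Adj] {B : Sym2 V → ℝ}
    (hB : ∀ e ∈ G.edgeFinset, 0 ≤ B e) (x : V) : 0 ≤ vw G B x := by
  unfold vw
  refine Finset.sum_nonneg (fun j hj => hB _ ?_)
  simpa using hj

theorem vw_bump (G : SimpleGraph V) [DecidableRel G.Adj] (B : Sym2 V → ℝ) {x v : V}
    (h : G.Adj x v) (u : V) :
    vw G (bump B s(x, v)) u = vw G B u + ((if u = x then 1 else 0) + if u = v then 1 else 0) := by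
  unfold vw bump
  rw [Finset.sum_add_distrib]
  congr 1
  have hne := h.ne
  by_cases hux : u = x
  · subst hux
    rw [Finset.sum_eq_single v]
    · simp [hne]
    · intro b _ hb
      simp [hb, hne]
    · intro hv; exact absurd (by simpa using h) hv
  · by_cases huv : u = v
    · subst huv
      rw [Finset.sum_eq_single x]
      · simp [hux, Sym2.eq_swap]
      · intro b _ hb
        simp [hb, hux]
      · intro hv; exact absurd (by simpa using h.symm) hv
    · rw [if_neg hux, if_neg huv, add_zero]
      exact Finset.sum_eq_zero fun b _ => by simp [hux, huv]

theorem bwt_bump (G : SimpleGraph V) [DecidableRel G.Adj] (B : Sym2 V → ℝ) {x v : V}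
    (h : G.Adj x v) (u : V) :
    bwt G v (bump B s(x, v)) u = bwt G x B u + if u = x then 1 else 0 := by
  unfold bwt
  rw [vw_bump G B h]
  have hne := h.ne
  by_cases hux : u = x
  · have : u ≠ v := hux ▸ hne
    simp [hux, hne]; ring
  · by_cases huv : u = v <;> simp [hux, huv, hne.symm]

theorem exists_adj (G : SimpleGraph V) (hG : G.Connected) {e0 : Sym2 V}
    (he0 : e0 ∈ G.edgeSet) (v : V) : ∃ u, G.Adj v u := by
  induction e0 with
  | _ a b =>
    have : Nontrivial V := ⟨a, b, (G.mem_edgeSet.1 he0).ne⟩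
    exact hG.preconnected.exists_adj_of_nontrivial v

theorem bwt_pos (G : SimpleGraph V) [DecidableRel G.Adj] {B : Sym2 V → ℝ}
    (hB : ∀ e ∈ G.edgeFinset, 0 < B e) {x v u : V} (h : G.Adj v u) : 0 < bwt G x B v := by
  have := vw_pos G hB h
  unfold bwt
  split_ifs <;> linarith

theorem Znorm_pos (G : SimpleGraph V) [DecidableRel G.Adj] {B : Sym2 V → ℝ}
    (hadj : ∀ v, ∃ u, G.Adj v u)
    (hB : ∀ e ∈ G.edgeFinset, 0 < B e) (x : V) : 0 < Znorm G x B := by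
  unfold Znorm
  have h1 : 0 < ∏ e ∈ G.edgeFinset, Gamma (B e) :=
    Finset.prod_pos fun e he => Gamma_pos_of_pos (hB e he)
  have h2 : 0 < ∏ v, Gamma (bwt G x B v) :=
    Finset.prod_pos fun v _ => Gamma_pos_of_pos (bwt_pos G hB (hadj v).choose_spec)
  positivity

theorem Znorm_bump (G : SimpleGraph V) [DecidableRel G.Adj] {B : Sym2 V → ℝ}
    (hB : ∀ e ∈ G.edgeFinset, 0 < B e) {x v : V} (h : G.Adj x v) :
    Znorm G v (bump B s(x, v)) = B s(x, v) / vw G B x * Znorm G x B := by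
  have he : s(x, v) ∈ G.edgeFinset := by simpa using h
  have hx := vw_pos G hB h
  have h1 : ∏ e ∈ G.edgeFinset, Gamma (bump B s(x, v) e)
      = B s(x, v) * ∏ e ∈ G.edgeFinset, Gamma (B e) := by
    rw [← Finset.mul_prod_erase _ _ he, ← Finset.mul_prod_erase _ (fun e => Gamma (B e)) he,
      ← mul_assoc]
    congr 1
    · simp only [bump, if_true]
      rw [Gamma_add_one (hB _ he).ne']
    · refine Finset.prod_congr rfl fun e hee => ?_
      simp [bump, (Finset.mem_erase.1 hee).1]
  have h2 : ∏ u, Gamma (bwt G v (bump B s(x, v)) u)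
      = vw G B x / 2 * ∏ u, Gamma (bwt G x B u) := by
    rw [← Finset.mul_prod_erase _ _ (Finset.mem_univ x),
      ← Finset.mul_prod_erase _ (fun u => Gamma (bwt G x B u)) (Finset.mem_univ x), ← mul_assoc]
    congr 1
    · rw [bwt_bump G B h, if_pos rfl]
      have : bwt G x B x = vw G B x / 2 := by simp [bwt]
      rw [this, Gamma_add_one (by positivity)]
    · refine Finset.prod_congr rfl fun u hu => ?_
      rw [bwt_bump G B h, if_neg (Finset.mem_erase.1 hu).1, add_zero]
  have h3 : ∑ e ∈ G.edgeFinset, bump B s(x, v) e = (∑ e ∈ G.edgeFinset, B e) + 1 := by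
    unfold bump
    rw [Finset.sum_add_distrib]
    simp only [Finset.sum_ite_eq', he, if_true]
  unfold Znorm
  rw [h1, h2, h3, ← add_assoc, rpow_add two_pos _ 1, rpow_one]
  field_simp

section Paths

variable (v0 : V) {T : ℕ}

theorem extendPath_snoc_of_le (x : Fin (T + 1) → V) (v : V) {t : ℕ} (ht : t ≤ T) :
    extendPath v0 (Fin.snoc (α := fun _ => V) x v : Fin (T + 1 + 1) → V) t
      = extendPath v0 x t := by
  unfold extendPath
  rw [dif_pos (by omega), dif_pos (by omega)]
  exact Fin.snoc_castSucc (α := fun _ => V) v x ⟨t, by omega⟩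

theorem extendPath_snoc_last (x : Fin (T + 1) → V) (v : V) :
    extendPath v0 (Fin.snoc (α := fun _ => V) x v : Fin (T + 1 + 1) → V) (T + 1) = v := by
  unfold extendPath
  rw [dif_pos (by omega)]
  exact Fin.snoc_last (α := fun _ => V) v x

theorem extendPath_last (x : Fin (T + 1) → V) : extendPath v0 x T = x (Fin.last T) := by
  unfold extendPath
  rw [dif_pos (by omega)]; rfl

/-- The edge weights reached by the walk at the end of a finite path. -/
def endWeight (a : Sym2 V → ℝ) (x : Fin (T + 1) → V) : Sym2 V → ℝ :=
  localTime a (extendPath v0 x) T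

theorem endWeight_eq (a : Sym2 V → ℝ) (x : Fin (T + 1) → V) (e : Sym2 V) :
    endWeight v0 a x e = a e + edgeCount v0 x e := rfl

theorem le_endWeight (a : Sym2 V → ℝ) (x : Fin (T + 1) → V) (e : Sym2 V) :
    a e ≤ endWeight v0 a x e := by
  rw [endWeight_eq]; linarith [(edgeCount v0 x e).cast_nonneg (α := ℝ)]

theorem endWeight_pos {G : SimpleGraph V} [DecidableRel G.Adj] {B : Sym2 V → ℝ}
    (hB : ∀ e ∈ G.edgeFinset, 0 < B e) (x : Fin (T + 1) → V) :
    ∀ e ∈ G.edgeFinset, 0 < endWeight v0 B x e :=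
  fun e he => (hB e he).trans_le (le_endWeight v0 B x e)

theorem endWeight_snoc (a : Sym2 V → ℝ) (x : Fin (T + 1) → V) (v : V) :
    endWeight v0 a (Fin.snoc (α := fun _ => V) x v : Fin (T + 1 + 1) → V)
      = bump (endWeight v0 a x) s(x (Fin.last T), v) := by
  funext e
  unfold endWeight localTime bump
  rw [Finset.range_add_one, Finset.filter_insert, extendPath_snoc_of_le v0 x v le_rfl,
    extendPath_snoc_last, extendPath_last]
  have : (Finset.range T).filter (fun k => s(extendPath v0 (Fin.snoc (α := fun _ => V) x v :
      Fin (T + 1 + 1) → V) k, extendPath v0 (Fin.snoc (α := fun _ => V) x v :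
      Fin (T + 1 + 1) → V) (k + 1)) = e)
      = (Finset.range T).filter (fun k => s(extendPath v0 x k, extendPath v0 x (k + 1)) = e) := by
    refine Finset.filter_congr fun k hk => ?_
    have := Finset.mem_range.1 hk
    rw [extendPath_snoc_of_le v0 x v (by omega), extendPath_snoc_of_le v0 x v (by omega)]
  rw [this]
  by_cases h : e = s(x (Fin.last T), v)
  · rw [if_pos h.symm, if_pos h, Finset.card_insert_of_notMem (by simp)]
    push_cast; ring
  · rw [if_neg (Ne.symm h), if_neg h]; ring

theorem errwProb_snoc (G : SimpleGraph V) [DecidableRel G.Adj] (a : Sym2 V → ℝ)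
    (x : Fin (T + 1) → V) (v : V) :
    errwProb G v0 a (T + 1) (Fin.snoc (α := fun _ => V) x v : Fin (T + 1 + 1) → V)
      = errwProb G v0 a T x * if G.Adj (x (Fin.last T)) v then
          endWeight v0 a x s(x (Fin.last T), v) / vw G (endWeight v0 a x) (x (Fin.last T))
        else 0 := by
  unfold errwProb
  have h0 : (Fin.snoc (α := fun _ => V) x v : Fin (T + 1 + 1) → V) 0 = x 0 :=
    Fin.snoc_castSucc (α := fun _ => V) v x 0
  rw [h0]
  split_ifs with h1 h2 h2
  · rw [Finset.prod_range_succ]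
    have hloc : ∀ t ≤ T, localTime a (extendPath v0 (Fin.snoc (α := fun _ => V) x v :
        Fin (T + 1 + 1) → V)) t = localTime a (extendPath v0 x) t := by
      intro t ht
      funext e
      unfold localTime
      congr 3
      refine Finset.filter_congr fun k hk => ?_
      have := Finset.mem_range.1 hk
      rw [extendPath_snoc_of_le v0 x v (by omega), extendPath_snoc_of_le v0 x v (by omega)]
    congr 1
    · refine Finset.prod_congr rfl fun t ht => ?_
      have := Finset.mem_range.1 ht
      unfold errwStep
      rw [extendPath_snoc_of_le v0 x v (by omega), extendPath_snoc_of_le v0 x v (by omega),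
        hloc t (by omega)]
    · unfold errwStep
      rw [extendPath_snoc_of_le v0 x v le_rfl, extendPath_snoc_last, extendPath_last,
        if_pos h2, hloc T le_rfl]
      rfl
  · rw [Finset.prod_range_succ]
    have : errwStep G a (extendPath v0 (Fin.snoc (α := fun _ => V) x v :
        Fin (T + 1 + 1) → V)) T = 0 := by
      unfold errwStep
      rw [extendPath_snoc_of_le v0 x v le_rfl, extendPath_snoc_last, extendPath_last, if_neg h2]
    simp [this]
  · simp
  · simp

/-- Decomposing an expectation over paths of length `T + 1` according to the last step. -/
theorem sum_errwProb_succ (G : SimpleGraph V) [DecidableRel G.Adj] (a : Sym2 V → ℝ)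
    (F : (Fin (T + 1 + 1) → V) → ℝ) :
    ∑ y, errwProb G v0 a (T + 1) y * F y
      = ∑ x : Fin (T + 1) → V, errwProb G v0 a T x *
          ∑ v ∈ G.neighborFinset (x (Fin.last T)),
            endWeight v0 a x s(x (Fin.last T), v) / vw G (endWeight v0 a x) (x (Fin.last T)) *
              F (Fin.snoc (α := fun _ => V) x v) := by
  rw [← (Fin.snocEquiv fun _ => V).sum_comp, Fintype.sum_prod_type_right]
  refine Finset.sum_congr rfl fun x _ => ?_
  rw [Finset.mul_sum, ← Finset.sum_subset (Finset.subset_univ (G.neighborFinset (x (Fin.last T))))]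
  · refine Finset.sum_congr rfl fun v hv => ?_
    change errwProb G v0 a (T + 1) (Fin.snoc (α := fun _ => V) x v) * _ = _
    rw [errwProb_snoc, if_pos (by simpa using hv), mul_assoc]; rfl
  · intro v _ hv
    change errwProb G v0 a (T + 1) (Fin.snoc (α := fun _ => V) x v) * _ = _
    rw [errwProb_snoc, if_neg (by simpa using hv)]; simp

theorem sum_errwProb (G : SimpleGraph V) [DecidableRel G.Adj] (hadj : ∀ v, ∃ u, G.Adj v u)
    {a : Sym2 V → ℝ} (ha : ∀ e ∈ G.edgeFinset, 0 < a e) (T : ℕ) :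
    ∑ x : Fin (T + 1) → V, errwProb G v0 a T x = 1 := by
  induction T with
  | zero =>
    rw [← (Equiv.funUnique (Fin 1) V).symm.sum_comp]
    simp [errwProb]
  | succ T ih =>
    have := sum_errwProb_succ v0 G a (T := T) (fun _ => 1)
    simp only [mul_one] at this
    rw [this, ← ih]
    refine Finset.sum_congr rfl fun x _ => ?_
    rw [← Finset.sum_div]
    change _ * (vw G (endWeight v0 a x) (x (Fin.last T)) / _) = _
    rw [div_self (vw_pos G (endWeight_pos v0 ha x) (hadj _).choose_spec).ne', mul_one]

/-- A path is admissible when it starts at `v0` and follows edges of the graph. -/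
def Admissible (G : SimpleGraph V) (x : Fin (T + 1) → V) : Prop :=
  x 0 = v0 ∧ ∀ t < T, G.Adj (extendPath v0 x t) (extendPath v0 x (t + 1))

theorem admissible_snoc (G : SimpleGraph V) (x : Fin (T + 1) → V) (v : V) :
    Admissible v0 G (Fin.snoc (α := fun _ => V) x v : Fin (T + 1 + 1) → V) ↔
      Admissible v0 G x ∧ G.Adj (x (Fin.last T)) v := by
  unfold Admissible
  have h0 : (Fin.snoc (α := fun _ => V) x v : Fin (T + 1 + 1) → V) 0 = x 0 :=
    Fin.snoc_castSucc (α := fun _ => V) v x 0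
  rw [h0]
  constructor
  · rintro ⟨h1, h2⟩
    refine ⟨⟨h1, fun t ht => ?_⟩, ?_⟩
    · have := h2 t (by omega)
      rwa [extendPath_snoc_of_le v0 x v (by omega),
        extendPath_snoc_of_le v0 x v (by omega)] at this
    · have := h2 T (by omega)
      rwa [extendPath_snoc_of_le v0 x v le_rfl, extendPath_snoc_last, extendPath_last] at this
  · rintro ⟨⟨h1, h2⟩, h3⟩
    refine ⟨h1, fun t ht => ?_⟩
    rcases Nat.lt_succ_iff_lt_or_eq.1 ht with ht | rfl
    · rw [extendPath_snoc_of_le v0 x v (by omega), extendPath_snoc_of_le v0 x v (by omega)]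
      exact h2 t ht
    · rwa [extendPath_snoc_of_le v0 x v le_rfl, extendPath_snoc_last, extendPath_last]

/-- Explicit, partially exchangeable form of the trajectory law. -/
theorem errwProb_eq (G : SimpleGraph V) [DecidableRel G.Adj] (hadj : ∀ v, ∃ u, G.Adj v u)
    {a : Sym2 V → ℝ} (ha : ∀ e ∈ G.edgeFinset, 0 < a e) (x : Fin (T + 1) → V) :
    errwProb G v0 a T x = if Admissible v0 G x then
      Znorm G (x (Fin.last T)) (endWeight v0 a x) / Znorm G v0 a else 0 := by
  induction T with
  | zero =>
    have hw : endWeight v0 a x = a := by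
      funext e; simp [endWeight, localTime]
    have hx : x (Fin.last 0) = x 0 := rfl
    simp only [errwProb, Admissible, Finset.range_zero, Finset.prod_empty, not_lt_zero,
      IsEmpty.forall_iff, implies_true, and_true, hw, hx]
    split_ifs with h
    · rw [h, div_self (Znorm_pos G hadj ha v0).ne']
    · rfl
  | succ T ih =>
    obtain ⟨x, v, rfl⟩ : ∃ (y : Fin (T + 1) → V) (v : V),
        x = (Fin.snoc (α := fun _ => V) y v : Fin (T + 1 + 1) → V) :=
      ⟨Fin.init x, x (Fin.last _), (Fin.snoc_init_self x).symm⟩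
    rw [errwProb_snoc, ih, admissible_snoc, endWeight_snoc, Fin.snoc_last]
    by_cases h1 : Admissible v0 G x <;> by_cases h2 : G.Adj (x (Fin.last T)) v
    · simp only [h1, h2, if_true, and_self]
      rw [Znorm_bump G (endWeight_pos v0 ha x) h2]
      ring
    · simp [h2]
    · simp [h1]
    · simp [h1]

theorem errwProb_pos (G : SimpleGraph V) [DecidableRel G.Adj] (hadj : ∀ v, ∃ u, G.Adj v u)
    {a : Sym2 V → ℝ} (ha : ∀ e ∈ G.edgeFinset, 0 < a e) {x : Fin (T + 1) → V}
    (hx : Admissible v0 G x) : 0 < errwProb G v0 a T x := by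
  rw [errwProb_eq v0 G hadj ha, if_pos hx]
  exact div_pos (Znorm_pos G hadj (endWeight_pos v0 ha x) _) (Znorm_pos G hadj ha _)

theorem errwProb_nonneg (G : SimpleGraph V) [DecidableRel G.Adj] (hadj : ∀ v, ∃ u, G.Adj v u)
    {a : Sym2 V → ℝ} (ha : ∀ e ∈ G.edgeFinset, 0 < a e) (x : Fin (T + 1) → V) :
    0 ≤ errwProb G v0 a T x := by
  by_cases hx : Admissible v0 G x
  · exact (errwProb_pos v0 G hadj ha hx).le
  · rw [errwProb_eq v0 G hadj ha, if_neg hx]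

end Paths

theorem log_Gamma_add_sub_le {x s : ℝ} (hx : 0 < x) (hs : 0 ≤ s) :
    log (Gamma (x + s)) - log (Gamma x) ≤ s * log (x + s) := by
  have hxs : 0 < x + s := by linarith
  have h := digamma_mul_le hxs hx
  have h1 := mul_le_mul_of_nonneg_right (digamma_le_log hxs) hs
  linarith

theorem le_log_Gamma_add_sub {x s : ℝ} (hx : 0 < x) (hs : 0 ≤ s) :
    s * log x - s / x ≤ log (Gamma (x + s)) - log (Gamma x) := by
  have hxs : 0 < x + s := by linarith
  have h := digamma_mul_le hx hxs
  have h1 := mul_le_mul_of_nonneg_right (log_sub_le_digamma hx) hs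
  have : (log x - 1 / x) * s = s * log x - s / x := by ring
  linarith

/-- Closed form for the divergence between two mixing measures with the same root. -/
def Phi (G : SimpleGraph V) [DecidableRel G.Adj] (x : V) (A B : Sym2 V → ℝ) : ℝ :=
  ∑ e ∈ G.edgeFinset, Lam (A e) (B e) - ∑ v, Lam (bwt G x A v) (bwt G x B v)

theorem Phi_bump (G : SimpleGraph V) [DecidableRel G.Adj] {A B : Sym2 V → ℝ}
    (hA : ∀ e ∈ G.edgeFinset, 0 < A e) (hB : ∀ e ∈ G.edgeFinset, 0 < B e) {x v : V}
    (h : G.Adj x v) :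
    Phi G v (bump A s(x, v)) (bump B s(x, v)) = Phi G x A B
      + (log (B s(x, v) / A s(x, v)) - (B s(x, v) - A s(x, v)) / A s(x, v))
      - (log (vw G B x / vw G A x) - (vw G B x - vw G A x) / vw G A x) := by
  have he : s(x, v) ∈ G.edgeFinset := by simpa using h
  have hx := vw_pos G hA h
  have hy := vw_pos G hB h
  have h1 : ∑ e ∈ G.edgeFinset, Lam (bump A s(x, v) e) (bump B s(x, v) e)
      = ∑ e ∈ G.edgeFinset, Lam (A e) (B e)
        + (log (B s(x, v) / A s(x, v)) - (B s(x, v) - A s(x, v)) / A s(x, v)) := by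
    rw [← Finset.add_sum_erase _ _ he, ← Finset.add_sum_erase _ (fun e => Lam (A e) (B e)) he]
    have : ∑ e ∈ G.edgeFinset.erase s(x, v), Lam (bump A s(x, v) e) (bump B s(x, v) e)
        = ∑ e ∈ G.edgeFinset.erase s(x, v), Lam (A e) (B e) :=
      Finset.sum_congr rfl fun e hee => by simp [bump, (Finset.mem_erase.1 hee).1]
    rw [this]
    simp only [bump, if_true]
    rw [Lam_add_one (hA _ he) (hB _ he)]; ring
  have h2 : ∑ u, Lam (bwt G v (bump A s(x, v)) u) (bwt G v (bump B s(x, v)) u)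
      = ∑ u, Lam (bwt G x A u) (bwt G x B u)
        + (log (vw G B x / vw G A x) - (vw G B x - vw G A x) / vw G A x) := by
    rw [← Finset.add_sum_erase _ _ (Finset.mem_univ x),
      ← Finset.add_sum_erase _ (fun u => Lam (bwt G x A u) (bwt G x B u)) (Finset.mem_univ x)]
    have : ∑ u ∈ Finset.univ.erase x, Lam (bwt G v (bump A s(x, v)) u) (bwt G v (bump B s(x, v)) u)
        = ∑ u ∈ Finset.univ.erase x, Lam (bwt G x A u) (bwt G x B u) :=
      Finset.sum_congr rfl fun u hu => by
        rw [bwt_bump G A h, bwt_bump G B h, if_neg (Finset.mem_erase.1 hu).1, add_zero, add_zero]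
    rw [this, bwt_bump G A h, bwt_bump G B h, if_pos rfl,
      Lam_add_one (bwt_pos G hA h) (bwt_pos G hB h)]
    have hb : ∀ C, bwt G x C x = vw G C x / 2 := fun C => by simp [bwt]
    rw [hb, hb]
    have e1 : vw G B x / 2 / (vw G A x / 2) = vw G B x / vw G A x := by field_simp
    have e2 : (vw G B x / 2 - vw G A x / 2) / (vw G A x / 2)
        = (vw G B x - vw G A x) / vw G A x := by field_simp
    rw [e1, e2]; ring
  unfold Phi
  rw [h1, h2]; ring

/-- Chain rule: the closed-form divergence splits into the trajectory divergence and
the expected closed-form divergence of the posteriors. -/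
theorem sum_errwProb_Phi (G : SimpleGraph V) [DecidableRel G.Adj] (hadj : ∀ v, ∃ u, G.Adj v u)
    (v0 : V) {a0 a1 : Sym2 V → ℝ} (ha0 : ∀ e ∈ G.edgeFinset, 0 < a0 e)
    (ha1 : ∀ e ∈ G.edgeFinset, 0 < a1 e) (T : ℕ) :
    ∑ x : Fin (T + 1) → V, errwProb G v0 a0 T x *
      (Phi G (x (Fin.last T)) (endWeight v0 a0 x) (endWeight v0 a1 x)
        + log (errwProb G v0 a0 T x / errwProb G v0 a1 T x)) = Phi G v0 a0 a1 := by
  induction T with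
  | zero =>
    rw [← (Equiv.funUnique (Fin 1) V).symm.sum_comp]
    have hw : ∀ a : Sym2 V → ℝ, ∀ x : Fin 1 → V, endWeight v0 a (T := 0) x = a := by
      intro a x; funext e; simp [endWeight, localTime]
    simp only [hw]
    rw [Finset.sum_eq_single v0]
    · simp [errwProb]
    · intro b _ hb; simp [errwProb, hb]
    · simp
  | succ T ih =>
    rw [sum_errwProb_succ, ← ih]
    refine Finset.sum_congr rfl fun x _ => ?_
    by_cases hx : Admissible v0 G x
    swap
    · rw [errwProb_eq v0 G hadj ha0, if_neg hx]; simp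
    congr 1
    have p0 := errwProb_pos v0 G hadj ha0 hx
    have p1 := errwProb_pos v0 G hadj ha1 hx
    set y := x (Fin.last T)
    set A := endWeight v0 a0 x with hA'
    set B := endWeight v0 a1 x with hB'
    have hA : ∀ e ∈ G.edgeFinset, 0 < A e := endWeight_pos v0 ha0 x
    have hB : ∀ e ∈ G.edgeFinset, 0 < B e := endWeight_pos v0 ha1 x
    have hAy : 0 < vw G A y := vw_pos G hA (hadj y).choose_spec
    have hBy : 0 < vw G B y := vw_pos G hB (hadj y).choose_spec
    have key : ∀ v ∈ G.neighborFinset y, A s(y, v) / vw G A y *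
        (Phi G ((Fin.snoc (α := fun _ => V) x v : Fin (T + 1 + 1) → V) (Fin.last (T + 1)))
            (endWeight v0 a0 (Fin.snoc (α := fun _ => V) x v : Fin (T + 1 + 1) → V))
            (endWeight v0 a1 (Fin.snoc (α := fun _ => V) x v : Fin (T + 1 + 1) → V)) +
          log (errwProb G v0 a0 (T + 1) (Fin.snoc (α := fun _ => V) x v) /
            errwProb G v0 a1 (T + 1) (Fin.snoc (α := fun _ => V) x v)))
        = A s(y, v) / vw G A y * (Phi G y A B + log (errwProb G v0 a0 T x / errwProb G v0 a1 T x)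
            + (vw G B y - vw G A y) / vw G A y) - (B s(y, v) - A s(y, v)) / vw G A y := by
      intro v hv
      have hv' : G.Adj y v := by simpa using hv
      have he : s(y, v) ∈ G.edgeFinset := by simpa using hv'
      have hAe := hA _ he
      have hBe := hB _ he
      rw [endWeight_snoc, endWeight_snoc, Fin.snoc_last, Phi_bump G hA hB hv', errwProb_snoc,
        errwProb_snoc, if_pos hv', if_pos hv', ← hA', ← hB']
      change A s(y, v) / vw G A y * (_ + log (errwProb G v0 a0 T x * (A s(y, v) / vw G A y) /
        (errwProb G v0 a1 T x * (B s(y, v) / vw G B y)))) = _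
      rw [log_div hBe.ne' hAe.ne', log_div hBy.ne' hAy.ne',
        log_div (by positivity) (by positivity), log_mul p0.ne' (by positivity),
        log_mul p1.ne' (by positivity), log_div hAe.ne' hAy.ne', log_div hBe.ne' hBy.ne',
        log_div p0.ne' p1.ne']
      field_simp
      ring
    rw [Finset.sum_congr rfl key, Finset.sum_sub_distrib, ← Finset.sum_mul, ← Finset.sum_div,
      ← Finset.sum_div, Finset.sum_sub_distrib]
    change vw G A y / vw G A y * _ - (vw G B y - vw G A y) / _ = _
    rw [div_self hAy.ne']; ring

/-- Double counting of the edges by their endpoints. -/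
theorem sum_sum_neighborFinset (G : SimpleGraph V) [DecidableRel G.Adj] (w : Sym2 V → ℝ)
    (h : V → ℝ) :
    ∑ v, ∑ j ∈ G.neighborFinset v, w s(v, j) * h v = ∑ e ∈ G.edgeFinset, w e * ssum h e := by
  have h1 : ∑ v, ∑ j ∈ G.neighborFinset v, w s(v, j) * h v
      = ∑ p ∈ (Finset.univ : Finset (V × V)).filter (fun p => G.Adj p.1 p.2),
          w s(p.1, p.2) * h p.1 := by
    rw [Finset.sum_filter, Fintype.sum_prod_type]
    refine Finset.sum_congr rfl fun v _ => ?_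
    rw [SimpleGraph.neighborFinset_eq_filter, Finset.sum_filter]
  rw [h1, ← Finset.sum_fiberwise_of_maps_to (s := _) (t := G.edgeFinset)
    (g := fun p : V × V => s(p.1, p.2)) (fun p hp => by simpa using hp)]
  refine Finset.sum_congr rfl fun e he => ?_
  induction e with
  | _ a b =>
    have hab : G.Adj a b := by simpa using he
    have : ((Finset.univ : Finset (V × V)).filter (fun p => G.Adj p.1 p.2)).filter
        (fun p => s(p.1, p.2) = s(a, b)) = {(a, b), (b, a)} := by
      ext ⟨p, q⟩
      simp only [Finset.mem_filter, Finset.mem_univ, true_and, Sym2.eq_iff, Finset.mem_insert,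
        Finset.mem_singleton, Prod.mk.injEq]
      constructor
      · exact fun h => h.2
      · rintro (⟨rfl, rfl⟩ | ⟨rfl, rfl⟩)
        · exact ⟨hab, Or.inl ⟨rfl, rfl⟩⟩
        · exact ⟨hab.symm, Or.inr ⟨rfl, rfl⟩⟩
    rw [this, Finset.sum_pair (by simp [hab.ne])]
    simp only [ssum, Sym2.lift_mk]
    rw [Sym2.eq_swap (a := b)]; ring

theorem sum_vw_mul (G : SimpleGraph V) [DecidableRel G.Adj] (w : Sym2 V → ℝ) (h : V → ℝ) :
    ∑ v, vw G w v * h v = ∑ e ∈ G.edgeFinset, w e * ssum h e := by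
  rw [← sum_sum_neighborFinset]
  exact Finset.sum_congr rfl fun v _ => by rw [vw, Finset.sum_mul]

theorem log_Znorm (G : SimpleGraph V) [DecidableRel G.Adj] (hadj : ∀ v, ∃ u, G.Adj v u)
    {B : Sym2 V → ℝ} (hB : ∀ e ∈ G.edgeFinset, 0 < B e) (x : V) :
    log (Znorm G x B) = ∑ e ∈ G.edgeFinset, log (Gamma (B e)) - ∑ v, log (Gamma (bwt G x B v))
      + ((((Fintype.card V : ℝ) - 1) / 2) * log Real.pi - (1 - (Fintype.card V : ℝ)) * log 2
      - log 2 * ∑ e ∈ G.edgeFinset, B e) := by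
  have h1 : ∀ e ∈ G.edgeFinset, Gamma (B e) ≠ 0 := fun e he => (Gamma_pos_of_pos (hB e he)).ne'
  have h2 : ∀ v ∈ Finset.univ, Gamma (bwt G x B v) ≠ 0 :=
    fun v _ => (Gamma_pos_of_pos (bwt_pos G hB (hadj v).choose_spec)).ne'
  have h3 := Finset.prod_ne_zero_iff.2 h1
  have h4 := Finset.prod_ne_zero_iff.2 h2
  have hp := Real.pi_pos
  unfold Znorm
  rw [log_div (mul_ne_zero (div_ne_zero h3 h4) (by positivity)) (by positivity),
    log_mul (div_ne_zero h3 h4) (by positivity), log_div h3 h4, log_prod h1, log_prod h2,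
    log_rpow hp, log_rpow two_pos]
  ring

/-- The squared ratio `w_i w_j / w_{ij}²`, in logarithmic form. -/
def logRatio (G : SimpleGraph V) [DecidableRel G.Adj] (A : Sym2 V → ℝ) (e : Sym2 V) : ℝ :=
  ssum (fun v => log (vw G A v)) e - 2 * log (A e)

theorem le_vw (G : SimpleGraph V) [DecidableRel G.Adj] {A : Sym2 V → ℝ}
    (hA : ∀ e ∈ G.edgeFinset, 0 < A e) {i j : V} (h : G.Adj i j) : A s(i, j) ≤ vw G A i :=
  Finset.single_le_sum (f := fun j => A s(i, j))
    (fun k hk => (hA _ (by simpa using hk)).le) (by simpa using h)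

theorem log_le_log_vw (G : SimpleGraph V) [DecidableRel G.Adj] {A : Sym2 V → ℝ}
    (hA : ∀ e ∈ G.edgeFinset, 0 < A e) {i j : V} (h : G.Adj i j) :
    log (A s(i, j)) ≤ log (vw G A i) :=
  log_le_log (hA _ (by simpa using h)) (le_vw G hA h)

theorem logRatio_nonneg (G : SimpleGraph V) [DecidableRel G.Adj] {A : Sym2 V → ℝ}
    (hA : ∀ e ∈ G.edgeFinset, 0 < A e) : ∀ e ∈ G.edgeFinset, 0 ≤ logRatio G A e := by
  intro e he
  induction e with
  | _ a b =>
    have hab : G.Adj a b := by simpa using he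
    have h1 := log_le_log_vw G hA hab
    have h2 := log_le_log_vw G hA hab.symm
    rw [Sym2.eq_swap] at h2
    simp only [logRatio, ssum, Sym2.lift_mk]
    linarith

theorem log_vw_sub_le_walk (G : SimpleGraph V) [DecidableRel G.Adj] {A : Sym2 V → ℝ}
    (hA : ∀ e ∈ G.edgeFinset, 0 < A e) {i m : V} (p : G.Walk i m) :
    log (vw G A m) - log (vw G A i) ≤ (p.edges.map (logRatio G A)).sum := by
  induction p with
  | nil => simp
  | @cons a b c hab p ih =>
    have h1 := log_le_log_vw G hA hab
    simp only [SimpleGraph.Walk.edges_cons, List.map_cons, List.sum_cons]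
    simp only [logRatio, ssum, Sym2.lift_mk] at ih ⊢
    linarith

theorem log_vw_sub_log_le (G : SimpleGraph V) [DecidableRel G.Adj] (hG : G.Connected)
    {A : Sym2 V → ℝ} (hA : ∀ e ∈ G.edgeFinset, 0 < A e) (m : V) {e : Sym2 V}
    (he : e ∈ G.edgeFinset) :
    log (vw G A m) - log (A e) ≤ 2 * ∑ f ∈ G.edgeFinset, logRatio G A f := by
  have hnn := logRatio_nonneg G hA
  have h1 := Finset.single_le_sum hnn he
  induction e with
  | _ a b =>
    have hab : G.Adj a b := by simpa using he
    obtain ⟨p, hp⟩ := hG.exists_isPath b m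
    have h2 := log_vw_sub_le_walk G hA p
    rw [← List.sum_toFinset _ hp.isTrail.edges_nodup] at h2
    have h3 : ∑ f ∈ p.edges.toFinset, logRatio G A f ≤ ∑ f ∈ G.edgeFinset, logRatio G A f := by
      refine Finset.sum_le_sum_of_subset_of_nonneg (fun f hf => ?_) fun f hf _ => hnn f hf
      rw [List.mem_toFinset] at hf
      simpa using p.edges_subset_edgeSet hf
    have h4 := log_le_log_vw G hA hab
    have h5 : logRatio G A s(a, b)
        = log (vw G A a) + log (vw G A b) - 2 * log (A s(a, b)) := rfl
    linarith

/-- Lower bound for the likelihood ratio of the walk with all initial weights lowered by `s`. -/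
theorem exists_le_log_Znorm_sub (G : SimpleGraph V) [DecidableRel G.Adj]
    (hadj : ∀ v, ∃ u, G.Adj v u) {a : Sym2 V → ℝ} {s : ℝ} (hs : 0 < s)
    (has : ∀ e ∈ G.edgeFinset, s < a e) :
    ∃ c : ℝ, ∀ (x : V) (A : Sym2 V → ℝ), (∀ e ∈ G.edgeFinset, a e ≤ A e) →
      c + s / 2 * ∑ e ∈ G.edgeFinset, logRatio G A e
        ≤ log (Znorm G x fun e => A e - s) - log (Znorm G x A) := by
  have ha : ∀ e ∈ G.edgeFinset, 0 < a e := fun e he => hs.trans (has e he)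
  obtain ⟨κ, hκ0, hκ⟩ : ∃ κ : ℝ, 0 < κ ∧ ∀ e ∈ G.edgeFinset, κ * a e ≤ a e - s ∧ κ ≤ 1 := by
    rcases G.edgeFinset.eq_empty_or_nonempty with h | h
    · exact ⟨1, one_pos, by simp [h]⟩
    · obtain ⟨f, hf, hmin⟩ := Finset.exists_min_image G.edgeFinset a h
      have h1 := has f hf
      have h2 := ha f hf
      refine ⟨1 - s / a f, by rw [sub_pos, div_lt_one h2]; exact h1, fun e he => ⟨?_, ?_⟩⟩
      · have : s ≤ s / a f * a e := by
          rw [div_mul_eq_mul_div, le_div_iff₀ h2]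
          exact mul_le_mul_of_nonneg_left (hmin e he) hs.le
        linarith
      · have : 0 < s / a f := by positivity
        linarith
  set σ : V → ℝ := fun v => s * (G.neighborFinset v).card / 2 with hσ
  refine ⟨∑ v, (σ v * log (κ / 2) - σ v / (κ * vw G a v / 2))
    + log 2 * (s * G.edgeFinset.card), fun x A hA => ?_⟩
  have hApos : ∀ e ∈ G.edgeFinset, 0 < A e := fun e he => (ha e he).trans_le (hA e he)
  have hAκ : ∀ e ∈ G.edgeFinset, κ * A e ≤ A e - s := by
    intro e he
    obtain ⟨h1, h2⟩ := hκ e he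
    nlinarith [hA e he]
  have hAs : ∀ e ∈ G.edgeFinset, 0 < A e - s := fun e he => by
    linarith [has e he, hA e he]
  rw [log_Znorm G hadj hAs, log_Znorm G hadj hApos]
  have hvw : ∀ v, vw G (fun e => A e - s) v = vw G A v - 2 * σ v := by
    intro v
    simp only [vw, hσ, Finset.sum_sub_distrib, Finset.sum_const, nsmul_eq_mul]; ring
  have hb : ∀ v, bwt G x A v = bwt G x (fun e => A e - s) v + σ v := by
    intro v; simp only [bwt, hvw]; ring
  have e1 : -∑ e ∈ G.edgeFinset, s * log (A e) ≤
      ∑ e ∈ G.edgeFinset, log (Gamma (A e - s)) - ∑ e ∈ G.edgeFinset, log (Gamma (A e)) := by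
    rw [← Finset.sum_sub_distrib, ← Finset.sum_neg_distrib]
    refine Finset.sum_le_sum fun e he => ?_
    have := log_Gamma_add_sub_le (hAs e he) hs.le
    rw [sub_add_cancel] at this
    linarith
  have e2 : ∑ v, (σ v * log (κ / 2) - σ v / (κ * vw G a v / 2)) + ∑ v, σ v * log (vw G A v)
      ≤ ∑ v, log (Gamma (bwt G x A v)) - ∑ v, log (Gamma (bwt G x (fun e => A e - s) v)) := by
    rw [← Finset.sum_sub_distrib, ← Finset.sum_add_distrib]
    refine Finset.sum_le_sum fun v _ => ?_
    have hσ0 : 0 ≤ σ v := by positivity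
    have hav : 0 < vw G a v := vw_pos G ha (hadj v).choose_spec
    have hav' : vw G a v ≤ vw G A v :=
      Finset.sum_le_sum fun j hj => hA _ (by simpa using hj)
    have hAv : κ * vw G A v ≤ vw G (fun e => A e - s) v := by
      unfold vw
      rw [Finset.mul_sum]
      exact Finset.sum_le_sum fun j hj => hAκ _ (by simpa using hj)
    have hlow : κ * vw G A v / 2 ≤ bwt G x (fun e => A e - s) v := by
      unfold bwt
      split_ifs <;> linarith
    have hlow0 : 0 < κ * vw G A v / 2 := by
      have := mul_pos hκ0 (hav.trans_le hav'); positivity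
    have h := le_log_Gamma_add_sub (hlow0.trans_le hlow) hσ0
    rw [hb v]
    have h3 : log (κ / 2) + log (vw G A v) ≤ log (bwt G x (fun e => A e - s) v) := by
      rw [← log_mul (by positivity) (hav.trans_le hav').ne']
      exact log_le_log (by have := hav.trans_le hav'; positivity) (by linarith)
    have h4 := mul_le_mul_of_nonneg_left h3 hσ0
    have h5 : σ v / bwt G x (fun e => A e - s) v ≤ σ v / (κ * vw G a v / 2) := by
      refine div_le_div_of_nonneg_left hσ0 (by positivity) (le_trans ?_ hlow)
      have := mul_le_mul_of_nonneg_left hav' hκ0.le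
      linarith
    linarith
  have e3 : ∑ v, σ v * log (vw G A v) - ∑ e ∈ G.edgeFinset, s * log (A e)
      = s / 2 * ∑ e ∈ G.edgeFinset, logRatio G A e := by
    have h := sum_vw_mul G (fun _ => s / 2) fun v => log (vw G A v)
    have h' : ∀ v, vw G (fun _ => s / 2) v = σ v := by
      intro v; simp only [vw, hσ, Finset.sum_const, nsmul_eq_mul]; ring
    simp only [h'] at h
    rw [h, Finset.mul_sum, ← Finset.sum_sub_distrib]
    exact Finset.sum_congr rfl fun e _ => by unfold logRatio; ring
  have e4 : ∑ e ∈ G.edgeFinset, (A e - s) = ∑ e ∈ G.edgeFinset, A e - G.edgeFinset.card * s := by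
    rw [Finset.sum_sub_distrib, Finset.sum_const, nsmul_eq_mul]
  rw [e4]
  linarith

theorem sum_vw (G : SimpleGraph V) [DecidableRel G.Adj] (w : Sym2 V → ℝ) :
    ∑ v, vw G w v = 2 * ∑ e ∈ G.edgeFinset, w e := by
  have := sum_vw_mul G w fun _ => 1
  simp only [mul_one] at this
  rw [this, Finset.mul_sum]
  refine Finset.sum_congr rfl fun e _ => ?_
  have : ssum (fun _ : V => (1 : ℝ)) e = 2 := by
    induction e with
    | _ a b => simp only [ssum, Sym2.lift_mk]; norm_num
  rw [this]; ring

theorem sum_edgeCount {T : ℕ} (v0 : V) (G : SimpleGraph V) [DecidableRel G.Adj]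
    {x : Fin (T + 1) → V} (hx : Admissible v0 G x) :
    ∑ e ∈ G.edgeFinset, (edgeCount v0 x e : ℝ) = T := by
  have := Finset.card_eq_sum_card_fiberwise (s := Finset.range T) (t := G.edgeFinset)
    (f := fun k => s(extendPath v0 x k, extendPath v0 x (k + 1)))
    (fun k hk => by simpa using hx.2 k (by simpa using hk))
  rw [Finset.card_range] at this
  unfold edgeCount
  exact_mod_cast this.symm

/-- Decay of the inverse edge local times of the reinforced walk. -/
theorem exists_sum_errwProb_inv_le (G : SimpleGraph V) [DecidableRel G.Adj] (hG : G.Connected)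
    (hadj : ∀ v, ∃ u, G.Adj v u) (v0 : V) {a : Sym2 V → ℝ} {r : ℝ} (hr : 0 < r) (hr1 : r ≤ 1)
    (har : ∀ e ∈ G.edgeFinset, 4 * r < a e) {e : Sym2 V} (he : e ∈ G.edgeFinset) :
    ∃ C : ℝ, 0 ≤ C ∧ ∀ T : ℕ, 1 ≤ T → ∑ x : Fin (T + 1) → V, errwProb G v0 a T x *
      (endWeight v0 a x e)⁻¹ ≤ C * (T : ℝ) ^ (-r) := by
  obtain ⟨c, hc⟩ := exists_le_log_Znorm_sub G hadj (s := 4 * r) (by linarith) har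
  have ha : ∀ e ∈ G.edgeFinset, 0 < a e := fun e he => by linarith [har e he]
  have ha' : ∀ e ∈ G.edgeFinset, 0 < a e - 4 * r := fun e he => by linarith [har e he]
  set n : ℝ := (Fintype.card V : ℝ) with hn
  have hn0 : 0 < n := by
    have : 0 < Fintype.card V := Fintype.card_pos_iff.2 ⟨v0⟩
    rw [hn]; exact_mod_cast this
  set Q : ℝ := Znorm G v0 (fun e => a e - 4 * r) / Znorm G v0 a with hQ
  have hZ' := Znorm_pos G hadj ha' v0
  have hZ := Znorm_pos G hadj ha v0
  have hQ0 : 0 < Q := div_pos hZ' hZ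
  have hae := ha e he
  refine ⟨a e ^ (r - 1) * n ^ r * exp (-c) * Q, by positivity, fun T hT => ?_⟩
  have hTpos : (0 : ℝ) < T := by exact_mod_cast hT
  have key : ∀ x : Fin (T + 1) → V, errwProb G v0 a T x * (endWeight v0 a x e)⁻¹
      ≤ a e ^ (r - 1) * n ^ r * exp (-c) * Q * (T : ℝ) ^ (-r)
        * errwProb G v0 (fun e => a e - 4 * r) T x := by
    intro x
    by_cases hx : Admissible v0 G x
    swap
    · rw [errwProb_eq v0 G hadj ha, errwProb_eq v0 G hadj ha', if_neg hx, if_neg hx]; simp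
    rw [errwProb_eq v0 G hadj ha, errwProb_eq v0 G hadj ha', if_pos hx, if_pos hx]
    set A := endWeight v0 a x with hA
    have hAB : endWeight v0 (fun e => a e - 4 * r) x = fun e => A e - 4 * r := by
      funext f; rw [hA, endWeight_eq, endWeight_eq]; ring
    rw [hAB]
    have hApos : ∀ e ∈ G.edgeFinset, 0 < A e := endWeight_pos v0 ha x
    have hAa : ∀ e ∈ G.edgeFinset, a e ≤ A e := fun e _ => le_endWeight v0 a x e
    have hAs : ∀ e ∈ G.edgeFinset, 0 < A e - 4 * r := fun e he => by
      linarith [hAa e he, har e he]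
    have hZA := Znorm_pos G hadj hApos (x (Fin.last T))
    have hZA' := Znorm_pos G hadj hAs (x (Fin.last T))
    have hAe := hApos e he
    have hsum : ∑ v, vw G A v ≥ T := by
      rw [sum_vw]
      have h1 : ∑ e ∈ G.edgeFinset, A e ≥ T := by
        rw [← sum_edgeCount v0 G hx]
        exact Finset.sum_le_sum fun e he => by
          rw [hA, endWeight_eq]; linarith [ha e he]
      linarith
    obtain ⟨m, -, hm⟩ : ∃ m ∈ (Finset.univ : Finset V), (T : ℝ) / n ≤ vw G A m := by
      refine Finset.exists_le_of_sum_le ⟨v0, Finset.mem_univ _⟩ ?_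
      rw [Finset.sum_const, Finset.card_univ, nsmul_eq_mul, ← hn, mul_div_cancel₀ _ hn0.ne']
      exact hsum
    have h1 := hc (x (Fin.last T)) A hAa
    have h2 := log_vw_sub_log_le G hG hApos m he
    have h3 : log (T / n) ≤ log (vw G A m) := log_le_log (by positivity) hm
    rw [log_div hTpos.ne' hn0.ne'] at h3
    have h4 : log (a e) ≤ log (A e) := log_le_log hae (hAa e he)
    have hfin : (A e)⁻¹ ≤ a e ^ (r - 1) * n ^ r * exp (-c) * (T : ℝ) ^ (-r) *
        (Znorm G (x (Fin.last T)) (fun e => A e - 4 * r) / Znorm G (x (Fin.last T)) A) := by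
      rw [← log_le_log_iff (by positivity) (by positivity), log_mul (by positivity) (by positivity),
        log_mul (by positivity) (by positivity), log_mul (by positivity) (by positivity),
        log_mul (by positivity) (by positivity), log_inv, log_rpow hae, log_rpow hn0,
        log_exp, log_rpow hTpos, log_div hZA'.ne' hZA.ne']
      have h5 := mul_le_mul_of_nonneg_left (add_le_add h2 h3) hr.le
      have h6 := mul_le_mul_of_nonneg_left h4 (show 0 ≤ 1 - r by linarith)
      linarith
    calc Znorm G (x (Fin.last T)) A / Znorm G v0 a * (A e)⁻¹
        ≤ Znorm G (x (Fin.last T)) A / Znorm G v0 a * _ :=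
          mul_le_mul_of_nonneg_left hfin (by positivity)
      _ = _ := by
          rw [hQ]
          generalize Znorm G (x (Fin.last T)) (fun e => A e - 4 * r) = z1 at hZA' ⊢
          generalize Znorm G v0 (fun e => a e - 4 * r) = z2 at hZ' ⊢
          field_simp
  calc _ ≤ _ := Finset.sum_le_sum fun x _ => key x
    _ = _ := by rw [← Finset.mul_sum, sum_errwProb v0 G hadj ha', mul_one]

theorem Phi_le_sum_Lam (G : SimpleGraph V) [DecidableRel G.Adj] (hadj : ∀ v, ∃ u, G.Adj v u)
    {A B : Sym2 V → ℝ} (hA : ∀ e ∈ G.edgeFinset, 0 < A e) (hB : ∀ e ∈ G.edgeFinset, 0 < B e)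
    (x : V) : Phi G x A B ≤ ∑ e ∈ G.edgeFinset, Lam (A e) (B e) := by
  have : 0 ≤ ∑ v, Lam (bwt G x A v) (bwt G x B v) := Finset.sum_nonneg fun v _ =>
    Lam_nonneg (bwt_pos G hA (hadj v).choose_spec) (bwt_pos G hB (hadj v).choose_spec)
  unfold Phi
  linarith

/-- Decay of the closed-form divergence gap. -/
theorem exists_Phi_sub_le (G : SimpleGraph V) [DecidableRel G.Adj] (hG : G.Connected)
    (hadj : ∀ v, ∃ u, G.Adj v u) (v0 : V) {a0 a1 : Sym2 V → ℝ}
    (ha1 : ∀ e ∈ G.edgeFinset, 0 < a1 e) {r : ℝ} (hr : 0 < r) (hr1 : r ≤ 1)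
    (har : ∀ e ∈ G.edgeFinset, 4 * r < a0 e) :
    ∃ C : ℝ, ∀ T : ℕ, 1 ≤ T → Phi G v0 a0 a1 - ∑ x : Fin (T + 1) → V, errwProb G v0 a0 T x *
      log (errwProb G v0 a0 T x / errwProb G v0 a1 T x) ≤ C * (T : ℝ) ^ (-r) := by
  have ha0 : ∀ e ∈ G.edgeFinset, 0 < a0 e := fun e he => by linarith [har e he]
  have := fun e : G.edgeFinset => exists_sum_errwProb_inv_le G hG hadj v0 hr hr1 har e.2
  choose C hC0 hC using this
  set K : Sym2 V → ℝ := fun e => |a1 e - a0 e| * (|a1 e - a0 e| + 1) * (a0 e / min (a0 e) (a1 e))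
    with hK
  have hLam : ∀ T, ∀ x : Fin (T + 1) → V, ∀ e ∈ G.edgeFinset,
      Lam (endWeight v0 a0 x e) (endWeight v0 a1 x e) ≤ K e * (endWeight v0 a0 x e)⁻¹ := by
    intro T x e he
    have h0 := endWeight_pos v0 ha0 x e he
    have h1 := endWeight_pos v0 ha1 x e he
    refine (Lam_le h0 h1).trans ?_
    have hd : endWeight v0 a1 x e - endWeight v0 a0 x e = a1 e - a0 e := by
      rw [endWeight_eq, endWeight_eq]; ring
    have hm : min (endWeight v0 a0 x e) (endWeight v0 a1 x e)
        = min (a0 e) (a1 e) + edgeCount v0 x e := by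
      rw [endWeight_eq, endWeight_eq, min_add_add_right]
    have hN : (0 : ℝ) ≤ edgeCount v0 x e := Nat.cast_nonneg _
    have hmp : 0 < min (a0 e) (a1 e) := lt_min (ha0 e he) (ha1 e he)
    have hml : min (a0 e) (a1 e) ≤ a0 e := min_le_left _ _
    rw [hd, hm, hK, mul_assoc, div_eq_mul_inv]
    refine mul_le_mul_of_nonneg_left ?_ (by positivity)
    rw [endWeight_eq] at h0 ⊢
    rw [← div_eq_mul_inv, div_div, inv_eq_one_div, div_le_div_iff₀ (by positivity) (by positivity)]
    nlinarith
  refine ⟨∑ e : G.edgeFinset, K e * C e, fun T hT => ?_⟩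
  rw [← sum_errwProb_Phi G hadj v0 ha0 ha1 T, ← Finset.sum_sub_distrib]
  calc _ ≤ ∑ x : Fin (T + 1) → V, ∑ e : G.edgeFinset,
        errwProb G v0 a0 T x * (K e * (endWeight v0 a0 x e)⁻¹) := by
        refine Finset.sum_le_sum fun x _ => ?_
        rw [mul_add, add_sub_cancel_right, ← Finset.mul_sum]
        refine mul_le_mul_of_nonneg_left ?_ (errwProb_nonneg v0 G hadj ha0 x)
        refine (Phi_le_sum_Lam G hadj (endWeight_pos v0 ha0 x) (endWeight_pos v0 ha1 x) _).trans ?_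
        rw [← Finset.sum_coe_sort]
        exact Finset.sum_le_sum fun e _ => hLam T x e e.2
    _ = ∑ e : G.edgeFinset, K e * ∑ x : Fin (T + 1) → V,
        errwProb G v0 a0 T x * (endWeight v0 a0 x e)⁻¹ := by
        rw [Finset.sum_comm]
        refine Finset.sum_congr rfl fun e _ => ?_
        rw [Finset.mul_sum]
        exact Finset.sum_congr rfl fun x _ => by ring
    _ ≤ ∑ e : G.edgeFinset, K e * (C e * (T : ℝ) ^ (-r)) := by
        refine Finset.sum_le_sum fun e _ => mul_le_mul_of_nonneg_left (hC e T hT) ?_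
        have h0 := ha0 e e.2
        have h1 := ha1 e e.2
        have : 0 < min (a0 e) (a1 e) := lt_min h0 h1
        positivity
    _ = _ := by
        rw [Finset.sum_mul]
        exact Finset.sum_congr rfl fun e _ => by ring

section Discrete

variable {Ω : Type*} [Fintype Ω] [MeasurableSpace Ω] [DiscreteMeasurableSpace Ω]

theorem lintegral_discreteMeasure (p : Ω → ℝ) (f : Ω → ℝ≥0∞) :
    ∫⁻ x, f x ∂(discreteMeasure p) = ∑ x, ENNReal.ofReal (p x) * f x := by
  unfold discreteMeasure
  rw [lintegral_finsetSum_measure]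
  simp

instance (p : Ω → ℝ) : IsFiniteMeasure (discreteMeasure p) := by
  refine ⟨?_⟩
  rw [← lintegral_one, lintegral_discreteMeasure]
  simp

theorem discreteMeasure_eq_withDensity {p q : Ω → ℝ} (hq : ∀ x, 0 ≤ q x)
    (hpq : ∀ x, q x = 0 → p x = 0) :
    discreteMeasure p = (discreteMeasure q).withDensity fun x => ENNReal.ofReal (p x / q x) := by
  refine Measure.ext_of_lintegral _ fun f hf => ?_
  rw [lintegral_withDensity_eq_lintegral_mul _ (Measurable.of_discrete) hf,
    lintegral_discreteMeasure, lintegral_discreteMeasure]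
  refine Finset.sum_congr rfl fun x _ => ?_
  rw [Pi.mul_apply, ← mul_assoc, ← ENNReal.ofReal_mul (hq x)]
  by_cases h : q x = 0
  · simp [h, hpq x h]
  · rw [mul_div_cancel₀ _ h]

theorem integral_discreteMeasure {p : Ω → ℝ} (hp : ∀ x, 0 ≤ p x) (f : Ω → ℝ) :
    ∫ x, f x ∂(discreteMeasure p) = ∑ x, p x * f x := by
  unfold discreteMeasure
  rw [integral_finsetSum_measure]
  · refine Finset.sum_congr rfl fun x _ => ?_
    rw [integral_smul_measure, integral_dirac, ENNReal.toReal_ofReal (hp x), smul_eq_mul]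
  · intro x _
    exact (integrable_dirac (by simp)).smul_measure ENNReal.ofReal_ne_top

theorem KL_discreteMeasure {p q : Ω → ℝ} (hp : ∀ x, 0 ≤ p x) (hq : ∀ x, 0 ≤ q x)
    (hpq : ∀ x, q x = 0 → p x = 0) :
    KL (discreteMeasure p) (discreteMeasure q) = ((∑ x, p x * log (p x / q x) : ℝ) : EReal) := by
  have h := discreteMeasure_eq_withDensity hq hpq
  have hac : discreteMeasure p ≪ discreteMeasure q := by
    rw [h]; exact withDensity_absolutelyContinuous _ _
  unfold KL
  rw [if_pos hac, ← integral_discreteMeasure hp]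
  congr 1
  refine integral_congr_ae ?_
  have h1 : (discreteMeasure p).rnDeriv (discreteMeasure q)
      =ᵐ[discreteMeasure q] fun x => ENNReal.ofReal (p x / q x) := by
    rw [h]
    exact Measure.rnDeriv_withDensity _ (Measurable.of_discrete)
  filter_upwards [hac.ae_le h1] with x hx
  rw [hx, ENNReal.toReal_ofReal (div_nonneg (hp x) (hq x))]

end Discrete

/-- The graph Laplacian with weights `w`, with the row and the column of `x` removed. -/
def redLap (G : SimpleGraph V) [DecidableRel G.Adj] (x : V) (w : Sym2 V → ℝ) :
    Matrix {v : V // v ≠ x} {v : V // v ≠ x} ℝ :=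
  Matrix.of fun i j => (if i = j then vw G w i else 0) -
    if G.Adj i j then w s((i : V), (j : V)) else 0

/-- A choice of an out-neighbour at every vertex other than `x` is rooted if following it
decreases some rank. -/
def Rooted (x : V) (f : {v : V // v ≠ x} → V) : Prop :=
  ∃ r : V → ℕ, ∀ i, r (f i) < r i

/-- Reduced Laplacian of a functional graph. -/
def funLap (x : V) (f : {v : V // v ≠ x} → V) :
    Matrix {v : V // v ≠ x} {v : V // v ≠ x} ℝ :=
  Matrix.of fun i j => (if i = j then 1 else 0) - if (j : V) = f i then 1 else 0

/-- The edges of a functional graph. -/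
def funEdges (x : V) (f : {v : V // v ≠ x} → V) : Finset (Sym2 V) :=
  Finset.univ.image fun i : {v : V // v ≠ x} => s((i : V), f i)

theorem det_redLap_expand (G : SimpleGraph V) [DecidableRel G.Adj] (x : V) (w : Sym2 V → ℝ) :
    (redLap G x w).det =
      ∑ f ∈ Fintype.piFinset fun i : {v : V // v ≠ x} => G.neighborFinset i,
        (∏ i : {v : V // v ≠ x}, w s((i : V), f i)) * (funLap x f).det := by
  have h : redLap G x w = fun i : {v : V // v ≠ x} => ∑ u ∈ G.neighborFinset (i : V),
      w s((i : V), u) • fun j : {v : V // v ≠ x} =>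
        ((if i = j then 1 else 0) - if (j : V) = u then 1 else 0 : ℝ) := by
    ext i j
    simp only [redLap, Matrix.of_apply, Finset.sum_apply, Pi.smul_apply, smul_eq_mul, mul_sub,
      Finset.sum_sub_distrib, mul_ite, mul_one, mul_zero, Finset.sum_ite_eq,
      SimpleGraph.mem_neighborFinset, vw]
    congr 1
    by_cases hij : i = j <;> simp [hij]
  have h2 : (redLap G x w).det = Matrix.detRowAlternating.toMultilinearMap (redLap G x w) := rfl
  rw [h2, h, MultilinearMap.map_sum_finset]
  refine Finset.sum_congr rfl fun f _ => ?_
  rw [MultilinearMap.map_smul_univ, smul_eq_mul]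
  rfl

theorem Rooted.det_funLap {x : V} {f : {v : V // v ≠ x} → V} (hf : Rooted x f) :
    (funLap x f).det = 1 := by
  obtain ⟨r, hr⟩ := hf
  have hb : (funLap x f).BlockTriangular fun i => OrderDual.toDual (r i) := by
    intro i j hij
    have hij' : r i < r j := hij
    have h1 : i ≠ j := by rintro rfl; exact lt_irrefl _ hij'
    have h2 : (j : V) ≠ f i := by
      intro h; have := hr i; rw [← h] at this; omega
    simp [funLap, h1, h2]
  rw [hb.det]
  refine Finset.prod_eq_one fun k _ => ?_
  have : (funLap x f).toSquareBlock (fun i => OrderDual.toDual (r i)) k = 1 := by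
    ext ⟨i, hi⟩ ⟨j, hj⟩
    have h2 : (j : V) ≠ f i := by
      intro h
      have := hr i
      rw [← h] at this
      have h3 : r i = r j := hi.trans hj.symm
      omega
    simp [funLap, Matrix.toSquareBlock_def, h2, Matrix.one_apply]
  rw [this, Matrix.det_one]

theorem det_funLap_of_not_rooted {x : V} {f : {v : V // v ≠ x} → V} (hf : ¬ Rooted x f) :
    (funLap x f).det = 0 := by
  let st : V → V := fun v => if h : v ≠ x then f ⟨v, h⟩ else x
  have hst : ∀ i : {v : V // v ≠ x}, st i = f i := fun i => by simp [st, i.2]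
  have hS : ∃ i : {v : V // v ≠ x}, ∀ k, st^[k] i ≠ x := by
    by_contra! hcon
    have hall : ∀ v : V, ∃ k, st^[k] v = x := fun v => by
      by_cases h : v = x
      · exact ⟨0, h⟩
      · exact hcon ⟨v, h⟩
    refine hf ⟨fun v => Nat.find (hall v), fun i => ?_⟩
    have h1 := Nat.find_spec (hall i)
    rcases hk : Nat.find (hall i) with _ | k
    · rw [hk] at h1; exact absurd h1 i.2
    · rw [hk, Function.iterate_succ_apply, hst] at h1
      have := Nat.find_min' (hall (f i)) h1
      show Nat.find (hall (f i)) < Nat.find (hall i)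
      omega
  obtain ⟨i₀, hi₀⟩ := hS
  refine Matrix.exists_mulVec_eq_zero_iff.1
    ⟨fun i => if ∀ k, st^[k] i ≠ x then 1 else 0, fun h => ?_, ?_⟩
  · have := congrFun h i₀
    simp [hi₀] at this
  · ext i
    have hiff : (∀ k, st^[k] i ≠ x) ↔ ∀ k, st^[k] (f i) ≠ x := by
      constructor
      · intro h k
        have := h (k + 1)
        rwa [Function.iterate_succ_apply, hst] at this
      · intro h k
        rcases k with _ | k
        · exact i.2
        · rw [Function.iterate_succ_apply, hst]; exact h k
    have hsum : ∑ j : {v : V // v ≠ x}, (if (j : V) = f i then (1 : ℝ) else 0) *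
        (if ∀ k, st^[k] j ≠ x then 1 else 0) = if ∀ k, st^[k] (f i) ≠ x then 1 else 0 := by
      by_cases hx : f i = x
      · rw [Finset.sum_eq_zero, if_neg]
        · push Not; exact ⟨0, hx⟩
        · intro j _
          rw [if_neg, zero_mul]
          rw [hx]; exact j.2
      · rw [Finset.sum_eq_single ⟨f i, hx⟩]
        · simp
        · intro j _ hj
          rw [if_neg, zero_mul]
          intro h; exact hj (Subtype.ext h)
        · simp
    simp only [Matrix.mulVec, dotProduct, funLap, Matrix.of_apply, sub_mul,
      Finset.sum_sub_distrib, hsum, Pi.zero_apply, ← hiff]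
    simp only [ite_mul, one_mul, zero_mul, Finset.sum_ite_eq, Finset.mem_univ, if_true, sub_self]

theorem Rooted.injective {x : V} {f : {v : V // v ≠ x} → V} (hf : Rooted x f) :
    Function.Injective fun i : {v : V // v ≠ x} => s((i : V), f i) := by
  obtain ⟨r, hr⟩ := hf
  intro i j hij
  rcases Sym2.eq_iff.1 hij with h | h
  · exact Subtype.ext h.1
  · have h1 := hr i
    have h2 := hr j
    rw [← h.1] at h2
    rw [h.2] at h1
    omega

theorem Rooted.card_funEdges {x : V} {f : {v : V // v ≠ x} → V} (hf : Rooted x f) :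
    (funEdges x f).card + 1 = Fintype.card V := by
  rw [funEdges, Finset.card_image_of_injective _ hf.injective, Finset.card_univ,
    Fintype.card_subtype_compl, Fintype.card_subtype_eq]
  have : 0 < Fintype.card V := Fintype.card_pos_iff.2 ⟨x⟩
  omega

theorem Rooted.prod_funEdges {x : V} {f : {v : V // v ≠ x} → V} (hf : Rooted x f)
    (w : Sym2 V → ℝ) : ∏ e ∈ funEdges x f, w e = ∏ i : {v : V // v ≠ x}, w s((i : V), f i) := by
  rw [funEdges, Finset.prod_image fun i _ j _ h => hf.injective h]

theorem funEdges_subset {G : SimpleGraph V} [DecidableRel G.Adj] {x : V}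
    {f : {v : V // v ≠ x} → V} (hf : ∀ i : {v : V // v ≠ x}, G.Adj i (f i)) : funEdges x f ⊆ G.edgeFinset := by
  intro e he
  obtain ⟨i, -, rfl⟩ := Finset.mem_image.1 he
  simpa using hf i

theorem edgeSet_fromEdgeSet_of_subset {G : SimpleGraph V} [DecidableRel G.Adj]
    {F : Finset (Sym2 V)} (hF : F ⊆ G.edgeFinset) :
    (SimpleGraph.fromEdgeSet (F : Set (Sym2 V))).edgeSet = F := by
  rw [SimpleGraph.edgeSet_fromEdgeSet, sdiff_eq_left, Set.disjoint_left]
  intro e he hd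
  exact G.not_isDiag_of_mem_edgeSet (SimpleGraph.mem_edgeFinset.1 (hF he)) hd

theorem Rooted.isTree {G : SimpleGraph V} [DecidableRel G.Adj] {x : V}
    {f : {v : V // v ≠ x} → V} (hf : Rooted x f) (hG : ∀ i : {v : V // v ≠ x}, G.Adj i (f i)) :
    (SimpleGraph.fromEdgeSet (funEdges x f : Set (Sym2 V))).IsTree := by
  rw [SimpleGraph.isTree_iff_connected_and_card,
    edgeSet_fromEdgeSet_of_subset (funEdges_subset hG)]
  constructor
  · have hreach : ∀ n v, (hf.choose v) ≤ n →
        (SimpleGraph.fromEdgeSet (funEdges x f : Set (Sym2 V))).Reachable v x := by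
      intro n
      induction n with
      | zero =>
        intro v hv
        by_cases h : v = x
        · rw [h]
        · have := hf.choose_spec ⟨v, h⟩
          simp only at this
          omega
      | succ n ih =>
        intro v hv
        by_cases h : v = x
        · rw [h]
        · have h1 := hf.choose_spec ⟨v, h⟩
          refine SimpleGraph.Reachable.trans (SimpleGraph.Adj.reachable ?_)
            (ih (f ⟨v, h⟩) (by simp only at h1; omega))
          rw [SimpleGraph.fromEdgeSet_adj]
          exact ⟨Finset.mem_coe.2 (Finset.mem_image.2 ⟨⟨v, h⟩, Finset.mem_univ _, rfl⟩),
            (hG ⟨v, h⟩).ne⟩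
    have : Nonempty V := ⟨x⟩
    exact ⟨fun u v => (hreach _ u le_rfl).trans (hreach _ v le_rfl).symm⟩
  · simpa using hf.card_funEdges

theorem Rooted.eq_of_funEdges_eq {x : V} {f g : {v : V // v ≠ x} → V} (hg : Rooted x g)
    (h : funEdges x f = funEdges x g) : f = g := by
  obtain ⟨r, hr⟩ := hg
  have key : ∀ n, ∀ i : {v : V // v ≠ x}, r i ≤ n → f i = g i := by
    intro n
    induction n with
    | zero => intro i hi; have := hr i; omega
    | succ n ih =>
      intro i hi
      by_contra hne
      have hmem : s((i : V), g i) ∈ funEdges x f := by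
        rw [h]; exact Finset.mem_image.2 ⟨i, Finset.mem_univ _, rfl⟩
      obtain ⟨j, -, hj⟩ := Finset.mem_image.1 hmem
      rcases Sym2.eq_iff.1 hj with h1 | h1
      · have : j = i := Subtype.ext h1.1
        exact hne (this ▸ h1.2)
      · have h2 := hr i
        have h3 := ih j (by rw [h1.1]; omega)
        have h4 := hr j
        rw [← h3, h1.2, h1.1] at h4
        omega
  exact funext fun i => key _ i le_rfl

theorem exists_rooted_of_mem_spanningTrees {G : SimpleGraph V} [DecidableRel G.Adj] (x : V)
    {F : Finset (Sym2 V)} (hF : F ∈ spanningTrees G) :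
    ∃ f : {v : V // v ≠ x} → V, (∀ i : {v : V // v ≠ x}, G.Adj i (f i)) ∧ Rooted x f ∧ funEdges x f = F := by
  obtain ⟨hsub, hT⟩ := Finset.mem_filter.1 hF
  rw [Finset.mem_powerset] at hsub
  set T := SimpleGraph.fromEdgeSet (F : Set (Sym2 V)) with hTdef
  have hstep : ∀ i : {v : V // v ≠ x}, ∃ u, T.Adj i u ∧ T.dist u x < T.dist i x := by
    rintro ⟨i, hi⟩
    obtain ⟨p, hp⟩ := hT.connected.exists_walk_length_eq_dist i x
    cases p with
    | nil => exact absurd rfl hi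
    | @cons _ u _ hadj q =>
      refine ⟨u, hadj, ?_⟩
      have := SimpleGraph.dist_le q
      simp only [SimpleGraph.Walk.length_cons] at hp
      simp only
      omega
  choose f hf hr using hstep
  have hroot : Rooted x f := ⟨fun v => T.dist v x, hr⟩
  have hmem : ∀ i : {v : V // v ≠ x}, s((i : V), f i) ∈ F := fun i => by
    have := hf i
    rw [hTdef, SimpleGraph.fromEdgeSet_adj] at this
    exact this.1
  refine ⟨f, fun i => by simpa using hsub (hmem i), hroot, ?_⟩
  refine Finset.eq_of_subset_of_card_le (fun e he => ?_) ?_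
  · obtain ⟨i, -, rfl⟩ := Finset.mem_image.1 he
    exact hmem i
  · have h1 := hroot.card_funEdges
    have h2 := (SimpleGraph.isTree_iff_connected_and_card.1 hT).2
    rw [hTdef, edgeSet_fromEdgeSet_of_subset hsub] at h2
    simp only [SetLike.coe_sort_coe, Nat.card_eq_fintype_card, Fintype.card_coe] at h2
    omega

/-- The weighted matrix-tree theorem. -/
theorem det_redLap (G : SimpleGraph V) [DecidableRel G.Adj] (x : V) (w : Sym2 V → ℝ) :
    (redLap G x w).det = tau G w := by
  rw [det_redLap_expand, tau]
  rw [← Finset.sum_filter_of_ne (p := fun f => Rooted x f)]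
  · refine Finset.sum_nbij (funEdges x) ?_ ?_ ?_ ?_
    · intro f hf
      obtain ⟨h1, h2⟩ := Finset.mem_filter.1 hf
      have h3 : ∀ i : {v : V // v ≠ x}, G.Adj i (f i) := fun i => by simpa using Fintype.mem_piFinset.1 h1 i
      exact Finset.mem_filter.2 ⟨Finset.mem_powerset.2 (funEdges_subset h3), h2.isTree h3⟩
    · intro f hf g hg h
      exact (Finset.mem_filter.1 hg).2.eq_of_funEdges_eq h
    · intro F hF
      obtain ⟨f, h1, h2, h3⟩ := exists_rooted_of_mem_spanningTrees x hF
      exact ⟨f, Finset.mem_filter.2 ⟨Fintype.mem_piFinset.2 fun i => by simpa using h1 i, h2⟩, h3⟩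
    · intro f hf
      have := (Finset.mem_filter.1 hf).2
      rw [this.det_funLap, mul_one, this.prod_funEdges]
  · intro f _ hne
    by_contra h
    exact hne (by rw [det_funLap_of_not_rooted h, mul_zero])

theorem lintegral_exp_neg_sq_half :
    ∫⁻ y : ℝ, ENNReal.ofReal (exp (-y ^ 2 / 2)) = ENNReal.ofReal √(2 * π) := by
  have h := integral_gaussian (1 / 2)
  have h2 := integrable_exp_neg_mul_sq (b := 1 / 2) (by norm_num)
  rw [show √(2 * π) = √(π / (1 / 2)) by congr 1; ring, ← h,
    ofReal_integral_eq_lintegral_ofReal h2 (ae_of_all _ fun _ => (exp_pos _).le)]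
  congr! 4 with y
  ring

theorem lintegral_Ioi_exp_neg_sq_half :
    ∫⁻ y in Set.Ioi (0 : ℝ), ENNReal.ofReal (exp (-y ^ 2 / 2)) =
      ENNReal.ofReal (√(2 * π) / 2) := by
  have h := integral_gaussian_Ioi (1 / 2)
  have h2 := integrable_exp_neg_mul_sq (b := 1 / 2) (by norm_num)
  rw [show √(2 * π) = √(π / (1 / 2)) by congr 1; ring, ← h,
    ofReal_integral_eq_lintegral_ofReal h2.integrableOn (ae_of_all _ fun _ => (exp_pos _).le)]
  congr! 4 with y
  ring

theorem image_sub_div_Ioi {c : ℝ} (hc : 0 < c) :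
    (fun x : ℝ => x - c / x) '' Set.Ioi 0 = Set.univ := by
  refine Set.eq_univ_of_forall fun y => ?_
  have h1 : |y| < √(y ^ 2 + 4 * c) := by
    rw [← sqrt_sq_eq_abs]; exact sqrt_lt_sqrt (sq_nonneg _) (by linarith)
  have h2 : 0 < (y + √(y ^ 2 + 4 * c)) / 2 := by
    have := neg_abs_le y
    linarith
  refine ⟨_, h2, ?_⟩
  have h3 : √(y ^ 2 + 4 * c) ^ 2 = y ^ 2 + 4 * c := sq_sqrt (by positivity)
  simp only
  rw [sub_eq_iff_eq_add, ← sub_eq_iff_eq_add', eq_div_iff h2.ne']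
  nlinarith

theorem lintegral_Ioi_exp_sub_div {c : ℝ} (hc : 0 < c) :
    ∫⁻ x in Set.Ioi (0 : ℝ), ENNReal.ofReal (exp (-(x - c / x) ^ 2 / 2)) =
      ENNReal.ofReal (√(2 * π) / 2) := by
  set f : ℝ → ℝ≥0∞ := fun x => ENNReal.ofReal (exp (-(x - c / x) ^ 2 / 2)) with hf
  have hfm : Measurable f := by fun_prop
  have hderiv : ∀ x ∈ Set.Ioi (0 : ℝ), HasDerivAt (fun x => c / x) (-(c / x ^ 2)) x := by
    intro x hx
    have := (hasDerivAt_inv (ne_of_gt hx)).const_mul c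
    simpa [div_eq_mul_inv] using this
  have himg : (fun x : ℝ => c / x) '' Set.Ioi 0 = Set.Ioi 0 := by
    ext y
    constructor
    · rintro ⟨x, hx, rfl⟩; exact div_pos hc hx
    · intro hy
      exact ⟨c / y, div_pos hc hy, by field_simp⟩
  have h1 : ∫⁻ x in Set.Ioi (0 : ℝ), f x =
      ∫⁻ x in Set.Ioi (0 : ℝ), ENNReal.ofReal (c / x ^ 2) * f x := by
    conv_lhs => rw [← himg]
    rw [lintegral_image_eq_lintegral_abs_deriv_mul measurableSet_Ioi
      (fun x hx => (hderiv x hx).hasDerivWithinAt)]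
    · refine setLIntegral_congr_fun measurableSet_Ioi fun x hx => ?_
      have hx' : (0 : ℝ) < x := hx
      simp only [hf]
      rw [abs_neg, abs_of_pos (by positivity)]
      congr 4
      field_simp
      ring
    · intro x hx y hy h
      simp only at h
      rw [div_eq_div_iff (ne_of_gt hx) (ne_of_gt hy)] at h
      exact (mul_left_cancel₀ hc.ne' h).symm
  have h2 : (∫⁻ x in Set.Ioi (0 : ℝ), f x) + ∫⁻ x in Set.Ioi (0 : ℝ), f x =
      ENNReal.ofReal √(2 * π) := by
    conv_lhs => rw [h1]; arg 1; rw [← h1]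
    rw [← lintegral_add_left hfm, ← lintegral_exp_neg_sq_half,
      ← setLIntegral_univ (fun y : ℝ => ENNReal.ofReal (exp (-y ^ 2 / 2))),
      ← image_sub_div_Ioi hc,
      lintegral_image_eq_lintegral_abs_deriv_mul (f' := fun x => 1 + c / x ^ 2) measurableSet_Ioi]
    · refine setLIntegral_congr_fun measurableSet_Ioi fun x hx => ?_
      have hx' : (0 : ℝ) < x := hx
      simp only [hf]
      rw [abs_of_pos (by positivity), ENNReal.ofReal_add (by positivity) (by positivity),
        ENNReal.ofReal_one, add_mul, one_mul]
    · intro x hx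
      have := ((hasDerivAt_id x).sub (hderiv x hx)).hasDerivWithinAt (s := Set.Ioi 0)
      simpa using! this
    · refine StrictMonoOn.injOn fun x hx y hy hxy => ?_
      have h3 : c / y < c / x := div_lt_div_of_pos_left hc hx hxy
      show x - c / x < y - c / y
      linarith
  rw [← two_mul] at h2
  rw [ENNReal.ofReal_div_of_pos two_pos, ← h2, ENNReal.ofReal_ofNat, mul_comm,
    ENNReal.mul_div_cancel_right two_ne_zero ENNReal.ofNat_ne_top]

/-- Normalization of the (reciprocal) inverse Gaussian density. -/
theorem lintegral_inverseGaussian {c : ℝ} (hc : 0 ≤ c) :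
    ∫⁻ s in Set.Ioi (0 : ℝ), ENNReal.ofReal ((√s)⁻¹ * exp (-(s + c ^ 2 / s) / 2)) =
      ENNReal.ofReal (√(2 * π) * exp (-c)) := by
  have himg : (fun x : ℝ => x ^ 2) '' Set.Ioi 0 = Set.Ioi 0 := by
    ext y
    constructor
    · rintro ⟨x, hx, rfl⟩; exact pow_pos (Set.mem_Ioi.1 hx) 2
    · intro hy
      exact ⟨√y, sqrt_pos.2 hy, sq_sqrt (le_of_lt hy)⟩
  conv_lhs => rw [← himg]
  rw [lintegral_image_eq_lintegral_abs_deriv_mul (f' := fun x => 2 * x) measurableSet_Ioi]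
  · have hmain : ∫⁻ x in Set.Ioi (0 : ℝ), ENNReal.ofReal (exp (-(x - c / x) ^ 2 / 2)) =
        ENNReal.ofReal (√(2 * π) / 2) := by
      rcases hc.eq_or_lt with rfl | hc'
      · simpa using lintegral_Ioi_exp_neg_sq_half
      · exact lintegral_Ioi_exp_sub_div hc'
    have heq : ∀ x ∈ Set.Ioi (0 : ℝ), ENNReal.ofReal |2 * x| *
        ENNReal.ofReal ((√(x ^ 2))⁻¹ * exp (-(x ^ 2 + c ^ 2 / x ^ 2) / 2)) =
        ENNReal.ofReal (2 * exp (-c)) * ENNReal.ofReal (exp (-(x - c / x) ^ 2 / 2)) := by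
      intro x hx
      have hx' : (0 : ℝ) < x := hx
      rw [← ENNReal.ofReal_mul (abs_nonneg _), ← ENNReal.ofReal_mul (by positivity),
        abs_of_pos (by positivity), sqrt_sq hx'.le, mul_assoc 2 (exp _), ← exp_add]
      congr 1
      rw [← mul_assoc, mul_assoc 2 x, mul_inv_cancel₀ hx'.ne', mul_one]
      congr 2
      field_simp
      ring
    rw [setLIntegral_congr_fun measurableSet_Ioi heq, lintegral_const_mul _ (by fun_prop), hmain,
      ← ENNReal.ofReal_mul (by positivity)]
    congr 1
    ring
  · intro x _
    simpa using! (hasDerivAt_pow 2 x).hasDerivWithinAt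
  · intro x hx y hy h
    exact (pow_left_inj₀ (le_of_lt hx) (le_of_lt hy) two_ne_zero).1 h

section Block

open Matrix

variable {ι : Type*} [Fintype ι] [DecidableEq ι]

/-- A symmetric matrix bordered by one row and one column. -/
def border (H : Matrix ι ι ℝ) (b : ι → ℝ) (t : ℝ) : Matrix (ι ⊕ Unit) (ι ⊕ Unit) ℝ :=
  fromBlocks H (Matrix.of fun i _ => -b i) (Matrix.of fun i _ => -b i)ᴴ (Matrix.of fun _ _ => t)

theorem schur_border (H : Matrix ι ι ℝ) (b : ι → ℝ) (t : ℝ) :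
    ((Matrix.of fun _ _ => t) -
      (Matrix.of fun (i : ι) (_ : Unit) => -b i)ᴴ * H⁻¹ * (Matrix.of fun i _ => -b i) :
        Matrix Unit Unit ℝ) = Matrix.of fun _ _ => t - b ⬝ᵥ (H⁻¹ *ᵥ b) := by
  ext i j
  rw [Matrix.mul_assoc]
  simp [Matrix.mul_apply, dotProduct, mulVec, Finset.sum_neg_distrib]

theorem det_border {H : Matrix ι ι ℝ} (hH : H.PosDef) (b : ι → ℝ) (t : ℝ) :
    (border H b t).det = H.det * (t - b ⬝ᵥ (H⁻¹ *ᵥ b)) := by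
  let _ := hH.isUnit.invertible
  rw [border, det_fromBlocks₁₁, invOf_eq_nonsing_inv, schur_border]
  simp

theorem posDef_border {H : Matrix ι ι ℝ} {b : ι → ℝ} {t : ℝ} :
    (border H b t).PosDef ↔ H.PosDef ∧ 0 < t - b ⬝ᵥ (H⁻¹ *ᵥ b) := by
  have key : H.PosDef → ((border H b t).PosDef ↔ 0 < t - b ⬝ᵥ (H⁻¹ *ᵥ b)) := by
    intro hH
    let _ := hH.isUnit.invertible
    have h1 : (border H b t).PosSemidef ↔ 0 ≤ t - b ⬝ᵥ (H⁻¹ *ᵥ b) := by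
      rw [border, PosDef.fromBlocks₁₁ _ _ hH, schur_border]
      rw [posSemidef_iff_dotProduct_mulVec]
      constructor
      · intro h
        have := h.2 fun _ => 1
        simpa [dotProduct, mulVec] using this
      · intro h
        refine ⟨by ext; simp, fun x => ?_⟩
        generalize b ⬝ᵥ (H⁻¹ *ᵥ b) = κ at h
        simp only [dotProduct, mulVec, Finset.univ_unique, Finset.sum_singleton, of_apply,
          Pi.star_apply, star_trivial]
        nlinarith [mul_nonneg h (mul_self_nonneg (x default))]
    constructor
    · intro h
      refine lt_of_le_of_ne (h1.1 h.posSemidef) fun h0 => ?_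
      have := h.det_pos
      rw [det_border hH, ← h0, mul_zero] at this
      exact lt_irrefl _ this
    · intro h
      rw [(h1.2 h.le).posDef_iff_det_ne_zero, det_border hH]
      exact (mul_pos hH.det_pos h).ne'
  constructor
  · intro h
    have hH : H.PosDef := by
      have := h.submatrix (e := Sum.inl) Sum.inl_injective
      exact this
    exact ⟨hH, (key hH).1 h⟩
  · intro h
    exact (key h.1).2 h.2

theorem dotProduct_inv_border {H : Matrix ι ι ℝ} {b : ι → ℝ} {t : ℝ}
    (hM : (border H b t).PosDef) (η : ι → ℝ) (e : ℝ) :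
    Sum.elim η (fun _ => e) ⬝ᵥ ((border H b t)⁻¹ *ᵥ Sum.elim η fun _ => e) =
      η ⬝ᵥ (H⁻¹ *ᵥ η) + (e + b ⬝ᵥ (H⁻¹ *ᵥ η)) ^ 2 / (t - b ⬝ᵥ (H⁻¹ *ᵥ b)) := by
  obtain ⟨hH, hs⟩ := posDef_border.1 hM
  set s := t - b ⬝ᵥ (H⁻¹ *ᵥ b) with hsdef
  set y := H⁻¹ *ᵥ η with hy
  set z := H⁻¹ *ᵥ b with hz
  set q := (e + b ⬝ᵥ y) / s with hq
  have hHu : IsUnit H.det := (isUnit_iff_isUnit_det _).1 hH.isUnit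
  have hMu : IsUnit (border H b t).det := (isUnit_iff_isUnit_det _).1 hM.isUnit
  have hHy : H *ᵥ y = η := by rw [hy, mulVec_mulVec, mul_nonsing_inv _ hHu, one_mulVec]
  have hHz : H *ᵥ z = b := by rw [hz, mulVec_mulVec, mul_nonsing_inv _ hHu, one_mulVec]
  have hsol : (border H b t) *ᵥ Sum.elim (y + q • z) (fun _ => q) = Sum.elim η fun _ => e := by
    rw [border, fromBlocks_mulVec]
    ext (i | i)
    · simp only [Sum.elim_inl, Pi.add_apply, Sum.elim_comp_inl, Sum.elim_comp_inr]
      rw [mulVec_add, mulVec_smul, hHy, hHz]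
      simp [mulVec, dotProduct]
      ring
    · simp only [Sum.elim_inr, Pi.add_apply, Sum.elim_comp_inl, Sum.elim_comp_inr]
      have h1 : ((Matrix.of fun (i : ι) (_ : Unit) => -b i)ᴴ *ᵥ (y + q • z)) i =
          -(b ⬝ᵥ y + q * (b ⬝ᵥ z)) := by
        simp [mulVec, dotProduct, mul_add, Finset.sum_add_distrib, Finset.mul_sum]
        rw [add_comm]
        congr 2
        exact Finset.sum_congr rfl fun _ _ => by ring
      rw [h1]
      have h2 : q * s = e + b ⬝ᵥ y := div_mul_cancel₀ _ hs.ne'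
      simp [mulVec, dotProduct] at h2 hsdef ⊢
      rw [hsdef] at h2
      linarith
  have hinv : (border H b t)⁻¹ *ᵥ Sum.elim η (fun _ => e) =
      Sum.elim (y + q • z) (fun _ => q) := by
    rw [← hsol, mulVec_mulVec, nonsing_inv_mul _ hMu, one_mulVec]
  have hsymm : η ⬝ᵥ z = b ⬝ᵥ y := by
    have hT : Hᵀ = H := by simpa using hH.isHermitian.eq
    calc η ⬝ᵥ z = z ⬝ᵥ (H *ᵥ y) := by rw [hHy, dotProduct_comm]
      _ = (Hᵀ *ᵥ z) ⬝ᵥ y := by rw [dotProduct_mulVec, mulVec_transpose]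
      _ = b ⬝ᵥ y := by rw [hT, hHz]
  rw [hinv]
  have h3 : Sum.elim η (fun _ => e) ⬝ᵥ Sum.elim (y + q • z) (fun _ : Unit => q) =
      η ⬝ᵥ y + q * (η ⬝ᵥ z) + e * q := by
    simp [dotProduct, mul_add, Finset.sum_add_distrib, Finset.mul_sum]
    exact Finset.sum_congr rfl fun _ _ => by ring
  rw [h3, hsymm, hq]
  field_simp
  ring

/-- Inverse positivity of symmetric positive definite matrices with nonpositive off-diagonal
entries. -/
theorem inv_mulVec_nonneg {H : Matrix ι ι ℝ} (hH : H.PosDef) (hoff : ∀ i j, i ≠ j → H i j ≤ 0)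
    {η : ι → ℝ} (hη : 0 ≤ η) : 0 ≤ H⁻¹ *ᵥ η := by
  set y := H⁻¹ *ᵥ η with hy
  have hHu : IsUnit H.det := (isUnit_iff_isUnit_det _).1 hH.isUnit
  have hHy : H *ᵥ y = η := by rw [hy, mulVec_mulVec, mul_nonsing_inv _ hHu, one_mulVec]
  set z : ι → ℝ := fun i => max (-y i) 0 with hz
  set p : ι → ℝ := fun i => max (y i) 0 with hp
  have hyp : y = p - z := by
    ext i
    simp only [hp, hz, Pi.sub_apply]
    rcases le_total 0 (y i) with h | h
    · rw [max_eq_left h, max_eq_right (by linarith), sub_zero]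
    · rw [max_eq_right h, max_eq_left (by linarith)]; ring
  have hpz : ∀ i, z i * p i = 0 := fun i => by
    simp only [hp, hz]
    rcases le_total 0 (y i) with h | h
    · rw [max_eq_right (by linarith : -y i ≤ 0), zero_mul]
    · rw [max_eq_right h, mul_zero]
  have h1 : 0 ≤ z ⬝ᵥ (H *ᵥ y) := by
    rw [hHy]
    exact Finset.sum_nonneg fun i _ => mul_nonneg (le_max_right _ _) (hη i)
  have h2 : z ⬝ᵥ (H *ᵥ p) ≤ 0 := by
    refine Finset.sum_nonpos fun i _ => ?_
    rw [mulVec, dotProduct, Finset.mul_sum]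
    refine Finset.sum_nonpos fun j _ => ?_
    by_cases hij : i = j
    · subst hij
      rw [mul_left_comm, hpz, mul_zero]
    · exact mul_nonpos_of_nonneg_of_nonpos (le_max_right _ _)
        (mul_nonpos_of_nonpos_of_nonneg (hoff i j hij) (le_max_right _ _))
  have h3 : z = 0 := by
    by_contra hne
    have := hH.dotProduct_mulVec_pos hne
    rw [hyp, mulVec_sub, dotProduct_sub] at h1
    simp only [star_trivial] at this
    linarith
  intro i
  have := congrFun h3 i
  simp only [hz, Pi.zero_apply] at this ⊢
  have := le_max_left (-y i) 0
  linarith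

end Block

section SDensity

open Matrix

variable {ι : Type*} [Fintype ι] [DecidableEq ι]

/-- The density of the random Schrödinger operator `diagonal k - W` attached to the
vertex-reinforced jump process, with boundary weights `η`. -/
def schroDensity (W : Matrix ι ι ℝ) (η k : ι → ℝ) : ℝ≥0∞ :=
  if (diagonal k - W).PosDef then
    ENNReal.ofReal ((√(diagonal k - W).det)⁻¹ *
      exp (-(∑ i, k i - ∑ i, ∑ j, W i j + η ⬝ᵥ ((diagonal k - W)⁻¹ *ᵥ η)) / 2 + ∑ i, η i))
  else 0

theorem measurableSet_posDef {W : Matrix ι ι ℝ} (hW : W.IsSymm) :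
    MeasurableSet {k : ι → ℝ | (diagonal k - W).PosDef} := by
  have h : {k : ι → ℝ | (diagonal k - W).PosDef} =
      (⋂ x : ι → ℝ, {k | 0 ≤ x ⬝ᵥ ((diagonal k - W) *ᵥ x)}) ∩ {k | (diagonal k - W).det ≠ 0} := by
    ext k
    have hsymm : (diagonal k - W).IsHermitian := by
      have : (diagonal k - W)ᵀ = diagonal k - W := by
        rw [transpose_sub, diagonal_transpose, hW.eq]
      simpa [IsHermitian] using this
    have h1 : (diagonal k - W).PosSemidef ↔ ∀ x : ι → ℝ, 0 ≤ x ⬝ᵥ ((diagonal k - W) *ᵥ x) := by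
      rw [posSemidef_iff_dotProduct_mulVec]
      simp only [star_trivial]
      exact ⟨fun h => h.2, fun h => ⟨hsymm, h⟩⟩
    simp only [Set.mem_ofPred_eq, Set.mem_inter_iff, Set.mem_iInter, ← h1]
    constructor
    · intro h; exact ⟨h.posSemidef, h.det_pos.ne'⟩
    · intro h; exact h.1.posDef_iff_det_ne_zero.2 h.2
  rw [h]
  have hcont : Continuous fun k : ι → ℝ => diagonal k - W := by fun_prop
  refine MeasurableSet.inter (IsClosed.measurableSet (isClosed_iInter fun x =>
    isClosed_le continuous_const ?_)) (IsOpen.measurableSet (isOpen_ne_fun ?_ continuous_const))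
  · fun_prop
  · exact hcont.matrix_det

theorem measurable_schroDensity {W : Matrix ι ι ℝ} (hW : W.IsSymm) (η : ι → ℝ) :
    Measurable (schroDensity W η) := by
  refine Measurable.ite (measurableSet_posDef hW) (ENNReal.measurable_ofReal.comp ?_)
    measurable_const
  have hcont : Continuous fun k : ι → ℝ => diagonal k - W := by fun_prop
  have hdet : Measurable fun k : ι → ℝ => (diagonal k - W).det := hcont.matrix_det.measurable
  have hadj : Measurable fun k : ι → ℝ => η ⬝ᵥ ((diagonal k - W).adjugate *ᵥ η) := by
    have : Continuous fun k : ι → ℝ => (diagonal k - W).adjugate := hcont.matrix_adjugate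
    exact Continuous.measurable (by fun_prop)
  have hinv : ∀ k : ι → ℝ, η ⬝ᵥ ((diagonal k - W)⁻¹ *ᵥ η) =
      (diagonal k - W).det⁻¹ * (η ⬝ᵥ ((diagonal k - W).adjugate *ᵥ η)) := fun k => by
    rw [inv_def, smul_mulVec, dotProduct_smul, Ring.inverse_eq_inv', smul_eq_mul]
  simp only [hinv]
  have h2 := hdet.inv.mul hadj
  simp only [Pi.mul_def, Pi.inv_def] at h2
  fun_prop

theorem lintegral_comp_piCongrLeft {κ : Type*} [Fintype κ] (e : ι ≃ κ) (F : (κ → ℝ) → ℝ≥0∞) :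
    ∫⁻ k, F k = ∫⁻ k : ι → ℝ, F (fun i => k (e.symm i)) := by
  have h := (volume_measurePreserving_piCongrLeft (fun _ : κ => ℝ) e).lintegral_comp_emb
    (MeasurableEquiv.measurableEmbedding _) F
  rw [← h]
  congr! 3 with k
  ext i
  obtain ⟨j, rfl⟩ := e.surjective i
  rw [MeasurableEquiv.coe_piCongrLeft, Equiv.piCongrLeft_apply_apply]
  simp

theorem lintegral_sumElim_unit (F : (ι ⊕ Unit → ℝ) → ℝ≥0∞) (hF : Measurable F) :
    ∫⁻ k, F k = ∫⁻ k : ι → ℝ, ∫⁻ t : ℝ, F (Sum.elim k fun _ => t) := by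
  have h := (volume_measurePreserving_sumPiEquivProdPi_symm
    (fun _ : ι ⊕ Unit => ℝ)).lintegral_comp_emb (MeasurableEquiv.measurableEmbedding _) F
  rw [← h, Measure.volume_eq_prod, lintegral_prod _ (by fun_prop)]
  refine lintegral_congr fun k => ?_
  have h2 := (volume_preserving_funUnique Unit ℝ).symm.lintegral_comp_emb
    (MeasurableEquiv.measurableEmbedding _)
    (fun y => F ((MeasurableEquiv.sumPiEquivProdPi fun _ => ℝ).symm (k, y)))
  rw [← h2]
  congr! 3 with t

theorem diagonal_sub_border (W : Matrix (ι ⊕ Unit) (ι ⊕ Unit) ℝ) (hW : W.IsSymm) (k : ι → ℝ)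
    (t : ℝ) : diagonal (Sum.elim k fun _ => t) - W =
      border (diagonal k - W.toBlocks₁₁) (fun i => W (.inl i) (.inr ()))
        (t - W (.inr ()) (.inr ())) := by
  have hs : ∀ i j, W i j = W j i := fun i j => hW.apply j i
  ext (i | i) (j | j)
  · simp [border, diagonal_apply, toBlocks₁₁]
  · simp [border]
  · simp [border, hs (.inl j)]
  · simp [border]

theorem lintegral_schroDensity_sum_unit (W : Matrix (ι ⊕ Unit) (ι ⊕ Unit) ℝ) (hW : W.IsSymm)
    (hW0 : ∀ i j, 0 ≤ W i j) {η : ι ⊕ Unit → ℝ} (hη : 0 ≤ η) (k : ι → ℝ) :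
    ∫⁻ t : ℝ, schroDensity W η (Sum.elim k fun _ => t) =
      ENNReal.ofReal √(2 * π) *
        schroDensity W.toBlocks₁₁ (fun i => η (.inl i) + W (.inl i) (.inr ())) k := by
  set A := W.toBlocks₁₁ with hA
  set b : ι → ℝ := fun i => W (.inl i) (.inr ()) with hb
  set d := W (.inr ()) (.inr ()) with hd
  set η' : ι → ℝ := fun i => η (.inl i) with hη'
  set e := η (.inr ()) with he
  have hηe : η = Sum.elim η' fun _ => e := by ext (i | i) <;> rfl
  set H := diagonal k - A with hH
  by_cases hpd : H.PosDef
  swap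
  · rw [schroDensity, if_neg hpd, mul_zero]
    convert lintegral_zero with t
    rw [schroDensity, diagonal_sub_border W hW, if_neg]
    rw [posDef_border]
    exact fun h => hpd h.1
  set κ := b ⬝ᵥ (H⁻¹ *ᵥ b) with hκ
  set c := e + b ⬝ᵥ (H⁻¹ *ᵥ η') with hc
  have hoff : ∀ i j, i ≠ j → H i j ≤ 0 := fun i j hij => by
    simp [hH, diagonal_apply_ne _ hij, hA, toBlocks₁₁, hW0]
  have hc0 : 0 ≤ c := add_nonneg (hη _) (Finset.sum_nonneg fun i _ => mul_nonneg (hW0 _ _)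
    (inv_mulVec_nonneg hpd hoff (fun i => hη (.inl i)) i))
  have hden : ∀ t : ℝ, schroDensity W η (Sum.elim k fun _ => t) =
      (Set.Ioi 0).indicator (fun s => ENNReal.ofReal ((√H.det)⁻¹ *
        exp (-(∑ i, k i - ∑ i, ∑ j, A i j - 2 * (∑ i, b i) + κ + η' ⬝ᵥ (H⁻¹ *ᵥ η')) / 2
          + ∑ i, η' i + e)) *
        ENNReal.ofReal ((√s)⁻¹ * exp (-(s + c ^ 2 / s) / 2))) (t - (d + κ)) := by
    intro t
    rw [schroDensity, diagonal_sub_border W hW]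
    have hiff : (border H b (t - d)).PosDef ↔ t - (d + κ) ∈ Set.Ioi 0 := by
      rw [posDef_border, ← hκ, Set.mem_Ioi, sub_sub]
      exact ⟨fun h => h.2, fun h => ⟨hpd, h⟩⟩
    by_cases hs : t - (d + κ) ∈ Set.Ioi 0
    · rw [if_pos (hiff.2 hs), Set.indicator_of_mem hs, ← ENNReal.ofReal_mul (by positivity),
        det_border hpd, ← hκ, hηe, dotProduct_inv_border (hiff.2 hs), ← hκ, ← hc]
      congr 1
      rw [sqrt_mul hpd.det_pos.le, mul_inv, mul_mul_mul_comm, ← exp_add, sub_sub]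
      congr 2
      have hs : ∀ i j, W i j = W j i := fun i j => hW.apply j i
      simp only [Fintype.sum_sum_type, Sum.elim_inl, Sum.elim_inr, Finset.univ_unique,
        Finset.sum_singleton, Finset.sum_add_distrib]
      simp only [hs (.inr _) (.inl _)]
      change -(∑ i, k i + t - (∑ i, ∑ j, A i j + ∑ i, b i + (∑ i, b i + d)) + _) / 2 + _ = _
      ring
    · rw [if_neg (fun h => hs (hiff.1 h)), Set.indicator_of_notMem hs]
  simp_rw [hden]
  rw [lintegral_sub_right_eq_self (μ := volume) (fun s => (Set.Ioi 0).indicator _ s),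
    lintegral_indicator measurableSet_Ioi, lintegral_const_mul _ (by fun_prop),
    lintegral_inverseGaussian hc0, schroDensity, if_pos hpd, ← ENNReal.ofReal_mul (by positivity),
    ← ENNReal.ofReal_mul (by positivity)]
  congr 1
  rw [mul_left_comm, mul_assoc, ← exp_add]
  congr 3
  have hsymm : η' ⬝ᵥ (H⁻¹ *ᵥ b) = b ⬝ᵥ (H⁻¹ *ᵥ η') := by
    have hT : (H⁻¹)ᵀ = H⁻¹ := by
      simpa using hpd.inv.isHermitian.eq
    rw [dotProduct_mulVec, ← mulVec_transpose, hT, dotProduct_comm]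
  have hbil : (fun i => η' i + b i) ⬝ᵥ (H⁻¹ *ᵥ fun i => η' i + b i) =
      η' ⬝ᵥ (H⁻¹ *ᵥ η') + 2 * (b ⬝ᵥ (H⁻¹ *ᵥ η')) + κ := by
    have : (fun i => η' i + b i) = η' + b := rfl
    rw [this, mulVec_add, dotProduct_add, add_dotProduct, add_dotProduct, hsymm]
    ring
  rw [← hH, hbil, Finset.sum_add_distrib, hc]
  ring

theorem schroDensity_reindex {κ : Type*} [Fintype κ] [DecidableEq κ] (e : ι ≃ κ)
    (W : Matrix κ κ ℝ) (η k : κ → ℝ) :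
    schroDensity W η k = schroDensity (W.submatrix e e) (η ∘ e) (k ∘ e) := by
  have h : diagonal (k ∘ e) - W.submatrix e e = (diagonal k - W).submatrix e e := by
    ext i j; simp [diagonal_apply]
  have hpd : ((diagonal k - W).submatrix e e).PosDef ↔ (diagonal k - W).PosDef := by
    constructor
    · intro h
      have := h.submatrix (e := e.symm) e.symm.injective
      simpa using this
    · intro h; exact h.submatrix e.injective
  simp only [schroDensity, h, hpd, det_submatrix_equiv_self, inv_submatrix_equiv]
  have h1 : ((diagonal k - W)⁻¹.submatrix e e) *ᵥ (η ∘ e) = ((diagonal k - W)⁻¹ *ᵥ η) ∘ e := by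
    rw [submatrix_mulVec_equiv]; simp [Function.comp_assoc]
  rw [h1, comp_equiv_dotProduct_comp_equiv]
  simp only [Function.comp_apply, submatrix_apply]
  rw [e.sum_comp k, e.sum_comp η, ← e.sum_comp fun i => ∑ j, W i j]
  simp_rw [← e.sum_comp fun j => W _ j]

theorem lintegral_schroDensity_reindex {κ : Type*} [Fintype κ] [DecidableEq κ] (e : ι ≃ κ)
    (W : Matrix κ κ ℝ) (η : κ → ℝ) :
    ∫⁻ k, schroDensity W η k = ∫⁻ k, schroDensity (W.submatrix e e) (η ∘ e) k := by
  rw [lintegral_comp_piCongrLeft e]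
  refine lintegral_congr fun k => ?_
  rw [schroDensity_reindex e]
  congr 1
  ext i
  simp

theorem lintegral_schroDensity_fin (n : ℕ) (W : Matrix (Fin n) (Fin n) ℝ) (hW : W.IsSymm)
    (hW0 : ∀ i j, 0 ≤ W i j) {η : Fin n → ℝ} (hη : 0 ≤ η) :
    ∫⁻ k, schroDensity W η k = ENNReal.ofReal √(2 * π) ^ n := by
  induction n with
  | zero =>
    have hpd : ∀ k, (diagonal k - W).PosDef := fun k =>
      ⟨by ext i; exact i.elim0, fun x hx => (hx (Subsingleton.elim _ _)).elim⟩
    simp [schroDensity, hpd, volume_pi]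
  | succ n ih =>
    let e : Fin n ⊕ Unit ≃ Fin (n + 1) :=
      ((Equiv.sumCongr (Equiv.refl _) (Equiv.ofUnique Unit (Fin 1))).trans finSumFinEquiv)
    have hW' : (W.submatrix e e).IsSymm := hW.submatrix e
    rw [lintegral_schroDensity_reindex e,
      lintegral_sumElim_unit _ (measurable_schroDensity hW' _)]
    have hη' : 0 ≤ η ∘ e := fun i => hη _
    simp_rw [lintegral_schroDensity_sum_unit _ hW' (fun i j => hW0 _ _) hη']
    have hW'' : (W.submatrix e e).toBlocks₁₁.IsSymm := hW'.submatrix Sum.inl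
    rw [lintegral_const_mul _ (measurable_schroDensity hW'' _), pow_succ']
    congr 1
    exact ih _ hW'' (fun i j => hW0 _ _) (fun i => add_nonneg (hη _) (hW0 _ _))

/-- The random Schrödinger operator density has total mass `(2 * π) ^ (n / 2)`. -/
theorem lintegral_schroDensity (W : Matrix ι ι ℝ) (hW : W.IsSymm)
    (hW0 : ∀ i j, 0 ≤ W i j) {η : ι → ℝ} (hη : 0 ≤ η) :
    ∫⁻ k, schroDensity W η k = ENNReal.ofReal √(2 * π) ^ Fintype.card ι := by
  rw [lintegral_schroDensity_reindex (Fintype.equivFin ι).symm]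
  exact lintegral_schroDensity_fin _ _ (hW.submatrix _) (fun i j => hW0 _ _) fun i => hη _

end SDensity

section Potential

open Matrix

/-- Extension by `0` to the root of a potential defined on the other vertices. -/
def extPot (x : V) (u : {v : V // v ≠ x} → ℝ) (v : V) : ℝ :=
  if h : v ≠ x then u ⟨v, h⟩ else 0

@[simp] theorem extPot_root (x : V) (u : {v : V // v ≠ x} → ℝ) : extPot x u x = 0 := by
  simp [extPot]

@[simp] theorem extPot_coe (x : V) (u : {v : V // v ≠ x} → ℝ) (i : {v : V // v ≠ x}) :
    extPot x u i = u i := by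
  simp [extPot, i.2]

/-- The edge weights `W` tilted by a potential. -/
def tilt (x : V) (u : {v : V // v ≠ x} → ℝ) (W : Sym2 V → ℝ) (e : Sym2 V) : ℝ :=
  W e * sprod (fun v => exp (extPot x u v)) e

theorem tilt_mk (x : V) (u : {v : V // v ≠ x} → ℝ) (W : Sym2 V → ℝ) (a b : V) :
    tilt x u W s(a, b) = W s(a, b) * (exp (extPot x u a) * exp (extPot x u b)) := rfl

theorem sprod_exp_pos (f : V → ℝ) (e : Sym2 V) : 0 < sprod (fun v => exp (f v)) e := by
  induction e with
  | _ a b => exact mul_pos (exp_pos _) (exp_pos _)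

theorem sum_eq_root_add (x : V) (f : V → ℝ) :
    ∑ v, f v = f x + ∑ i : {v : V // v ≠ x}, f i := by
  rw [← Finset.add_sum_erase _ _ (Finset.mem_univ x)]
  congr 1
  exact (Finset.sum_subtype _ (by simp) _)

theorem prod_eq_root_mul (x : V) (f : V → ℝ) :
    ∏ v, f v = f x * ∏ i : {v : V // v ≠ x}, f i := by
  rw [← Finset.mul_prod_erase _ _ (Finset.mem_univ x)]
  congr 1
  exact (Finset.prod_subtype _ (by simp) _)

variable (G : SimpleGraph V) [DecidableRel G.Adj] (x : V) (W : Sym2 V → ℝ)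

/-- The weighted adjacency matrix with the root removed. -/
def adjMat : Matrix {v : V // v ≠ x} {v : V // v ≠ x} ℝ :=
  Matrix.of fun i j => if G.Adj i j then W s((i : V), (j : V)) else 0

/-- The weights of the edges to the root. -/
def rootWeight (i : {v : V // v ≠ x}) : ℝ := if G.Adj i x then W s((i : V), x) else 0

/-- The diagonal of the Schrödinger operator with ground state `exp u`. -/
def potDiag (u : {v : V // v ≠ x} → ℝ) (i : {v : V // v ≠ x}) : ℝ :=
  ∑ j ∈ G.neighborFinset i, W s((i : V), j) * exp (extPot x u j - u i)

theorem sum_neighborFinset_eq (i : {v : V // v ≠ x}) (f : V → ℝ) :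
    ∑ j ∈ G.neighborFinset i, W s((i : V), j) * f j =
      rootWeight G x W i * f x + ∑ j : {v : V // v ≠ x}, adjMat G x W i j * f j := by
  have : ∑ j ∈ G.neighborFinset i, W s((i : V), j) * f j =
      ∑ j, (if G.Adj i j then W s((i : V), j) else 0) * f j := by
    simp only [ite_mul, zero_mul]
    rw [← Finset.sum_filter]
    refine Finset.sum_congr (by ext; simp) fun _ _ => rfl
  rw [this, sum_eq_root_add x]
  rfl

theorem adjMat_isSymm : (adjMat G x W).IsSymm := by
  ext i j
  simp [adjMat, G.adj_comm, Sym2.eq_swap]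

variable {W}

theorem adjMat_nonneg (hW : ∀ e ∈ G.edgeFinset, 0 < W e) (i j : {v : V // v ≠ x}) :
    0 ≤ adjMat G x W i j := by
  simp only [adjMat, of_apply]
  split_ifs with h
  · exact (hW _ (by simpa using h)).le
  · exact le_rfl

theorem rootWeight_nonneg (hW : ∀ e ∈ G.edgeFinset, 0 < W e) (i : {v : V // v ≠ x}) :
    0 ≤ rootWeight G x W i := by
  simp only [rootWeight]
  split_ifs with h
  · exact (hW _ (by simpa using h)).le
  · exact le_rfl

variable (W)

theorem potDiag_mul (u : {v : V // v ≠ x} → ℝ) (i : {v : V // v ≠ x}) :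
    potDiag G x W u i * exp (u i) =
      rootWeight G x W i + ∑ j, adjMat G x W i j * exp (u j) := by
  have h := sum_neighborFinset_eq G x W i fun v => exp (extPot x u v)
  simp only [extPot_root, exp_zero, mul_one, extPot_coe] at h
  rw [← h, potDiag, Finset.sum_mul]
  refine Finset.sum_congr rfl fun j _ => ?_
  rw [mul_assoc, ← exp_add, sub_add_cancel]

theorem schro_mulVec_exp (u : {v : V // v ≠ x} → ℝ) :
    (diagonal (potDiag G x W u) - adjMat G x W) *ᵥ (fun i => exp (u i)) = rootWeight G x W := by
  ext i
  rw [sub_mulVec, Pi.sub_apply, mulVec_diagonal, potDiag_mul]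
  simp [mulVec, dotProduct]

theorem schro_conj (u : {v : V // v ≠ x} → ℝ) :
    diagonal (fun i => exp (u i)) * (diagonal (potDiag G x W u) - adjMat G x W) *
      diagonal (fun i => exp (u i)) = redLap G x (tilt x u W) := by
  ext i j
  rw [mul_diagonal, diagonal_mul, redLap, of_apply, Matrix.sub_apply, diagonal_apply, adjMat, of_apply,
    tilt_mk, extPot_coe, extPot_coe]
  by_cases hij : i = j
  · subst hij
    simp only [if_true, SimpleGraph.irrefl, if_false, sub_zero]
    rw [mul_assoc, mul_comm, potDiag, vw, Finset.sum_mul, Finset.sum_mul]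
    refine Finset.sum_congr rfl fun j _ => ?_
    rw [tilt_mk, extPot_coe, exp_sub]
    field_simp
  · simp only [if_neg hij, zero_sub]
    split_ifs <;> ring

theorem det_schro (u : {v : V // v ≠ x} → ℝ) :
    (diagonal (potDiag G x W u) - adjMat G x W).det * exp (∑ i, u i) ^ 2 =
      tau G (tilt x u W) := by
  rw [← det_redLap G x, ← schro_conj, det_mul, det_mul, det_diagonal, ← exp_sum]
  ring

variable {W}

theorem tilt_pos (u : {v : V // v ≠ x} → ℝ) (hW : ∀ e ∈ G.edgeFinset, 0 < W e) :
    ∀ e ∈ G.edgeFinset, 0 < tilt x u W e := fun e he =>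
  mul_pos (hW e he) (sprod_exp_pos _ e)

/-- Dirichlet form of the reduced Laplacian. -/
theorem dotProduct_redLap (w : Sym2 V → ℝ) (z : {v : V // v ≠ x} → ℝ) :
    2 * (z ⬝ᵥ (redLap G x w *ᵥ z)) =
      ∑ v, ∑ j ∈ G.neighborFinset v, w s(v, j) * (extPot x z v - extPot x z j) ^ 2 := by
  have h1 : z ⬝ᵥ (redLap G x w *ᵥ z) =
      ∑ v, ∑ j ∈ G.neighborFinset v, w s(v, j) *
        (extPot x z v * (extPot x z v - extPot x z j)) := by
    rw [sum_eq_root_add x]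
    simp only [extPot_root, zero_mul, mul_zero, Finset.sum_const_zero, zero_add]
    rw [dotProduct]
    refine Finset.sum_congr rfl fun i _ => ?_
    have h := sum_neighborFinset_eq G x w i (extPot x z)
    simp only [extPot_root, mul_zero, zero_add, extPot_coe] at h
    have h2 : (redLap G x w *ᵥ z) i = vw G w i * z i - ∑ j, adjMat G x w i j * z j := by
      simp only [redLap, mulVec, dotProduct, of_apply, sub_mul, Finset.sum_sub_distrib, ite_mul,
        zero_mul, Finset.sum_ite_eq, Finset.mem_univ, if_true, adjMat]
    rw [h2, ← h, vw, Finset.sum_mul, ← Finset.sum_sub_distrib, Finset.mul_sum, extPot_coe]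
    exact Finset.sum_congr rfl fun j _ => by ring
  have h2 : ∑ v, ∑ j ∈ G.neighborFinset v, w s(v, j) *
        (extPot x z v * (extPot x z v - extPot x z j)) =
      ∑ v, ∑ j ∈ G.neighborFinset v, w s(v, j) *
        (extPot x z j * (extPot x z j - extPot x z v)) := by
    simp only [SimpleGraph.neighborFinset_eq_filter, Finset.sum_filter]
    rw [Finset.sum_comm]
    refine Finset.sum_congr rfl fun v _ => Finset.sum_congr rfl fun j _ => ?_
    simp only [G.adj_comm j v, Sym2.eq_swap (a := j)]
  rw [two_mul]
  nth_rewrite 2 [h1]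
  rw [h2, h1, ← Finset.sum_add_distrib]
  refine Finset.sum_congr rfl fun v _ => ?_
  rw [← Finset.sum_add_distrib]
  exact Finset.sum_congr rfl fun j _ => by ring

/-- A property at the root which spreads along edges holds everywhere in a connected graph. -/
theorem of_connected {G : SimpleGraph V} (hG : G.Connected) {x : V} {P : V → Prop} (hx : P x)
    (hP : ∀ a b, G.Adj a b → P a → P b) (v : V) : P v := by
  obtain ⟨p⟩ := hG x v
  induction p with
  | nil => exact hx
  | cons h q ih => exact ih (hP _ _ h hx)

theorem posDef_redLap (hG : G.Connected) {w : Sym2 V → ℝ} (hw : ∀ e ∈ G.edgeFinset, 0 < w e) :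
    (redLap G x w).PosDef := by
  refine PosDef.of_dotProduct_mulVec_pos ?_ fun z hz => ?_
  · have : (redLap G x w)ᵀ = redLap G x w := by
      ext i j
      simp only [redLap, transpose_apply, of_apply, G.adj_comm (i : V), Sym2.eq_swap (a := (i : V)),
        eq_comm (a := i)]
      congr 1
      split_ifs with h
      · rw [h]
      · rfl
    simpa [IsHermitian] using this
  · rw [star_trivial]
    have h := dotProduct_redLap G x w z
    have hnn : ∀ v, ∀ j ∈ G.neighborFinset v,
        0 ≤ w s(v, j) * (extPot x z v - extPot x z j) ^ 2 := fun v j hj =>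
      mul_nonneg (hw _ (by simpa using hj)).le (sq_nonneg _)
    have h0 := Finset.sum_nonneg fun v (_ : v ∈ Finset.univ) => Finset.sum_nonneg (hnn v)
    by_contra hneg
    have hzero : ∑ v, ∑ j ∈ G.neighborFinset v,
        w s(v, j) * (extPot x z v - extPot x z j) ^ 2 = 0 := by
      refine le_antisymm ?_ h0
      rw [← h]; linarith
    rw [Finset.sum_eq_zero_iff_of_nonneg fun v _ => Finset.sum_nonneg (hnn v)] at hzero
    have hall : ∀ v, extPot x z v = 0 := by
      refine of_connected hG (extPot_root x z) fun a b hab ha => ?_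
      have h1 := (Finset.sum_eq_zero_iff_of_nonneg (hnn a)).1 (hzero a (Finset.mem_univ a)) b
        (by simpa using hab)
      have h2 : 0 < w s(a, b) := hw _ (by simpa using hab)
      have h3 := (mul_eq_zero.1 h1).resolve_left h2.ne'
      rw [ha] at h3
      simpa using h3
    exact hz (funext fun i => by simpa using hall i)

theorem posDef_schro (hG : G.Connected) (hW : ∀ e ∈ G.edgeFinset, 0 < W e)
    (u : {v : V // v ≠ x} → ℝ) : (diagonal (potDiag G x W u) - adjMat G x W).PosDef := by
  have h := posDef_redLap G x hG (tilt_pos G x u hW)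
  rw [← schro_conj] at h
  have h2 := h.conjTranspose_mul_mul_same (B := diagonal fun i => exp (-u i)) (by
    refine mulVec_injective_of_isUnit ?_
    rw [isUnit_iff_isUnit_det, det_diagonal, isUnit_iff_ne_zero]
    exact (Finset.prod_pos fun i _ => exp_pos _).ne')
  have h3 : diagonal (fun i => exp (-u i)) * diagonal (fun i => exp (u i)) =
      (1 : Matrix {v : V // v ≠ x} {v : V // v ≠ x} ℝ) := by
    rw [diagonal_mul_diagonal, ← diagonal_one]
    congr 1
    ext i
    rw [← exp_add, neg_add_cancel, exp_zero]
  have h4 : diagonal (fun i => exp (u i)) * diagonal (fun i => exp (-u i)) =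
      (1 : Matrix {v : V // v ≠ x} {v : V // v ≠ x} ℝ) := by
    rw [diagonal_mul_diagonal, ← diagonal_one]
    congr 1
    ext i
    rw [← exp_add, add_neg_cancel, exp_zero]
  rw [diagonal_conjTranspose, star_trivial, Matrix.mul_assoc, Matrix.mul_assoc, Matrix.mul_assoc,
    h4, Matrix.mul_one, ← Matrix.mul_assoc, h3, Matrix.one_mul] at h2
  exact h2

theorem inv_schro_mulVec (hG : G.Connected) (hW : ∀ e ∈ G.edgeFinset, 0 < W e)
    (u : {v : V // v ≠ x} → ℝ) :
    (diagonal (potDiag G x W u) - adjMat G x W)⁻¹ *ᵥ rootWeight G x W = fun i => exp (u i) := by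
  rw [← schro_mulVec_exp G x W u, mulVec_mulVec,
    nonsing_inv_mul _ ((isUnit_iff_isUnit_det _).1 (posDef_schro G x hG hW u).isUnit), one_mulVec]

theorem injective_potDiag (hG : G.Connected) (hW : ∀ e ∈ G.edgeFinset, 0 < W e) :
    Function.Injective (potDiag G x W) := by
  intro u u' h
  have h1 := inv_schro_mulVec G x hG hW u
  rw [h, inv_schro_mulVec G x hG hW u'] at h1
  exact funext fun i => exp_injective (congrFun h1 i).symm

theorem range_potDiag (hG : G.Connected) (hW : ∀ e ∈ G.edgeFinset, 0 < W e) :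
    Set.range (potDiag G x W) = {k | (diagonal k - adjMat G x W).PosDef} := by
  ext k
  constructor
  · rintro ⟨u, rfl⟩
    exact posDef_schro G x hG hW u
  · intro hk
    have hk' : (diagonal k - adjMat G x W).PosDef := hk
    set H := diagonal k - adjMat G x W with hH
    set y := H⁻¹ *ᵥ rootWeight G x W with hy
    have hy0 : 0 ≤ y := inv_mulVec_nonneg hk' (fun i j hij => by
      simp [hH, diagonal_apply_ne _ hij, adjMat_nonneg G x hW]) (rootWeight_nonneg G x hW)
    have hHy : H *ᵥ y = rootWeight G x W := by
      rw [hy, mulVec_mulVec, mul_nonsing_inv _ ((isUnit_iff_isUnit_det _).1 hk'.isUnit),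
        one_mulVec]
    set Y : V → ℝ := fun v => if h : v ≠ x then y ⟨v, h⟩ else 1 with hYdef
    have hYx : Y x = 1 := by simp [hYdef]
    have hYi : ∀ i : {v : V // v ≠ x}, Y i = y i := fun i => by simp [hYdef, i.2]
    have hrow : ∀ i : {v : V // v ≠ x},
        ∑ j ∈ G.neighborFinset i, W s((i : V), j) * Y j = k i * y i := fun i => by
      have h := congrFun hHy i
      rw [hH, sub_mulVec, Pi.sub_apply, mulVec_diagonal, sub_eq_iff_eq_add] at h
      rw [sum_neighborFinset_eq, h, hYx, mul_one]
      simp only [hYi]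
      rfl
    have hY0 : ∀ v, 0 ≤ Y v := fun v => by
      simp only [hYdef]
      by_cases h : v = x
      · simp [h]
      · simpa [h] using hy0 ⟨v, h⟩
    have hYpos : ∀ v, 0 < Y v := by
      refine of_connected hG (by rw [hYx]; exact one_pos) fun a b hab ha => ?_
      by_cases hb : b = x
      · rw [hb, hYx]; exact one_pos
      · refine lt_of_le_of_ne (hY0 b) fun h0 => ?_
        have h := hrow ⟨b, hb⟩
        rw [← hYi ⟨b, hb⟩] at h
        simp only at h
        rw [← h0, mul_zero] at h
        have h1 := (Finset.sum_eq_zero_iff_of_nonneg fun j hj =>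
          mul_nonneg (hW _ (by simpa using hj)).le (hY0 j)).1 h a (by simpa using hab.symm)
        have h2 : 0 < W s(b, a) := hW _ (by simpa using hab.symm)
        exact absurd h1 (mul_pos h2 ha).ne'
    refine ⟨fun i => log (y i), funext fun i => ?_⟩
    have hyi : ∀ i, exp (log (y i)) = y i := fun i => exp_log (by rw [← hYi]; exact hYpos _)
    have hext : ∀ j, exp (extPot x (fun i => log (y i)) j) = Y j := fun j => by
      by_cases hj : j = x
      · rw [hj, extPot_root, exp_zero, hYx]
      · exact (congrArg exp (extPot_coe x (fun i => log (y i)) ⟨j, hj⟩)).trans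
          ((hyi ⟨j, hj⟩).trans (hYi ⟨j, hj⟩).symm)
    have hy_pos : 0 < y i := by rw [← hYi]; exact hYpos _
    rw [← (div_eq_iff hy_pos.ne').2 (hrow i), potDiag, Finset.sum_div]
    refine Finset.sum_congr rfl fun j _ => ?_
    rw [exp_sub, hext, hyi, mul_div_assoc]

end Potential

section ChangeOfVariables

open Matrix

variable (G : SimpleGraph V) [DecidableRel G.Adj] (x : V) (W : Sym2 V → ℝ)

theorem potDiag_eq (u : {v : V // v ≠ x} → ℝ) (i : {v : V // v ≠ x}) :
    potDiag G x W u i =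
      exp (-u i) * (rootWeight G x W i + ∑ j, adjMat G x W i j * exp (u j)) := by
  rw [← potDiag_mul, mul_comm, mul_assoc, ← exp_add, add_neg_cancel, exp_zero, mul_one]

/-- The Jacobian matrix of `potDiag`. -/
def potJac (u : {v : V // v ≠ x} → ℝ) : Matrix {v : V // v ≠ x} {v : V // v ≠ x} ℝ :=
  -(diagonal (fun i => exp (-u i)) * (diagonal (potDiag G x W u) - adjMat G x W) *
    diagonal (fun i => exp (u i)))

theorem abs_det_potJac (hG : G.Connected) (hW : ∀ e ∈ G.edgeFinset, 0 < W e)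
    (u : {v : V // v ≠ x} → ℝ) :
    |(potJac G x W u).det| = (diagonal (potDiag G x W u) - adjMat G x W).det := by
  have h := (posDef_schro G x hG hW u).det_pos
  rw [potJac, det_neg, det_mul, det_mul, det_diagonal, det_diagonal, abs_mul, abs_pow, abs_neg,
    abs_one, one_pow, one_mul, mul_right_comm, ← Finset.prod_mul_distrib]
  simp only [← exp_add, neg_add_cancel, exp_zero, Finset.prod_const_one, one_mul]
  exact abs_of_pos h

theorem hasFDerivAt_potDiag (u : {v : V // v ≠ x} → ℝ) :
    HasFDerivAt (potDiag G x W) (toLin' (potJac G x W u)).toContinuousLinearMap u := by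
  rw [hasFDerivAt_pi']
  intro i
  have h1 : HasFDerivAt (fun u : {v : V // v ≠ x} → ℝ => exp (-u i) *
      (rootWeight G x W i + ∑ j, adjMat G x W i j * exp (u j))) _ u :=
    (hasFDerivAt_apply (𝕜 := ℝ) i u).neg.exp.mul
      ((HasFDerivAt.fun_sum fun j _ =>
        ((hasFDerivAt_apply (𝕜 := ℝ) j u).exp.const_mul (adjMat G x W i j))).const_add
          (rootWeight G x W i))
  have h2 : (fun u : {v : V // v ≠ x} → ℝ => potDiag G x W u i) = fun u => exp (-u i) *
      (rootWeight G x W i + ∑ j, adjMat G x W i j * exp (u j)) :=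
    funext fun u => potDiag_eq G x W u i
  rw [h2]
  refine h1.congr_fderiv ?_
  ext z
  simp only [potJac, neg_mulVec, ← mulVec_mulVec, sub_mulVec, ContinuousLinearMap.comp_apply,
    ContinuousLinearMap.proj_apply, LinearMap.coe_toContinuousLinearMap', toLin'_apply,
    Pi.neg_apply, mulVec_diagonal, Pi.sub_apply, _root_.add_apply,
    _root_.smul_apply, _root_.sum_apply, _root_.neg_apply,
    smul_eq_mul]
  rw [← potDiag_mul]
  simp only [mulVec, dotProduct, diagonal_apply, ite_mul, zero_mul, Finset.sum_ite_eq,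
    Finset.mem_univ, if_true, mul_assoc]
  ring

theorem sum_vw_eq_root (W : Sym2 V → ℝ) :
    2 * ∑ e ∈ G.edgeFinset, W e =
      ∑ i, ∑ j, adjMat G x W i j + 2 * ∑ i, rootWeight G x W i := by
  rw [← sum_vw, sum_eq_root_add x]
  have h (i : {v : V // v ≠ x}) : vw G W i = rootWeight G x W i + ∑ j, adjMat G x W i j := by
    simpa [vw] using sum_neighborFinset_eq G x W i fun _ => 1
  have hx : vw G W x = ∑ i, rootWeight G x W i := by
    have : vw G W x = ∑ v, if G.Adj v x then W s(v, x) else 0 := by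
      rw [vw, SimpleGraph.neighborFinset_eq_filter, Finset.sum_filter]
      simp only [G.adj_comm x, Sym2.eq_swap (a := x)]
    rw [this, sum_eq_root_add x, if_neg (G.irrefl), zero_add]
    rfl
  simp only [h, hx, Finset.sum_add_distrib]
  ring

theorem sum_exp_mul_vw_tilt (u : {v : V // v ≠ x} → ℝ) :
    ∑ v, exp (-2 * extPot x u v) * vw G (tilt x u W) v =
      ∑ i, potDiag G x W u i + rootWeight G x W ⬝ᵥ fun i => exp (u i) := by
  have h (v : V) : exp (-2 * extPot x u v) * vw G (tilt x u W) v =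
      ∑ j ∈ G.neighborFinset v, W s(v, j) * exp (extPot x u j - extPot x u v) := by
    rw [vw, Finset.mul_sum]
    refine Finset.sum_congr rfl fun j _ => ?_
    rw [tilt_mk, sub_eq_add_neg, exp_add, show -2 * extPot x u v =
      -extPot x u v + -extPot x u v by ring, exp_add]
    have : exp (-extPot x u v) * exp (extPot x u v) = 1 := by
      rw [← exp_add, neg_add_cancel, exp_zero]
    linear_combination (W s(v, j) * exp (extPot x u j) * exp (-extPot x u v)) * this
  simp only [h]
  rw [sum_eq_root_add x, add_comm]
  congr 1
  · simp only [extPot_coe]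
    rfl
  · rw [SimpleGraph.neighborFinset_eq_filter, Finset.sum_filter, sum_eq_root_add x,
      if_neg (G.irrefl), zero_add, dotProduct]
    refine Finset.sum_congr rfl fun i _ => ?_
    simp only [rootWeight, extPot_coe, extPot_root, sub_zero, G.adj_comm x,
      Sym2.eq_swap (a := x), ite_mul, zero_mul]

theorem lintegral_tilt (hG : G.Connected) (hW : ∀ e ∈ G.edgeFinset, 0 < W e) :
    ∫⁻ u : {v : V // v ≠ x} → ℝ, ENNReal.ofReal (√(tau G (tilt x u W)) * exp (-∑ i, u i) *
        exp (-(∑ v, exp (-2 * extPot x u v) * vw G (tilt x u W) v) / 2)) =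
      ENNReal.ofReal √(2 * π) ^ Fintype.card {v : V // v ≠ x} *
        ENNReal.ofReal (exp (-∑ e ∈ G.edgeFinset, W e)) := by
  have hS := measurableSet_posDef (adjMat_isSymm G x W)
  have h1 := lintegral_schroDensity (adjMat G x W) (adjMat_isSymm G x W)
    (adjMat_nonneg G x hW) (rootWeight_nonneg G x hW)
  have h2 := lintegral_image_eq_lintegral_abs_det_fderiv_mul volume MeasurableSet.univ
    (fun u _ => (hasFDerivAt_potDiag G x W u).hasFDerivWithinAt)
    (injective_potDiag G x hG hW).injOn (schroDensity (adjMat G x W) (rootWeight G x W))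
  rw [Set.image_univ, range_potDiag G x hG hW, Measure.restrict_univ] at h2
  have h3 : ∫⁻ k in {k | (diagonal k - adjMat G x W).PosDef},
      schroDensity (adjMat G x W) (rootWeight G x W) k =
      ∫⁻ k, schroDensity (adjMat G x W) (rootWeight G x W) k := by
    rw [← lintegral_indicator hS]
    refine lintegral_congr fun k => ?_
    by_cases hk : (diagonal k - adjMat G x W).PosDef
    · rw [Set.indicator_of_mem (by exact hk)]
    · rw [Set.indicator_of_notMem (by exact hk), schroDensity, if_neg hk]
  rw [h3, h1] at h2
  rw [h2, ← lintegral_mul_const' _ _ ENNReal.ofReal_ne_top]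
  refine lintegral_congr fun u => ?_
  have hdet := (posDef_schro G x hG hW u).det_pos
  rw [schroDensity, if_pos (posDef_schro G x hG hW u), ContinuousLinearMap.det,
    LinearMap.coe_toContinuousLinearMap, LinearMap.det_toLin', abs_det_potJac G x W hG hW,
    ← ENNReal.ofReal_mul hdet.le, ← ENNReal.ofReal_mul (by positivity), inv_schro_mulVec G x hG hW,
    sum_exp_mul_vw_tilt, ← det_schro G x W u, sqrt_mul hdet.le, sqrt_sq (exp_pos _).le]
  congr 1
  have h4 := sum_vw_eq_root G x W
  set d := (diagonal (potDiag G x W u) - adjMat G x W).det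
  have h5 : d * (√d)⁻¹ = √d := by
    rw [← div_eq_mul_inv, div_sqrt]
  rw [← mul_assoc, h5, mul_assoc √d (exp _) (exp _), ← exp_add, add_neg_cancel, exp_zero, mul_one,
    mul_assoc, ← exp_add]
  congr 2
  linarith

end ChangeOfVariables

section Orthant

variable {ι : Type*} [Fintype ι]

/-- The open positive orthant. -/
def orthant (ι : Type*) : Set (ι → ℝ) := {k | ∀ i, 0 < k i}

theorem measurableSet_orthant : MeasurableSet (orthant ι) := by
  have : orthant ι = Set.pi Set.univ fun _ => Set.Ioi 0 := by ext; simp [orthant]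
  rw [this]
  exact MeasurableSet.univ_pi fun _ => measurableSet_Ioi

theorem lintegral_ofReal_prod {f : ι → ℝ → ℝ} (hf : ∀ i, Integrable (f i))
    (h0 : ∀ i t, 0 ≤ f i t) :
    ∫⁻ k : ι → ℝ, ENNReal.ofReal (∏ i, f i (k i)) = ENNReal.ofReal (∏ i, ∫ t, f i t) := by
  rw [← integral_fintype_prod_volume_eq_prod, ofReal_integral_eq_lintegral_ofReal]
  · exact Integrable.fintype_prod hf
  · exact Eventually.of_forall fun k => Finset.prod_nonneg fun i _ => h0 i _

theorem setLIntegral_orthant_prod {f : ι → ℝ → ℝ} (hf : ∀ i, IntegrableOn (f i) (Set.Ioi 0))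
    (h0 : ∀ i t, 0 < t → 0 ≤ f i t) :
    ∫⁻ k in orthant ι, ENNReal.ofReal (∏ i, f i (k i)) =
      ENNReal.ofReal (∏ i, ∫ t in Set.Ioi 0, f i t) := by
  rw [← lintegral_indicator measurableSet_orthant]
  simp only [← integral_indicator (measurableSet_Ioi (a := (0 : ℝ)))]
  rw [← lintegral_ofReal_prod fun i => (hf i).integrable_indicator measurableSet_Ioi]
  · refine lintegral_congr fun k => ?_
    by_cases hk : k ∈ orthant ι
    · rw [Set.indicator_of_mem hk]
      congr 1
      exact Finset.prod_congr rfl fun i _ => (Set.indicator_of_mem (hk i) _).symm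
    · rw [Set.indicator_of_notMem hk]
      simp only [orthant, Set.mem_ofPred_eq, not_forall] at hk
      obtain ⟨i, hi⟩ := hk
      rw [Finset.prod_eq_zero (Finset.mem_univ i) (Set.indicator_of_notMem hi _),
        ENNReal.ofReal_zero]
  · intro i t
    exact Set.indicator_nonneg (fun t ht => h0 i t ht) t

theorem setLIntegral_orthant_scale {c : ι → ℝ} (hc : ∀ i, 0 < c i) {F : (ι → ℝ) → ℝ≥0∞}
    (hF : Measurable F) :
    ∫⁻ k in orthant ι, F k =
      ENNReal.ofReal (∏ i, c i) * ∫⁻ k in orthant ι, F fun i => c i * k i := by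
  have hdet : (Matrix.diagonal c).det ≠ 0 := by
    rw [Matrix.det_diagonal]
    exact (Finset.prod_pos fun i _ => hc i).ne'
  have h := Real.smul_map_diagonal_volume_pi hdet
  rw [← lintegral_indicator measurableSet_orthant, ← lintegral_indicator measurableSet_orthant,
    ← h, lintegral_smul_measure, lintegral_map (hF.indicator measurableSet_orthant)
      (LinearMap.continuous_on_pi _).measurable, h, Matrix.det_diagonal,
    abs_of_pos (Finset.prod_pos fun i _ => hc i), smul_eq_mul]
  congr 1
  refine lintegral_congr fun k => ?_
  have hk : Matrix.toLin' (Matrix.diagonal c) k = fun i => c i * k i := by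
    ext i
    rw [Matrix.toLin'_apply, Matrix.mulVec_diagonal]
  rw [hk]
  have hiff : (fun i => c i * k i) ∈ orthant ι ↔ k ∈ orthant ι :=
    forall_congr' fun i => mul_pos_iff_of_pos_left (hc i)
  by_cases hk : k ∈ orthant ι
  · rw [Set.indicator_of_mem hk, Set.indicator_of_mem (hiff.2 hk)]
  · rw [Set.indicator_of_notMem hk, Set.indicator_of_notMem (fun h => hk (hiff.1 h))]

theorem setLIntegral_orthant_sum_unit {F : (ι ⊕ Unit → ℝ) → ℝ≥0∞} (hF : Measurable F) :
    ∫⁻ k in orthant (ι ⊕ Unit), F k =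
      ∫⁻ t in Set.Ioi 0, ∫⁻ k in orthant ι, F (Sum.elim k fun _ => t) := by
  rw [← lintegral_indicator measurableSet_orthant,
    lintegral_sumElim_unit _ (hF.indicator measurableSet_orthant), lintegral_lintegral_swap,
    ← lintegral_indicator measurableSet_Ioi]
  · refine lintegral_congr fun t => ?_
    by_cases ht : t ∈ Set.Ioi (0 : ℝ)
    · rw [Set.indicator_of_mem ht, ← lintegral_indicator measurableSet_orthant]
      refine lintegral_congr fun k => ?_
      have hiff : (Sum.elim k fun _ => t : ι ⊕ Unit → ℝ) ∈ orthant (ι ⊕ Unit) ↔ k ∈ orthant ι := by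
        simp only [orthant, Set.mem_ofPred_eq, Sum.forall, Sum.elim_inl, Sum.elim_inr]
        exact and_iff_left fun _ => ht
      by_cases hk : k ∈ orthant ι
      · rw [Set.indicator_of_mem hk, Set.indicator_of_mem (hiff.2 hk)]
      · rw [Set.indicator_of_notMem hk, Set.indicator_of_notMem (fun h => hk (hiff.1 h))]
    · rw [Set.indicator_of_notMem ht]
      refine (lintegral_congr fun k => Set.indicator_of_notMem (fun h => ht ?_) _).trans
        lintegral_zero
      exact h (Sum.inr ())
  · refine ((hF.indicator measurableSet_orthant).comp ?_).aemeasurable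
    refine measurable_pi_lambda _ fun i => ?_
    cases i with
    | inl i => exact (measurable_pi_apply i).comp measurable_fst
    | inr i => exact measurable_snd

theorem setLIntegral_orthant_equiv {κ : Type*} [Fintype κ] (e : ι ≃ κ) (F : (κ → ℝ) → ℝ≥0∞) :
    ∫⁻ k in orthant κ, F k = ∫⁻ k in orthant ι, F (fun i => k (e.symm i)) := by
  rw [← lintegral_indicator measurableSet_orthant, lintegral_comp_piCongrLeft e,
    ← lintegral_indicator measurableSet_orthant]
  refine lintegral_congr fun k => ?_
  have hiff : (fun i => k (e.symm i)) ∈ orthant κ ↔ k ∈ orthant ι := e.symm.forall_congr_left.trans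
    (forall_congr' fun i => by simp)
  by_cases hk : k ∈ orthant ι
  · rw [Set.indicator_of_mem hk, Set.indicator_of_mem (hiff.2 hk)]
  · rw [Set.indicator_of_notMem hk, Set.indicator_of_notMem (fun h => hk (hiff.1 h))]

end Orthant

theorem integrableOn_rpow_mul_exp {p c : ℝ} (hp : 0 < p) (hc : 0 < c) :
    IntegrableOn (fun t : ℝ => t ^ (p - 1) * exp (-(c * t))) (Set.Ioi 0) := by
  refine Integrable.of_integral_ne_zero ?_
  rw [integral_rpow_mul_exp_neg_mul_Ioi hp hc]
  exact (mul_pos (rpow_pos_of_pos (by positivity) _) (Gamma_pos_of_pos hp)).ne'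

theorem setLIntegral_rpow_mul_exp {p c : ℝ} (hp : 0 < p) (hc : 0 < c) :
    ∫⁻ t in Set.Ioi 0, ENNReal.ofReal (t ^ (p - 1) * exp (-(c * t))) =
      ENNReal.ofReal (c ^ (-p) * Gamma p) := by
  rw [← ofReal_integral_eq_lintegral_ofReal (integrableOn_rpow_mul_exp hp hc),
    integral_rpow_mul_exp_neg_mul_Ioi hp hc, one_div, inv_rpow hc.le, rpow_neg hc.le]
  filter_upwards [self_mem_ae_restrict measurableSet_Ioi] with t ht
  exact mul_nonneg (rpow_nonneg (le_of_lt ht) _) (exp_pos _).le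

theorem image_exp_neg_two_mul : (fun u : ℝ => exp (-2 * u)) '' Set.univ = Set.Ioi 0 := by
  ext t
  simp only [Set.image_univ, Set.mem_range, Set.mem_Ioi]
  constructor
  · rintro ⟨u, rfl⟩
    exact exp_pos _
  · intro ht
    exact ⟨-log t / 2, by rw [show -2 * (-log t / 2) = log t by ring, exp_log ht]⟩

theorem exp_substitution_deriv (p c u : ℝ) :
    |exp (-2 * u) * (-2)| • ((exp (-2 * u)) ^ (p / 2 - 1) * exp (-(c / 2 * exp (-2 * u)))) =
      2 * (exp (-(c * exp (-2 * u)) / 2) * exp (-(p * u))) := by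
  rw [abs_mul, abs_of_pos (exp_pos _), ← exp_mul, smul_eq_mul, abs_neg, abs_two]
  have : exp (-2 * u) * exp (-2 * u * (p / 2 - 1)) = exp (-(p * u)) := by
    rw [← exp_add]; congr 1; ring
  rw [← this, show -(c / 2 * exp (-2 * u)) = -(c * exp (-2 * u)) / 2 by ring]
  ring

theorem integrable_exp_neg_exp {p c : ℝ} (hp : 0 < p) (hc : 0 < c) :
    Integrable fun u : ℝ => exp (-(c * exp (-2 * u)) / 2) * exp (-(p * u)) := by
  have h := integrableOn_rpow_mul_exp (half_pos hp) (half_pos hc)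
  rw [← image_exp_neg_two_mul, integrableOn_image_iff_integrableOn_abs_deriv_smul
    (f' := fun u => exp (-2 * u) * (-2)) MeasurableSet.univ] at h
  · simp only [exp_substitution_deriv] at h
    rw [integrableOn_univ] at h
    exact (integrable_const_mul_iff (by norm_num) _).1 h
  · intro u _
    simpa using ((hasDerivAt_id u).const_mul (-2)).exp
  · exact (exp_injective.comp (mul_right_injective₀ (by norm_num))).injOn

theorem integral_exp_neg_exp {p c : ℝ} (hp : 0 < p) (hc : 0 < c) :
    ∫ u : ℝ, exp (-(c * exp (-2 * u)) / 2) * exp (-(p * u)) =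
      (c / 2) ^ (-(p / 2)) * Gamma (p / 2) / 2 := by
  have h := integral_rpow_mul_exp_neg_mul_Ioi (half_pos hp) (half_pos hc)
  rw [← image_exp_neg_two_mul, integral_image_eq_integral_abs_deriv_smul
    (f' := fun u => exp (-2 * u) * (-2)) MeasurableSet.univ] at h
  · simp only [exp_substitution_deriv] at h
    rw [setIntegral_univ, integral_const_mul, one_div, inv_rpow (half_pos hc).le,
      ← rpow_neg (half_pos hc).le] at h
    linarith
  · intro u _
    simpa using ((hasDerivAt_id u).const_mul (-2)).exp
  · exact (exp_injective.comp (mul_right_injective₀ (by norm_num))).injOn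

section Joint

variable (G : SimpleGraph V) [DecidableRel G.Adj] (x : V) (B : Sym2 V → ℝ)

/-- Extension by `0` of weights defined on the edges. -/
def edgeExt (w : G.edgeFinset → ℝ) (e : Sym2 V) : ℝ :=
  if h : e ∈ G.edgeFinset then w ⟨e, h⟩ else 0

variable {G} in
theorem edgeExt_of_mem (w : G.edgeFinset → ℝ) {e : Sym2 V} (he : e ∈ G.edgeFinset) :
    edgeExt G w e = w ⟨e, he⟩ := dif_pos he

theorem edgeExt_coe (w : G.edgeFinset → ℝ) (e : G.edgeFinset) : edgeExt G w e = w e :=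
  dif_pos e.2

variable {G} in
theorem edgeExt_pos {w : G.edgeFinset → ℝ} (hw : w ∈ orthant G.edgeFinset) :
    ∀ e ∈ G.edgeFinset, 0 < edgeExt G w e := fun e he => by
  rw [edgeExt_of_mem w he]
  exact hw _

theorem measurable_edgeExt : Measurable (edgeExt G) := by
  refine measurable_pi_lambda _ fun e => ?_
  unfold edgeExt
  split_ifs with h
  · exact measurable_pi_apply _
  · exact measurable_const

theorem measurable_vw (v : V) : Measurable fun w => vw G w v := by
  unfold vw
  fun_prop

theorem measurable_tau : Measurable (tau G) := by
  unfold tau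
  fun_prop

theorem measurable_extPot (v : V) : Measurable fun u => extPot x u v := by
  unfold extPot
  split_ifs <;> fun_prop

theorem measurable_tilt : Measurable fun p : (Sym2 V → ℝ) × ({v : V // v ≠ x} → ℝ) =>
    tilt x p.2 p.1 := by
  have h := measurable_extPot x
  refine measurable_pi_lambda _ fun e => ?_
  induction e with
  | _ a b =>
    simp only [tilt_mk]
    fun_prop

/-- The joint density of the edge weights and of the potential, up to a constant. -/
def jointDensity (w : Sym2 V → ℝ) (u : {v : V // v ≠ x} → ℝ) : ℝ :=
  (∏ e ∈ G.edgeFinset, w e ^ (B e - 1)) * √(tau G w) *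
    exp (-(∑ v, exp (-2 * extPot x u v) * vw G w v) / 2) *
    exp (-∑ i : {v : V // v ≠ x}, (vw G B i + 1) * u i)

theorem measurable_jointDensity_edgeExt :
    Measurable (Function.uncurry fun (w : G.edgeFinset → ℝ) u =>
      ENNReal.ofReal (jointDensity G x B (edgeExt G w) u)) := by
  have h1 := measurable_tau G
  have h2 := measurable_vw G
  have h3 := measurable_extPot x
  have h4 := measurable_edgeExt G
  unfold jointDensity Function.uncurry
  fun_prop

theorem sprod_exp (f : V → ℝ) (e : Sym2 V) : sprod (fun v => exp (f v)) e = exp (ssum f e) := by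
  induction e with
  | _ a b => exact (exp_add _ _).symm

theorem prod_sprod_exp_rpow (u : {v : V // v ≠ x} → ℝ) :
    ∏ e ∈ G.edgeFinset, sprod (fun v => exp (extPot x u v)) e ^ B e =
      exp (∑ i : {v : V // v ≠ x}, vw G B i * u i) := by
  have h := sum_vw_mul G B (extPot x u)
  rw [sum_eq_root_add x] at h
  simp only [extPot_root, extPot_coe, mul_zero, zero_add] at h
  rw [h, exp_sum]
  refine Finset.prod_congr rfl fun e _ => ?_
  rw [sprod_exp, ← exp_mul, mul_comm]

theorem prod_mul_jointDensity_tilt {W : Sym2 V → ℝ} (hW : ∀ e ∈ G.edgeFinset, 0 < W e)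
    (u : {v : V // v ≠ x} → ℝ) :
    (∏ e ∈ G.edgeFinset, sprod (fun v => exp (extPot x u v)) e) *
        jointDensity G x B (tilt x u W) u =
      (∏ e ∈ G.edgeFinset, W e ^ (B e - 1)) * (√(tau G (tilt x u W)) * exp (-∑ i, u i) *
        exp (-(∑ v, exp (-2 * extPot x u v) * vw G (tilt x u W) v) / 2)) := by
  have h1 : (∏ e ∈ G.edgeFinset, sprod (fun v => exp (extPot x u v)) e) *
      ∏ e ∈ G.edgeFinset, tilt x u W e ^ (B e - 1) =
      (∏ e ∈ G.edgeFinset, W e ^ (B e - 1)) *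
        exp (∑ i : {v : V // v ≠ x}, vw G B i * u i) := by
    rw [← prod_sprod_exp_rpow, ← Finset.prod_mul_distrib, ← Finset.prod_mul_distrib]
    refine Finset.prod_congr rfl fun e he => ?_
    have hs := sprod_exp_pos (extPot x u) e
    rw [tilt, mul_rpow (hW e he).le hs.le, mul_left_comm, rpow_sub_one hs.ne',
      mul_div_cancel₀ _ hs.ne']
  have h2 : exp (∑ i : {v : V // v ≠ x}, vw G B i * u i) *
      exp (-∑ i : {v : V // v ≠ x}, (vw G B i + 1) * u i) = exp (-∑ i, u i) := by
    rw [← exp_add]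
    congr 1
    simp only [add_mul, one_mul, Finset.sum_add_distrib]
    ring
  rw [jointDensity, ← h2]
  linear_combination (√(tau G (tilt x u W)) *
    exp (-(∑ v, exp (-2 * extPot x u v) * vw G (tilt x u W) v) / 2) *
    exp (-∑ i : {v : V // v ≠ x}, (vw G B i + 1) * u i)) * h1

variable {B}

theorem lintegral_prod_rpow_mul_exp (hB : ∀ e ∈ G.edgeFinset, 0 < B e) :
    ∫⁻ w in orthant G.edgeFinset, ENNReal.ofReal ((∏ e ∈ G.edgeFinset, edgeExt G w e ^ (B e - 1)) *
      exp (-∑ e ∈ G.edgeFinset, edgeExt G w e)) =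
      ENNReal.ofReal (∏ e ∈ G.edgeFinset, Gamma (B e)) := by
  rw [← Finset.prod_coe_sort G.edgeFinset fun e => Gamma (B e)]
  have h := setLIntegral_orthant_prod (ι := G.edgeFinset)
    (f := fun e t => t ^ (B e - 1) * exp (-(1 * t)))
    (fun e => integrableOn_rpow_mul_exp (hB e e.2) one_pos)
    (fun e t ht => mul_nonneg (rpow_nonneg ht.le _) (exp_pos _).le)
  have h2 (e : G.edgeFinset) : ∫ t in Set.Ioi 0, t ^ (B e - 1) * exp (-(1 * t)) = Gamma (B e) := by
    rw [integral_rpow_mul_exp_neg_mul_Ioi (hB e e.2) one_pos, div_one, one_rpow, one_mul]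
  simp only [h2] at h
  rw [← h]
  refine lintegral_congr fun w => ?_
  rw [Finset.prod_mul_distrib, ← exp_sum, Finset.sum_neg_distrib,
    ← Finset.prod_coe_sort G.edgeFinset, ← Finset.sum_coe_sort G.edgeFinset]
  simp only [edgeExt_coe, one_mul]

theorem lintegral_jointDensity (hG : G.Connected) (hB : ∀ e ∈ G.edgeFinset, 0 < B e) :
    ∫⁻ w in orthant G.edgeFinset, ∫⁻ u, ENNReal.ofReal (jointDensity G x B (edgeExt G w) u) =
      ENNReal.ofReal √(2 * π) ^ Fintype.card {v : V // v ≠ x} *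
        ENNReal.ofReal (∏ e ∈ G.edgeFinset, Gamma (B e)) := by
  have hext := measurable_edgeExt G
  have htau := measurable_tau G
  have hvw := measurable_vw G
  have hpot := measurable_extPot x
  rw [lintegral_lintegral_swap]
  swap
  · exact (measurable_jointDensity_edgeExt G x B).aemeasurable
  have h1 (u : {v : V // v ≠ x} → ℝ) :
      ∫⁻ w in orthant G.edgeFinset, ENNReal.ofReal (jointDensity G x B (edgeExt G w) u) =
      ∫⁻ w in orthant G.edgeFinset,
        ENNReal.ofReal (∏ e ∈ G.edgeFinset, edgeExt G w e ^ (B e - 1)) *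
        ENNReal.ofReal (√(tau G (tilt x u (edgeExt G w))) * exp (-∑ i, u i) *
        exp (-(∑ v, exp (-2 * extPot x u v) * vw G (tilt x u (edgeExt G w)) v) / 2)) := by
    have hmu : Measurable fun w => ENNReal.ofReal (jointDensity G x B (edgeExt G w) u) :=
      (measurable_jointDensity_edgeExt G x B).of_uncurry_right
    rw [setLIntegral_orthant_scale
      (c := fun e : G.edgeFinset => sprod (fun v => exp (extPot x u v)) e)
      (fun e => sprod_exp_pos _ _)
      (F := fun w => ENNReal.ofReal (jointDensity G x B (edgeExt G w) u))
      hmu, ← lintegral_const_mul' _ _ ENNReal.ofReal_ne_top]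
    refine setLIntegral_congr_fun measurableSet_orthant fun w hw => ?_
    have htilt : edgeExt G (fun e => sprod (fun v => exp (extPot x u v)) e * w e) =
        tilt x u (edgeExt G w) := by
      ext e
      by_cases he : e ∈ G.edgeFinset
      · rw [tilt, edgeExt_of_mem _ he, edgeExt_of_mem _ he, mul_comm]
      · rw [tilt, edgeExt, edgeExt, dif_neg he, dif_neg he, zero_mul]
    have hc : 0 ≤ ∏ e : G.edgeFinset, sprod (fun v => exp (extPot x u v)) e :=
      Finset.prod_nonneg fun e _ => (sprod_exp_pos _ _).le
    rw [htilt, ← ENNReal.ofReal_mul hc,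
      Finset.prod_coe_sort G.edgeFinset fun e => sprod (fun v => exp (extPot x u v)) e,
      prod_mul_jointDensity_tilt G x B (edgeExt_pos hw), ENNReal.ofReal_mul]
    exact Finset.prod_nonneg fun e he => rpow_nonneg (edgeExt_pos hw e he).le _
  simp only [h1]
  rw [← lintegral_lintegral_swap]
  · have h2 : ∀ w ∈ orthant G.edgeFinset,
        ∫⁻ u, ENNReal.ofReal (∏ e ∈ G.edgeFinset, edgeExt G w e ^ (B e - 1)) *
          ENNReal.ofReal (√(tau G (tilt x u (edgeExt G w))) * exp (-∑ i, u i) *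
          exp (-(∑ v, exp (-2 * extPot x u v) * vw G (tilt x u (edgeExt G w)) v) / 2)) =
        ENNReal.ofReal √(2 * π) ^ Fintype.card {v : V // v ≠ x} *
          ENNReal.ofReal ((∏ e ∈ G.edgeFinset, edgeExt G w e ^ (B e - 1)) *
            exp (-∑ e ∈ G.edgeFinset, edgeExt G w e)) := fun w hw => by
      rw [lintegral_const_mul' _ _ ENNReal.ofReal_ne_top,
        lintegral_tilt G x (edgeExt G w) hG (edgeExt_pos hw), mul_left_comm, ← ENNReal.ofReal_mul]
      exact Finset.prod_nonneg fun e he => rpow_nonneg (edgeExt_pos hw e he).le _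
    rw [setLIntegral_congr_fun measurableSet_orthant h2, lintegral_const_mul',
      lintegral_prod_rpow_mul_exp G hB]
    exact ENNReal.pow_ne_top ENNReal.ofReal_ne_top
  · refine Measurable.aemeasurable ?_
    have h3 : Measurable fun p : (G.edgeFinset → ℝ) × ({v : V // v ≠ x} → ℝ) =>
        tilt x p.2 (edgeExt G p.1) := (measurable_tilt x).comp
      ((hext.comp measurable_fst).prodMk measurable_snd)
    have h4 : Measurable fun p : (G.edgeFinset → ℝ) × ({v : V // v ≠ x} → ℝ) =>
        edgeExt G p.1 := hext.comp measurable_fst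
    fun_prop

end Joint

section Pinned

variable (G : SimpleGraph V) [DecidableRel G.Adj] (x : V) (B : Sym2 V → ℝ)

theorem card_eq_card_ne_add_one : Fintype.card V = Fintype.card {v : V // v ≠ x} + 1 := by
  have := sum_eq_root_add x fun _ => (1 : ℝ)
  simp only [Finset.sum_const, Finset.card_univ, nsmul_eq_mul, mul_one] at this
  rw [add_comm]
  exact_mod_cast this

theorem vw_smul (t : ℝ) (w : Sym2 V → ℝ) (v : V) : vw G (t • w) v = t * vw G w v := by
  simp [vw, Finset.mul_sum]

theorem tau_smul (t : ℝ) (w : Sym2 V → ℝ) :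
    tau G (t • w) = t ^ Fintype.card {v : V // v ≠ x} * tau G w := by
  rw [← det_redLap G x, ← det_redLap G x, ← Matrix.det_smul]
  congr 1
  ext i j
  simp only [redLap, Matrix.of_apply, vw_smul, Matrix.smul_apply, smul_eq_mul, Pi.smul_apply,
    mul_sub, mul_ite, mul_zero]

/-- The potential integrated out of `jointDensity`, except for a factor at the root. -/
def marginalDensity (w : Sym2 V → ℝ) : ℝ :=
  (∏ e ∈ G.edgeFinset, w e ^ (B e - 1)) * √(tau G w) *
    ∏ i : {v : V // v ≠ x}, ((vw G w i / 2) ^ (-((vw G B i + 1) / 2)) *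
      Gamma ((vw G B i + 1) / 2) / 2)

theorem measurable_marginalDensity : Measurable (marginalDensity G x B) := by
  have h1 := measurable_tau G
  have h2 := measurable_vw G
  unfold marginalDensity
  fun_prop

variable {B}

theorem lintegral_jointDensity_potential (hadj : ∀ v, ∃ u, G.Adj v u)
    (hB : ∀ e ∈ G.edgeFinset, 0 < B e) {w : Sym2 V → ℝ} (hw : ∀ e ∈ G.edgeFinset, 0 < w e) :
    ∫⁻ u, ENNReal.ofReal (jointDensity G x B w u) =
      ENNReal.ofReal (marginalDensity G x B w * exp (-(vw G w x / 2 * 1))) := by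
  have hBv (v : V) : 0 < vw G B v + 1 := by
    obtain ⟨u, hu⟩ := hadj v
    have := vw_pos G hB hu
    linarith
  have hwv (v : V) : 0 < vw G w v := by
    obtain ⟨u, hu⟩ := hadj v
    exact vw_pos G hw hu
  have h0 : 0 ≤ (∏ e ∈ G.edgeFinset, w e ^ (B e - 1)) * √(tau G w) * exp (-(vw G w x / 2 * 1)) := by
    have := Finset.prod_nonneg fun e he => rpow_nonneg (hw e he).le (B e - 1)
    positivity
  have h (u : {v : V // v ≠ x} → ℝ) : jointDensity G x B w u =
      (∏ e ∈ G.edgeFinset, w e ^ (B e - 1)) * √(tau G w) * exp (-(vw G w x / 2 * 1)) *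
        ∏ i : {v : V // v ≠ x},
          (exp (-(vw G w i * exp (-2 * u i)) / 2) * exp (-((vw G B i + 1) * u i))) := by
    rw [jointDensity, sum_eq_root_add x]
    simp only [extPot_root, extPot_coe, mul_zero, exp_zero, one_mul]
    rw [Finset.prod_mul_distrib, ← exp_sum, ← exp_sum, Finset.sum_neg_distrib,
      ← Finset.sum_div, Finset.sum_neg_distrib, neg_add, add_div, exp_add]
    simp only [mul_comm (exp (-2 * _))]
    rw [show -(vw G w x / 2 * 1) = -vw G w x / 2 by ring]
    ring
  simp only [h, ENNReal.ofReal_mul h0]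
  rw [lintegral_const_mul' _ _ ENNReal.ofReal_ne_top,
    lintegral_ofReal_prod (ι := {v : V // v ≠ x})
      (f := fun i t => exp (-(vw G w i * exp (-2 * t)) / 2) * exp (-((vw G B i + 1) * t)))
      (fun i => integrable_exp_neg_exp (hBv i) (hwv i)) (fun i t => by positivity),
    ← ENNReal.ofReal_mul h0]
  simp only [integral_exp_neg_exp (hBv _) (hwv _)]
  congr 1
  rw [marginalDensity]
  ring

/-- The edges, as the pinned edges together with the reference edge. -/
def edgeEquiv {e0 : Sym2 V} (he0 : e0 ∈ G.edgeFinset) : Epin G e0 ⊕ Unit ≃ G.edgeFinset where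
  toFun := Sum.elim (fun e => ⟨e.1, e.2.1⟩) fun _ => ⟨e0, he0⟩
  invFun e := if h : (e : Sym2 V) = e0 then Sum.inr () else Sum.inl ⟨e, e.2, h⟩
  left_inv e := by
    cases e with
    | inl e => simp [e.2.2]
    | inr e => simp
  right_inv e := by
    by_cases h : (e : Sym2 V) = e0
    · simp only [h, dif_pos, Sum.elim_inr]
      exact Subtype.ext h.symm
    · simp [h]

theorem edgeExt_edgeEquiv {e0 : Sym2 V} (he0 : e0 ∈ G.edgeFinset) (k : Epin G e0 → ℝ) (t : ℝ) :
    edgeExt G (fun e => (Sum.elim (fun i => t * k i) fun _ => t : Epin G e0 ⊕ Unit → ℝ)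
      ((edgeEquiv G he0).symm e)) = t • pinExt G e0 k := by
  ext e
  rw [Pi.smul_apply, smul_eq_mul, pinExt]
  by_cases h : e = e0
  · subst h
    rw [edgeExt_of_mem _ he0, if_pos rfl, mul_one]
    simp [edgeEquiv]
  · rw [if_neg h]
    by_cases he : e ∈ G.edgeFinset
    · rw [edgeExt_of_mem _ he, dif_pos ⟨he, h⟩]
      simp [edgeEquiv, h]
    · rw [edgeExt, dif_neg he, dif_neg fun hh => he hh.1, mul_zero]

theorem measurable_pinExt (e0 : Sym2 V) : Measurable (pinExt G e0) := by
  refine measurable_pi_lambda _ fun e => ?_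
  unfold pinExt
  split_ifs <;> fun_prop

theorem pinExt_pos_iff (e0 : Sym2 V) (k : Epin G e0 → ℝ) :
    (∀ e ∈ G.edgeFinset, 0 < pinExt G e0 k e) ↔ k ∈ orthant (Epin G e0) := by
  constructor
  · intro h i
    have := h i i.2.1
    rwa [pinExt, if_neg i.2.2, dif_pos i.2] at this
  · intro h e he
    rw [pinExt]
    split_ifs with h1 h2
    · exact one_pos
    · exact h _
    · exact absurd ⟨he, h1⟩ h2

theorem setLIntegral_orthant_edgeExt {e0 : Sym2 V} (he0 : e0 ∈ G.edgeFinset)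
    {f : (Sym2 V → ℝ) → ℝ≥0∞} (hf : Measurable f) :
    ∫⁻ w in orthant G.edgeFinset, f (edgeExt G w) =
      ∫⁻ k in orthant (Epin G e0), ∫⁻ t in Set.Ioi 0,
        ENNReal.ofReal (t ^ Fintype.card (Epin G e0)) * f (t • pinExt G e0 k) := by
  have hpin := measurable_pinExt G e0
  have hmeas : Measurable fun k : Epin G e0 ⊕ Unit → ℝ =>
      f (edgeExt G fun e => k ((edgeEquiv G he0).symm e)) := by
    refine hf.comp ((measurable_edgeExt G).comp ?_)
    fun_prop
  rw [setLIntegral_orthant_equiv (edgeEquiv G he0), setLIntegral_orthant_sum_unit hmeas,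
    lintegral_lintegral_swap (μ := volume.restrict (orthant (Epin G e0)))]
  · refine setLIntegral_congr_fun measurableSet_Ioi fun t ht => ?_
    have hmt : Measurable fun k : Epin G e0 → ℝ => f (edgeExt G fun e =>
        (Sum.elim k fun _ => t : Epin G e0 ⊕ Unit → ℝ) ((edgeEquiv G he0).symm e)) := by
      refine hmeas.comp (measurable_pi_lambda _ fun i => ?_)
      cases i with
      | inl i => exact measurable_pi_apply i
      | inr i => exact measurable_const
    rw [setLIntegral_orthant_scale (c := fun _ => t) (fun _ => ht) hmt, Finset.prod_const,
      Finset.card_univ, ← lintegral_const_mul' _ _ ENNReal.ofReal_ne_top]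
    simp only [edgeExt_edgeEquiv]
  · refine Measurable.aemeasurable ?_
    have h2 : Measurable fun p : (Epin G e0 → ℝ) × ℝ => p.2 • pinExt G e0 p.1 := by
      fun_prop
    have h3 := hf.comp h2
    unfold Function.uncurry
    exact Measurable.mul (by fun_prop) h3

end Pinned

section Normalization

variable (G : SimpleGraph V) [DecidableRel G.Adj] (x : V) {B : Sym2 V → ℝ}

theorem card_edgeFinset_eq {e0 : Sym2 V} (he0 : e0 ∈ G.edgeFinset) :
    G.edgeFinset.card = Fintype.card (Epin G e0) + 1 := by
  have := Fintype.card_congr (edgeEquiv G he0)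
  rw [Fintype.card_sum, Fintype.card_unit, Fintype.card_coe] at this
  exact this.symm

theorem sum_vw_add_one_half (B : Sym2 V → ℝ) :
    ∑ i : {v : V // v ≠ x}, (vw G B i + 1) / 2 =
      ∑ e ∈ G.edgeFinset, B e - vw G B x / 2 + Fintype.card {v : V // v ≠ x} / 2 := by
  have h := sum_vw G B
  rw [sum_eq_root_add x] at h
  rw [← Finset.sum_div, Finset.sum_add_distrib]
  simp only [Finset.sum_const, Finset.card_univ, nsmul_eq_mul, mul_one]
  linarith

theorem pow_mul_marginalDensity_smul {e0 : Sym2 V} (he0 : e0 ∈ G.edgeFinset) {w : Sym2 V → ℝ}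
    (hw : ∀ e ∈ G.edgeFinset, 0 < w e) {t : ℝ} (ht : 0 < t) :
    t ^ Fintype.card (Epin G e0) * marginalDensity G x B (t • w) =
      t ^ (vw G B x / 2 - 1) * marginalDensity G x B w := by
  have hN := card_edgeFinset_eq G he0
  have h1 : ∏ e ∈ G.edgeFinset, (t • w) e ^ (B e - 1) =
      t ^ (∑ e ∈ G.edgeFinset, (B e - 1)) * ∏ e ∈ G.edgeFinset, w e ^ (B e - 1) := by
    rw [rpow_sum_of_pos ht, ← Finset.prod_mul_distrib]
    refine Finset.prod_congr rfl fun e he => ?_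
    rw [Pi.smul_apply, smul_eq_mul, mul_rpow ht.le (hw e he).le]
  have h2 : √(tau G (t • w)) = t ^ ((Fintype.card {v : V // v ≠ x} : ℝ) / 2) * √(tau G w) := by
    rw [tau_smul G x, sqrt_mul (by positivity), sqrt_eq_rpow (t ^ _), ← rpow_natCast,
      ← rpow_mul ht.le, mul_one_div]
  have h3 : ∏ i : {v : V // v ≠ x}, ((vw G (t • w) i / 2) ^ (-((vw G B i + 1) / 2)) *
      Gamma ((vw G B i + 1) / 2) / 2) =
      t ^ (∑ i : {v : V // v ≠ x}, -((vw G B i + 1) / 2)) *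
      ∏ i : {v : V // v ≠ x}, ((vw G w i / 2) ^ (-((vw G B i + 1) / 2)) *
        Gamma ((vw G B i + 1) / 2) / 2) := by
    rw [rpow_sum_of_pos ht, ← Finset.prod_mul_distrib]
    refine Finset.prod_congr rfl fun i _ => ?_
    rw [vw_smul, mul_div_assoc t (vw G w i) 2, mul_rpow ht.le
      (div_nonneg (vw_nonneg G (fun e he => (hw e he).le) _) zero_le_two)]
    ring
  rw [marginalDensity, h1, h2, h3, marginalDensity]
  have h4 : t ^ (Fintype.card (Epin G e0) : ℝ) * t ^ (∑ e ∈ G.edgeFinset, (B e - 1)) *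
      t ^ ((Fintype.card {v : V // v ≠ x} : ℝ) / 2) *
      t ^ (∑ i : {v : V // v ≠ x}, -((vw G B i + 1) / 2)) = t ^ (vw G B x / 2 - 1) := by
    rw [← rpow_add ht, ← rpow_add ht, ← rpow_add ht]
    congr 1
    rw [Finset.sum_neg_distrib, sum_vw_add_one_half, Finset.sum_sub_distrib, Finset.sum_const, hN]
    simp only [nsmul_eq_mul]
    push_cast
    ring
  rw [← h4, rpow_natCast]
  ring

theorem marginalDensity_mul_root (hadj : ∀ v, ∃ u, G.Adj v u)
    (hB : ∀ e ∈ G.edgeFinset, 0 < B e) {w : Sym2 V → ℝ} (hw : ∀ e ∈ G.edgeFinset, 0 < w e) :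
    marginalDensity G x B w * ((vw G w x / 2) ^ (-(vw G B x / 2)) * Gamma (vw G B x / 2)) =
      √(2 * π) ^ Fintype.card {v : V // v ≠ x} * (∏ e ∈ G.edgeFinset, Gamma (B e)) *
        magicDensity G x B w := by
  have hwv (v : V) : 0 < vw G w v := by
    obtain ⟨u, hu⟩ := hadj v
    exact vw_pos G hw hu
  have hb (v : V) : 0 < bwt G x B v := by
    obtain ⟨u, hu⟩ := hadj v
    exact bwt_pos G hB hu
  set N := Fintype.card {v : V // v ≠ x} with hN
  have hbx : bwt G x B x = vw G B x / 2 := by simp [bwt]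
  have hbi (i : {v : V // v ≠ x}) : bwt G x B i = (vw G B i + 1) / 2 := by simp [bwt, i.2]
  have hcard : (Fintype.card V : ℝ) = N + 1 := by
    rw [card_eq_card_ne_add_one x]; push_cast; rfl
  have hscale {v : V} {p : ℝ} : (vw G w v / 2) ^ (-p) = (2 : ℝ) ^ p * (vw G w v ^ p)⁻¹ := by
    rw [div_rpow (hwv v).le zero_le_two, rpow_neg zero_le_two, rpow_neg (hwv v).le]
    field_simp
  have h1 : ∏ i : {v : V // v ≠ x}, ((vw G w i / 2) ^ (-((vw G B i + 1) / 2)) *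
      Gamma ((vw G B i + 1) / 2) / 2) =
      (2 : ℝ) ^ (∑ i : {v : V // v ≠ x}, (vw G B i + 1) / 2) * ((2 : ℝ) ^ (N : ℝ))⁻¹ *
        (∏ i : {v : V // v ≠ x}, vw G w i ^ ((vw G B i + 1) / 2))⁻¹ *
        ∏ i : {v : V // v ≠ x}, Gamma ((vw G B i + 1) / 2) := by
    rw [rpow_sum_of_pos zero_lt_two, rpow_natCast, hN, Fintype.card, ← Finset.prod_const,
      ← Finset.prod_inv_distrib, ← Finset.prod_inv_distrib, ← Finset.prod_mul_distrib,
      ← Finset.prod_mul_distrib, ← Finset.prod_mul_distrib]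
    refine Finset.prod_congr rfl fun i _ => ?_
    rw [hscale]
    ring
  have h2 : vw G w x ^ ((vw G B x + 1) / 2) = vw G w x ^ (vw G B x / 2) * vw G w x ^ ((1 : ℝ) / 2) := by
    rw [← rpow_add (hwv x), add_div]
  have h3 : √(2 * π) ^ N = (2 : ℝ) ^ ((N : ℝ) / 2) * π ^ ((N : ℝ) / 2) := by
    rw [← mul_rpow zero_le_two pi_pos.le, rpow_div_two_eq_sqrt _ (by positivity), rpow_natCast]
  rw [marginalDensity, magicDensity, Znorm, prod_eq_root_mul x fun v => Gamma (bwt G x B v),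
    prod_eq_root_mul x fun v => vw G w v ^ ((vw G B v + 1) / 2), h1, h2, h3, hbx, hscale]
  simp only [hbi]
  rw [sum_vw_add_one_half, hcard, ← hN,
    show (1 : ℝ) - (N + 1) + ∑ e ∈ G.edgeFinset, B e = (∑ e ∈ G.edgeFinset, B e) - N by ring,
    rpow_add zero_lt_two, rpow_sub zero_lt_two, rpow_sub zero_lt_two, add_sub_cancel_right]
  have hx0 := (rpow_pos_of_pos (hwv x) (vw G B x / 2)).ne'
  have hx1 := (rpow_pos_of_pos (hwv x) ((1 : ℝ) / 2)).ne'
  have hg1 : ∏ e ∈ G.edgeFinset, Gamma (B e) ≠ 0 :=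
    (Finset.prod_pos fun e he => Gamma_pos_of_pos (hB e he)).ne'
  have hg2 : Gamma (vw G B x / 2) ≠ 0 := by rw [← hbx]; exact (Gamma_pos_of_pos (hb x)).ne'
  have hg3 : ∏ i : {v : V // v ≠ x}, Gamma ((vw G B i + 1) / 2) ≠ 0 :=
    (Finset.prod_pos fun i _ => by rw [← hbi]; exact Gamma_pos_of_pos (hb i)).ne'
  have hp := (rpow_pos_of_pos pi_pos ((N : ℝ) / 2)).ne'
  have hv : ∏ i : {v : V // v ≠ x}, vw G w i ^ ((vw G B i + 1) / 2) ≠ 0 :=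
    Finset.prod_ne_zero_iff.2 fun i _ => (rpow_pos_of_pos (hwv i) _).ne'
  generalize ∏ e ∈ G.edgeFinset, Gamma (B e) = g1 at *
  generalize Gamma (vw G B x / 2) = g2 at *
  generalize ∏ i : {v : V // v ≠ x}, Gamma ((vw G B i + 1) / 2) = g3 at *
  generalize π ^ ((N : ℝ) / 2) = pp at *
  generalize ∏ i : {v : V // v ≠ x}, vw G w i ^ ((vw G B i + 1) / 2) = vv at *
  generalize vw G w x ^ (vw G B x / 2) = x0 at *
  generalize vw G w x ^ ((1 : ℝ) / 2) = x1 at *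
  field_simp

/-- The magic formula density is normalized. -/
theorem lintegral_magicDensity (hG : G.Connected) {e0 : Sym2 V} (he0 : e0 ∈ G.edgeFinset)
    (hB : ∀ e ∈ G.edgeFinset, 0 < B e) :
    ∫⁻ k in orthant (Epin G e0), ENNReal.ofReal (magicDensity G x B (pinExt G e0 k)) = 1 := by
  have hadj := exists_adj G hG (SimpleGraph.mem_edgeFinset.1 he0)
  have h1 := lintegral_jointDensity G x hG hB
  rw [setLIntegral_congr_fun measurableSet_orthant fun w hw =>
    lintegral_jointDensity_potential G x hadj hB (edgeExt_pos hw)] at h1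
  have hm : Measurable fun w => ENNReal.ofReal
      (marginalDensity G x B w * exp (-(vw G w x / 2 * 1))) := by
    have h1 := measurable_marginalDensity G x B
    have h2 := measurable_vw G
    fun_prop
  rw [setLIntegral_orthant_edgeExt G he0 hm] at h1
  set Q := √(2 * π) ^ Fintype.card {v : V // v ≠ x} * (∏ e ∈ G.edgeFinset, Gamma (B e)) with hQ
  have hQ0 : 0 < Q := mul_pos (by positivity)
    (Finset.prod_pos fun e he => Gamma_pos_of_pos (hB e he))
  have h2 : ∀ k ∈ orthant (Epin G e0), ∫⁻ t in Set.Ioi 0,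
      ENNReal.ofReal (t ^ Fintype.card (Epin G e0)) *
      ENNReal.ofReal (marginalDensity G x B (t • pinExt G e0 k) *
        exp (-(vw G (t • pinExt G e0 k) x / 2 * 1))) =
      ENNReal.ofReal Q * ENNReal.ofReal (magicDensity G x B (pinExt G e0 k)) := fun k hk => by
    have hw := (pinExt_pos_iff G e0 k).2 hk
    set w := pinExt G e0 k
    have hx : 0 < vw G w x := by
      obtain ⟨u, hu⟩ := hadj x
      exact vw_pos G hw hu
    have hBx : 0 < vw G B x := by
      obtain ⟨u, hu⟩ := hadj x
      exact vw_pos G hB hu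
    have hS : 0 ≤ marginalDensity G x B w := by
      refine mul_nonneg (mul_nonneg (Finset.prod_nonneg fun e he => rpow_nonneg (hw e he).le _)
        (sqrt_nonneg _)) (Finset.prod_nonneg fun i _ => ?_)
      have h3 := vw_nonneg G (fun e he => (hw e he).le) i
      have h4 := vw_nonneg G (fun e he => (hB e he).le) i
      have := (Gamma_pos_of_pos (s := (vw G B i + 1) / 2) (by positivity)).le
      positivity
    have h3 : ∀ t ∈ Set.Ioi (0 : ℝ), ENNReal.ofReal (t ^ Fintype.card (Epin G e0)) *
        ENNReal.ofReal (marginalDensity G x B (t • w) * exp (-(vw G (t • w) x / 2 * 1))) =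
        ENNReal.ofReal (marginalDensity G x B w) *
          ENNReal.ofReal (t ^ (vw G B x / 2 - 1) * exp (-(vw G w x / 2 * t))) := fun t ht => by
      rw [← ENNReal.ofReal_mul (pow_nonneg (le_of_lt ht) _), ← ENNReal.ofReal_mul hS, ← mul_assoc,
        pow_mul_marginalDensity_smul G x he0 hw ht, vw_smul]
      congr 1
      rw [show t * vw G w x / 2 * 1 = vw G w x / 2 * t by ring]
      ring
    rw [setLIntegral_congr_fun measurableSet_Ioi h3, lintegral_const_mul' _ _ ENNReal.ofReal_ne_top,
      setLIntegral_rpow_mul_exp (half_pos hBx) (half_pos hx), ← ENNReal.ofReal_mul hS,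
      marginalDensity_mul_root G x hadj hB hw, ENNReal.ofReal_mul hQ0.le]
  rw [setLIntegral_congr_fun measurableSet_orthant h2,
    lintegral_const_mul' _ _ ENNReal.ofReal_ne_top, ← ENNReal.ofReal_pow (sqrt_nonneg _),
    ← ENNReal.ofReal_mul (by positivity), ← hQ] at h1
  exact (ENNReal.mul_eq_left (ENNReal.ofReal_pos.2 hQ0).ne' ENNReal.ofReal_ne_top).1 h1

end Normalization

section Divergence

/-- The mean of `log f` is at most the derivative at `0` of the moment function
`s ↦ ∫ f ^ s`. -/
theorem integral_log_le_of_hasDerivAt {Ω : Type*} [MeasurableSpace Ω] {μ : Measure Ω}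
    [IsProbabilityMeasure μ] {f : Ω → ℝ} (hf : Measurable f) (hpos : ∀ᵐ w ∂μ, 0 < f w)
    {H : ℝ → ℝ} {L : ℝ} (hH : HasDerivAt H L 0) (hH0 : H 0 = 1)
    (hm : ∀ᶠ s in nhds 0, ∫⁻ w, ENNReal.ofReal (f w ^ s) ∂μ = ENNReal.ofReal (H s)) :
    ∫ w, log (f w) ∂μ ≤ L := by
  have hint {s : ℝ} (hs : ∫⁻ w, ENNReal.ofReal (f w ^ s) ∂μ = ENNReal.ofReal (H s)) :
      Integrable (fun w => f w ^ s) μ := by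
    refine ⟨(by fun_prop : Measurable fun w => f w ^ s).aestronglyMeasurable, ?_⟩
    rw [hasFiniteIntegral_iff_ofReal (hpos.mono fun w hw => (rpow_pos_of_pos hw s).le), hs]
    exact ENNReal.ofReal_lt_top
  have hle {s : ℝ} {w : Ω} (hw : 0 < f w) : s * log (f w) ≤ f w ^ s - 1 := by
    rw [rpow_def_of_pos hw, mul_comm]
    linarith [add_one_le_exp (log (f w) * s)]
  have hneg : ∀ᶠ s in nhds (0 : ℝ),
      ∫⁻ w, ENNReal.ofReal (f w ^ (-s)) ∂μ = ENNReal.ofReal (H (-s)) := by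
    have : Tendsto (fun s : ℝ => -s) (nhds 0) (nhds 0) := by
      simpa using (continuous_neg (G := ℝ)).tendsto 0
    exact this.eventually hm
  have hlog : Integrable (fun w => log (f w)) μ := by
    obtain ⟨s, ⟨h1, h2⟩, hs⟩ := (((hm.and hneg).filter_mono nhdsWithin_le_nhds).and
      (self_mem_nhdsWithin (s := Set.Ioi (0 : ℝ)))).exists
    have hs : 0 < s := hs
    refine (((hint h1).add (hint h2)).div_const s).mono'
      (by fun_prop : Measurable fun w => log (f w)).aestronglyMeasurable ?_
    filter_upwards [hpos] with w hw
    have h3 := hle (s := s) hw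
    have h4 := hle (s := -s) hw
    have h5 := rpow_pos_of_pos hw s
    have h6 := rpow_pos_of_pos hw (-s)
    rw [norm_eq_abs, le_div_iff₀ hs, ← abs_of_pos hs, ← abs_mul, abs_of_pos hs]
    simp only [Pi.add_apply]
    rw [abs_le]
    constructor <;> linarith
  have hslope : Tendsto (slope H 0) (nhdsWithin 0 (Set.Ioi 0)) (nhds L) :=
    (hasDerivAt_iff_tendsto_slope.1 hH).mono_left
      (nhdsWithin_mono _ fun s hs => ne_of_gt (Set.mem_Ioi.1 hs))
  have hHpos : ∀ᶠ s in nhds 0, 0 < H s :=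
    hH.continuousAt.eventually (by rw [hH0]; exact lt_mem_nhds one_pos)
  refine ge_of_tendsto hslope ?_
  filter_upwards [(hm.and hHpos).filter_mono nhdsWithin_le_nhds, self_mem_nhdsWithin]
    with s ⟨hs, hHs⟩ hs0
  have hs0 : 0 < s := hs0
  have h1 : ∫ w, f w ^ s ∂μ = H s := by
    rw [integral_eq_lintegral_of_nonneg_ae (hpos.mono fun w hw => (rpow_pos_of_pos hw s).le)
      (hint hs).aestronglyMeasurable, hs, ENNReal.toReal_ofReal hHs.le]
  have h2 : ∫ w, s * log (f w) ∂μ ≤ ∫ w, (f w ^ s - 1) ∂μ :=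
    integral_mono_ae (hlog.const_mul s) ((hint hs).sub (integrable_const 1))
      (hpos.mono fun w hw => hle hw)
  rw [integral_const_mul, integral_sub (hint hs) (integrable_const 1), h1] at h2
  simp only [integral_const, probReal_univ, smul_eq_mul, mul_one] at h2
  rw [slope_def_field, hH0, sub_zero, le_div_iff₀ hs0]
  linarith

variable (G : SimpleGraph V) [DecidableRel G.Adj] (x : V)

theorem measurable_magicDensity (B : Sym2 V → ℝ) : Measurable (magicDensity G x B) := by
  have h1 := measurable_vw G
  have h2 := measurable_tau G
  unfold magicDensity
  fun_prop

theorem lintegral_mixing (e0 : Sym2 V) (B : Sym2 V → ℝ) {F : (Sym2 V → ℝ) → ℝ≥0∞}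
    (hF : Measurable F) :
    ∫⁻ w, F w ∂(mixing G e0 x B) = ∫⁻ k in orthant (Epin G e0),
      ENNReal.ofReal (magicDensity G x B (pinExt G e0 k)) * F (pinExt G e0 k) := by
  have hp := measurable_pinExt G e0
  have hd : Measurable fun k => ENNReal.ofReal (magicDensity G x B (pinExt G e0 k)) :=
    ((measurable_magicDensity G x B).comp hp).ennreal_ofReal
  have h : (fun u => ENNReal.ofReal (if ∀ e ∈ G.edgeFinset, 0 < pinExt G e0 u e then
      magicDensity G x B (pinExt G e0 u) else 0)) = (orthant (Epin G e0)).indicator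
      fun k => ENNReal.ofReal (magicDensity G x B (pinExt G e0 k)) := by
    funext u
    simp only [pinExt_pos_iff, Set.indicator]
    split_ifs <;> simp
  unfold mixing
  rw [h, lintegral_map hF hp, withDensity_indicator measurableSet_orthant,
    lintegral_withDensity_eq_lintegral_mul (volume.restrict (orthant (Epin G e0))) hd
      (g := fun k => F (pinExt G e0 k)) (hF.comp hp)]
  rfl

theorem isProbabilityMeasure_mixing (hG : G.Connected) {e0 : Sym2 V} (he0 : e0 ∈ G.edgeFinset)
    {B : Sym2 V → ℝ} (hB : ∀ e ∈ G.edgeFinset, 0 < B e) :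
    IsProbabilityMeasure (mixing G e0 x B) := by
  refine ⟨?_⟩
  rw [← lintegral_one, lintegral_mixing G x e0 B measurable_const]
  simpa using lintegral_magicDensity G x hG he0 hB

theorem ae_mixing_pos (e0 : Sym2 V) (B : Sym2 V → ℝ) :
    ∀ᵐ w ∂(mixing G e0 x B), ∀ e ∈ G.edgeFinset, 0 < w e := by
  have hs : MeasurableSet {w : Sym2 V → ℝ | ∀ e ∈ G.edgeFinset, 0 < w e} := by
    rw [show {w : Sym2 V → ℝ | ∀ e ∈ G.edgeFinset, 0 < w e} =
      ⋂ e ∈ G.edgeFinset, {w | 0 < w e} by ext w; simp]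
    exact Finset.measurableSet_biInter _ fun e _ =>
      measurableSet_lt measurable_const (measurable_pi_apply e)
  rw [ae_iff, ← Set.compl_ofPred, ← lintegral_indicator_one hs.compl,
    lintegral_mixing G x e0 B (measurable_one.indicator hs.compl)]
  rw [setLIntegral_congr_fun (g := 0) measurableSet_orthant fun k hk => ?_]
  · simp
  · have := (pinExt_pos_iff G e0 k).2 hk
    simp only [Pi.zero_apply]
    rw [Set.indicator_of_notMem, mul_zero]
    simpa using this

/-- The weight monomial by which the magic density changes when the initial weights are
shifted by `D`, up to normalization. -/
def shiftFactor (D w : Sym2 V → ℝ) : ℝ :=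
  (∏ e ∈ G.edgeFinset, w e ^ D e) * ∏ v, vw G w v ^ (-(vw G D v / 2))

theorem measurable_shiftFactor (D : Sym2 V → ℝ) : Measurable (shiftFactor G D) := by
  have h1 := measurable_vw G
  unfold shiftFactor
  fun_prop

theorem vw_add (A D : Sym2 V → ℝ) (v : V) : vw G (A + D) v = vw G A v + vw G D v := by
  simp [vw, Finset.sum_add_distrib]

theorem bwt_add_smul (A D : Sym2 V → ℝ) (s : ℝ) (v : V) :
    bwt G x (A + s • D) v = bwt G x A v + s * (vw G D v / 2) := by
  unfold bwt
  rw [vw_add, vw_smul]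
  ring

variable {G} in
theorem shiftFactor_pos (hadj : ∀ v, ∃ u, G.Adj v u) (D : Sym2 V → ℝ) {w : Sym2 V → ℝ}
    (hw : ∀ e ∈ G.edgeFinset, 0 < w e) : 0 < shiftFactor G D w := by
  refine mul_pos (Finset.prod_pos fun e he => rpow_pos_of_pos (hw e he) _)
    (Finset.prod_pos fun v _ => rpow_pos_of_pos ?_ _)
  obtain ⟨u, hu⟩ := hadj v
  exact vw_pos G hw hu

theorem magicDensity_mul_shiftFactor_rpow (hadj : ∀ v, ∃ u, G.Adj v u) {A D : Sym2 V → ℝ} {s : ℝ}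
    (hAD : ∀ e ∈ G.edgeFinset, 0 < (A + s • D) e)
    {w : Sym2 V → ℝ} (hw : ∀ e ∈ G.edgeFinset, 0 < w e) :
    magicDensity G x A w * shiftFactor G D w ^ s =
      Znorm G x (A + s • D) / Znorm G x A * magicDensity G x (A + s • D) w := by
  have hwv (v : V) : 0 < vw G w v := by
    obtain ⟨u, hu⟩ := hadj v
    exact vw_pos G hw hu
  have hZ := (Znorm_pos G hadj hAD x).ne'
  have h1 : ∏ e ∈ G.edgeFinset, w e ^ ((A + s • D) e - 1) =
      (∏ e ∈ G.edgeFinset, w e ^ (A e - 1)) * (∏ e ∈ G.edgeFinset, w e ^ D e) ^ s := by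
    rw [← finsetProd_rpow _ _ fun e he => (rpow_pos_of_pos (hw e he) _).le,
      ← Finset.prod_mul_distrib]
    refine Finset.prod_congr rfl fun e he => ?_
    rw [← rpow_mul (hw e he).le, ← rpow_add (hw e he)]
    congr 1
    simp only [Pi.add_apply, Pi.smul_apply, smul_eq_mul]
    ring
  have h2 : (∏ v, vw G w v ^ ((vw G (A + s • D) v + 1) / 2))⁻¹ =
      (∏ v, vw G w v ^ ((vw G A v + 1) / 2))⁻¹ * (∏ v, vw G w v ^ (-(vw G D v / 2))) ^ s := by
    rw [← finsetProd_rpow _ _ fun v _ => (rpow_pos_of_pos (hwv v) _).le,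
      ← Finset.prod_inv_distrib, ← Finset.prod_inv_distrib, ← Finset.prod_mul_distrib]
    refine Finset.prod_congr rfl fun v _ => ?_
    rw [← rpow_mul (hwv v).le, ← rpow_neg (hwv v).le, ← rpow_neg (hwv v).le, ← rpow_add (hwv v)]
    congr 1
    rw [vw_add, vw_smul]
    ring
  rw [magicDensity, magicDensity, div_eq_mul_inv _ (∏ v, vw G w v ^ ((vw G (A + s • D) v + 1) / 2)),
    h1, h2, shiftFactor, mul_rpow
      (Finset.prod_nonneg fun e he => (rpow_pos_of_pos (hw e he) _).le)
      (Finset.prod_nonneg fun v _ => (rpow_pos_of_pos (hwv v) _).le)]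
  field_simp

theorem hasDerivAt_log_Znorm (hadj : ∀ v, ∃ u, G.Adj v u) {A : Sym2 V → ℝ}
    (hA : ∀ e ∈ G.edgeFinset, 0 < A e) (D : Sym2 V → ℝ) :
    HasDerivAt (fun s : ℝ => log (Znorm G x (A + s • D)))
      (∑ e ∈ G.edgeFinset, D e * digamma (A e) -
        ∑ v, vw G D v / 2 * digamma (bwt G x A v) - log 2 * ∑ e ∈ G.edgeFinset, D e) 0 := by
  have hlin (p d : ℝ) (hp : 0 < p) :
      HasDerivAt (fun s : ℝ => log (Gamma (p + s * d))) (d * digamma p) 0 := by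
    have h1 : HasDerivAt (fun s : ℝ => p + s * d) d 0 := by
      simpa using ((hasDerivAt_id (0 : ℝ)).mul_const d).const_add p
    have h2 : HasDerivAt (fun y => log (Gamma y)) (digamma p) (p + 0 * d) := by
      simpa using hasDerivAt_log_Gamma hp
    exact (h2.comp (0 : ℝ) h1).congr_deriv (mul_comm _ _)
  have hb (v : V) : 0 < bwt G x A v := by
    obtain ⟨u, hu⟩ := hadj v
    exact bwt_pos G hA hu
  have hev : ∀ᶠ s in nhds (0 : ℝ), ∀ e ∈ G.edgeFinset, 0 < (A + s • D) e := by
    rw [Filter.eventually_all_finset]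
    intro e he
    have : ContinuousAt (fun s : ℝ => A e + s * D e) 0 := by fun_prop
    exact this.eventually (lt_mem_nhds (by simpa using hA e he))
  have hd := ((HasDerivAt.fun_sum fun e he => hlin (A e) (D e) (hA e he)).sub
    (HasDerivAt.fun_sum fun v (_ : v ∈ Finset.univ) => hlin (bwt G x A v) (vw G D v / 2) (hb v))).add
    ((((hasDerivAt_id (0 : ℝ)).mul_const (∑ e ∈ G.edgeFinset, D e)).const_add
      (∑ e ∈ G.edgeFinset, A e)).const_mul (log 2) |>.const_sub
      ((((Fintype.card V : ℝ) - 1) / 2) * log π - (1 - (Fintype.card V : ℝ)) * log 2))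
  refine (hd.congr_of_eventuallyEq ?_).congr_deriv (by ring)
  filter_upwards [hev] with s hs
  rw [log_Znorm G hadj hs]
  simp only [bwt_add_smul, Pi.add_apply, Pi.smul_apply, smul_eq_mul, Finset.sum_add_distrib,
    ← Finset.mul_sum, id, Pi.sub_apply]

theorem Phi_eq (hadj : ∀ v, ∃ u, G.Adj v u) {A B : Sym2 V → ℝ}
    (hA : ∀ e ∈ G.edgeFinset, 0 < A e) (hB : ∀ e ∈ G.edgeFinset, 0 < B e) :
    Phi G x A B = ∑ e ∈ G.edgeFinset, (A - B) e * digamma (A e) -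
        ∑ v, vw G (A - B) v / 2 * digamma (bwt G x A v) - log 2 * ∑ e ∈ G.edgeFinset, (A - B) e +
        (log (Znorm G x B) - log (Znorm G x A)) := by
  have h (v : V) : vw G (A - B) v / 2 = bwt G x A v - bwt G x B v := by
    simp only [vw, bwt, Pi.sub_apply, Finset.sum_sub_distrib]
    ring
  rw [log_Znorm G hadj hA, log_Znorm G hadj hB, Phi]
  simp only [h, Lam, Pi.sub_apply, Finset.sum_sub_distrib, sub_mul]
  ring

theorem KL_mixing_le_Phi (hG : G.Connected) {e0 : Sym2 V} (he0 : e0 ∈ G.edgeFinset)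
    {a0 a1 : Sym2 V → ℝ} (ha0 : ∀ e ∈ G.edgeFinset, 0 < a0 e)
    (ha1 : ∀ e ∈ G.edgeFinset, 0 < a1 e) :
    KL (mixing G e0 x a0) (mixing G e0 x a1) ≤ ((Phi G x a0 a1 : ℝ) : EReal) := by
  have hadj := exists_adj G hG (SimpleGraph.mem_edgeFinset.1 he0)
  have hZ0 := Znorm_pos G hadj ha0 x
  have hZ1 := Znorm_pos G hadj ha1 x
  set c := Znorm G x a1 / Znorm G x a0 with hc
  have hc0 : 0 < c := div_pos hZ1 hZ0
  set f : (Sym2 V → ℝ) → ℝ := fun w => c * shiftFactor G (a0 - a1) w with hfdef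
  have hfm : Measurable f := (measurable_shiftFactor G _).const_mul c
  have hfpos {w : Sym2 V → ℝ} (hw : ∀ e ∈ G.edgeFinset, 0 < w e) : 0 < f w :=
    mul_pos hc0 (shiftFactor_pos hadj _ hw)
  have hdens : mixing G e0 x a0 =
      (mixing G e0 x a1).withDensity fun w => ENNReal.ofReal (f w) := by
    refine Measure.ext_of_lintegral _ fun F hF => ?_
    rw [lintegral_withDensity_eq_lintegral_mul _ hfm.ennreal_ofReal hF,
      lintegral_mixing G x e0 a0 hF, lintegral_mixing G x e0 a1 (hfm.ennreal_ofReal.mul hF)]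
    refine setLIntegral_congr_fun measurableSet_orthant fun k hk => ?_
    have hw := (pinExt_pos_iff G e0 k).2 hk
    have h1 : a1 + (1 : ℝ) • (a0 - a1) = a0 := by simp
    have h2 := magicDensity_mul_shiftFactor_rpow G x hadj (D := a0 - a1) (s := 1)
      (by rwa [h1]) hw
    rw [h1, rpow_one] at h2
    simp only [Pi.mul_apply]
    rw [← mul_assoc, ← ENNReal.ofReal_mul' (hfpos hw).le]
    congr 2
    rw [hfdef]
    simp only
    rw [mul_left_comm, h2, hc]
    field_simp
  have hac : mixing G e0 x a0 ≪ mixing G e0 x a1 := by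
    rw [hdens]; exact withDensity_absolutelyContinuous _ _
  let _ := isProbabilityMeasure_mixing G x hG he0 ha0
  let _ := isProbabilityMeasure_mixing G x hG he0 ha1
  have hpos := ae_mixing_pos G x e0 a0
  have hrn : (mixing G e0 x a0).rnDeriv (mixing G e0 x a1)
      =ᵐ[mixing G e0 x a0] fun w => ENNReal.ofReal (f w) := by
    refine hac.ae_le ?_
    rw [hdens]
    exact Measure.rnDeriv_withDensity _ hfm.ennreal_ofReal
  unfold KL
  rw [if_pos hac, EReal.coe_le_coe_iff]
  have hint : ∫ w, log ((mixing G e0 x a0).rnDeriv (mixing G e0 x a1) w).toReal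
      ∂(mixing G e0 x a0) = ∫ w, log (f w) ∂(mixing G e0 x a0) := by
    refine integral_congr_ae ?_
    filter_upwards [hrn, hpos] with w h1 h2
    rw [h1, ENNReal.toReal_ofReal (hfpos h2).le]
  rw [hint]
  set D := a0 - a1 with hD
  have hd := (((hasDerivAt_log_Znorm G x hadj ha0 D).add
    ((hasDerivAt_id (0 : ℝ)).mul_const (log (Znorm G x a1) - log (Znorm G x a0)))).sub_const
    (log (Znorm G x a0))).exp
  simp only [Pi.add_apply, id, zero_smul, add_zero, zero_mul, sub_self, exp_zero, one_mul] at hd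
  rw [Phi_eq G x hadj ha0 ha1]
  refine integral_log_le_of_hasDerivAt hfm (hpos.mono fun w hw => hfpos hw) hd (by simp) ?_
  have hev : ∀ᶠ s in nhds (0 : ℝ), ∀ e ∈ G.edgeFinset, 0 < (a0 + s • D) e := by
    rw [Filter.eventually_all_finset]
    intro e he
    have : ContinuousAt (fun s : ℝ => a0 e + s * D e) 0 := by fun_prop
    exact this.eventually (lt_mem_nhds (by simpa using ha0 e he))
  filter_upwards [hev] with s hs
  have hZs := Znorm_pos G hadj hs x
  have hval : exp (log (Znorm G x (a0 + s • D)) +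
      s * (log (Znorm G x a1) - log (Znorm G x a0)) - log (Znorm G x a0)) =
      c ^ s * (Znorm G x (a0 + s • D) / Znorm G x a0) := by
    rw [rpow_def_of_pos hc0, hc, log_div hZ1.ne' hZ0.ne', add_sub_right_comm, exp_add, exp_sub,
      exp_log hZs, exp_log hZ0, mul_comm s]
    ring
  rw [hval, lintegral_mixing G x e0 a0 (hfm.pow_const s).ennreal_ofReal,
    setLIntegral_congr_fun (g := fun k => ENNReal.ofReal
      (c ^ s * (Znorm G x (a0 + s • D) / Znorm G x a0)) *
      ENNReal.ofReal (magicDensity G x (a0 + s • D) (pinExt G e0 k))) measurableSet_orthant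
      fun k hk => ?_,
    lintegral_const_mul' _ _ ENNReal.ofReal_ne_top, lintegral_magicDensity G x hG he0 hs, mul_one]
  have hw := (pinExt_pos_iff G e0 k).2 hk
  simp only
  rw [← ENNReal.ofReal_mul' (rpow_pos_of_pos (hfpos hw) s).le,
    ← ENNReal.ofReal_mul (mul_pos (rpow_pos_of_pos hc0 s) (div_pos hZs hZ0)).le]
  congr 1
  rw [hfdef]
  simp only
  rw [mul_rpow hc0.le (shiftFactor_pos hadj D hw).le, mul_left_comm,
    magicDensity_mul_shiftFactor_rpow G x hadj hs hw, mul_assoc]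

end Divergence

/-- Decay of the trajectory-level KL gap.  With `μ_s = μ_{v0,A⁽ˢ⁾}`,
`P_s^{(T)}` the ERRW trajectory laws, `Gap_T := D(μ_0‖μ_1) − D(P_0^{(T)}‖P_1^{(T)})` and
`ā := min_e min{a_e⁽⁰⁾, a_e⁽¹⁾} > 0`:
(i) if `ā ≤ 4 + 2√5`, for every `0 < r < min{ā/8, 3/4}` there is `C_r < ∞` with
`Gap_T ≤ C_r·T^{−r}` for all `T ≥ 1`;
(ii) if `ā > 4 + 2√5`, there is `C < ∞` with `Gap_T ≤ C/T` for all `T ≥ 1`. -/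
theorem gap_decay
    {V : Type*} [Fintype V] [DecidableEq V] [MeasurableSpace V] [DiscreteMeasurableSpace V]
    (G : SimpleGraph V) [DecidableRel G.Adj] (hG : G.Connected)
    (v0 : V) (e0 : Sym2 V) (he0 : e0 ∈ G.edgeFinset)
    (a0 a1 : Sym2 V → ℝ)
    (ha0 : ∀ e ∈ G.edgeFinset, 0 < a0 e) (ha1 : ∀ e ∈ G.edgeFinset, 0 < a1 e)
    (abar : ℝ) (habar : abar = G.edgeFinset.inf' ⟨e0, he0⟩ fun e => min (a0 e) (a1 e)) :
    ((abar ≤ 4 + 2 * Real.sqrt 5 →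
      ∀ r : ℝ, 0 < r → r < min (abar / 8) (3 / 4) →
        ∃ C : ℝ, ∀ T : ℕ, 1 ≤ T →
          KL (mixing G e0 v0 a0) (mixing G e0 v0 a1)
              - KL (discreteMeasure (errwProb G v0 a0 T))
                  (discreteMeasure (errwProb G v0 a1 T))
            ≤ ((C * (T : ℝ) ^ (-r) : ℝ) : EReal)) ∧
     (4 + 2 * Real.sqrt 5 < abar →
      ∃ C : ℝ, ∀ T : ℕ, 1 ≤ T →
        KL (mixing G e0 v0 a0) (mixing G e0 v0 a1)
            - KL (discreteMeasure (errwProb G v0 a0 T))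
                (discreteMeasure (errwProb G v0 a1 T))
          ≤ ((C / T : ℝ) : EReal))) := by
  have hle (e : Sym2 V) (he : e ∈ G.edgeFinset) : abar ≤ a0 e := by
    rw [habar]
    exact (Finset.inf'_le _ he).trans (min_le_left _ _)
  have hadj := exists_adj G hG (SimpleGraph.mem_edgeFinset.1 he0)
  have key {r : ℝ} (hr : 0 < r) (hr1 : r ≤ 1) (hra : 4 * r < abar) :
      ∃ C : ℝ, ∀ T : ℕ, 1 ≤ T →
        KL (mixing G e0 v0 a0) (mixing G e0 v0 a1)
            - KL (discreteMeasure (errwProb G v0 a0 T)) (discreteMeasure (errwProb G v0 a1 T))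
          ≤ ((C * (T : ℝ) ^ (-r) : ℝ) : EReal) := by
    obtain ⟨C, hC⟩ := exists_Phi_sub_le G hG hadj v0 ha1 hr hr1
      fun e he => hra.trans_le (hle e he)
    refine ⟨C, fun T hT => ?_⟩
    rw [KL_discreteMeasure (errwProb_nonneg v0 G hadj ha0) (errwProb_nonneg v0 G hadj ha1)
      fun x hx => ?_]
    · refine (EReal.sub_le_sub (KL_mixing_le_Phi G v0 hG he0 ha0 ha1) le_rfl).trans ?_
      rw [← EReal.coe_sub, EReal.coe_le_coe_iff]
      exact hC T hT
    · by_contra h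
      have hadm : Admissible v0 G x := by
        by_contra h2
        exact h (by rw [errwProb_eq v0 G hadj ha0, if_neg h2])
      exact (errwProb_pos v0 G hadj ha1 hadm).ne' hx
  refine ⟨fun _ r hr hr1 => ?_, fun h => ?_⟩
  · have h1 := hr1.trans_le (min_le_left _ _)
    have h2 := hr1.trans_le (min_le_right _ _)
    exact key hr (by linarith) (by linarith)
  · obtain ⟨C, hC⟩ := key one_pos le_rfl (by linarith [sqrt_pos.2 (by norm_num : (0 : ℝ) < 5)])
    refine ⟨C, fun T hT => ?_⟩
    simpa only [rpow_neg_one, div_eq_mul_inv] using hC T hT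

end ERRW
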